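/- arXiv:1808.04466 — 3 statements merged into one kernel-verified Lean document; each statement's English description precedes it below -/
import Mathlib

section
/- Let E be a directed graph with E⁰ finite and K a field, and let L = L_K(E) be the (unital) Leavitt path algebra. Then every simple left L-module is flat if and only if L is von Neumann regular (for every a ∈ L there exists b ∈ L with a = aba). -/
/-- Generators for the Leavitt path algebra of a directed graph: one generator for each
vertex `v`, each edge `e`, and each ghost edge `e*`. -/
inductive LPAGen (V E : Type) : Type
  | vertex : V → LPAGen V E
  | edge : E → LPAGen V E
  | ghost : E → LPAGen V E

/-- The defining relations of the (unital) Leavitt path algebra of a directed graph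
`(V, E, s, r)` with finitely many vertices, imposed on the free unital `K`-algebra on the
generators; the relation `unit` makes the identity equal to the sum of the vertices. -/
inductive LPARel (K : Type) [Field K] (V E : Type) [Fintype V] (s r : E → V) :
    FreeAlgebra K (LPAGen V E) → FreeAlgebra K (LPAGen V E) → Prop
  | vertex_orth (v w : V) (h : v ≠ w) :
      LPARel K V E s r (FreeAlgebra.ι K (LPAGen.vertex v) * FreeAlgebra.ι K (LPAGen.vertex w)) 0
  | vertex_idem (v : V) :
      LPARel K V E s r (FreeAlgebra.ι K (LPAGen.vertex v) * FreeAlgebra.ι K (LPAGen.vertex v))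
        (FreeAlgebra.ι K (LPAGen.vertex v))
  | edge_src (e : E) :
      LPARel K V E s r (FreeAlgebra.ι K (LPAGen.vertex (s e)) * FreeAlgebra.ι K (LPAGen.edge e))
        (FreeAlgebra.ι K (LPAGen.edge e))
  | edge_rng (e : E) :
      LPARel K V E s r (FreeAlgebra.ι K (LPAGen.edge e) * FreeAlgebra.ι K (LPAGen.vertex (r e)))
        (FreeAlgebra.ι K (LPAGen.edge e))
  | ghost_rng (e : E) :
      LPARel K V E s r (FreeAlgebra.ι K (LPAGen.vertex (r e)) * FreeAlgebra.ι K (LPAGen.ghost e))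
        (FreeAlgebra.ι K (LPAGen.ghost e))
  | ghost_src (e : E) :
      LPARel K V E s r (FreeAlgebra.ι K (LPAGen.ghost e) * FreeAlgebra.ι K (LPAGen.vertex (s e)))
        (FreeAlgebra.ι K (LPAGen.ghost e))
  | ck1_distinct (e f : E) (h : e ≠ f) :
      LPARel K V E s r (FreeAlgebra.ι K (LPAGen.ghost e) * FreeAlgebra.ι K (LPAGen.edge f)) 0
  | ck1_same (e : E) :
      LPARel K V E s r (FreeAlgebra.ι K (LPAGen.ghost e) * FreeAlgebra.ι K (LPAGen.edge e))
        (FreeAlgebra.ι K (LPAGen.vertex (r e)))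
  | ck2 (v : V) (h : {e : E | s e = v}.Finite) (hne : {e : E | s e = v}.Nonempty) :
      LPARel K V E s r (FreeAlgebra.ι K (LPAGen.vertex v))
        (∑ e ∈ h.toFinset, FreeAlgebra.ι K (LPAGen.edge e) * FreeAlgebra.ι K (LPAGen.ghost e))
  | unit :
      LPARel K V E s r 1 (∑ v : V, FreeAlgebra.ι K (LPAGen.vertex v))

/-- The unital Leavitt path algebra `L_K(E)` of a directed graph with finitely many
vertices, as the quotient of the free unital `K`-algebra on the generators by the
defining relations. -/
abbrev LeavittPathAlgebra (K : Type) [Field K] (V E : Type) [Fintype V] (s r : E → V) :=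
  RingQuot (LPARel K V E s r)


/-- A left module `M` over a (possibly noncommutative) ring `R` is flat, expressed via the
standard equational criterion: whenever `∑ i, c i • m i = 0` with `c i ∈ R`, `m i ∈ M`,
there are finitely many `y j ∈ M` and scalars `a i j ∈ R` with `∑ i, c i * a i j = 0` for
all `j` and `m i = ∑ j, a i j • y j` for all `i`. -/
def IsFlatModule (R M : Type) [Ring R] [AddCommGroup M] [Module R M] : Prop :=
  ∀ (n : ℕ) (c : Fin n → R) (m : Fin n → M), ∑ i, c i • m i = 0 →
    ∃ (k : ℕ) (a : Fin n → Fin k → R) (y : Fin k → M),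
      (∀ j, ∑ i, c i * a i j = 0) ∧ ∀ i, m i = ∑ j, a i j • y j


/-- A ring is von Neumann regular once it is semisimple. -/
theorem lpa_regular_of_semisimple (R : Type) [Ring R] [IsSemisimpleModule R R] (a : R) :
    ∃ b : R, a = a * b * a := by
  obtain ⟨J, hJ⟩ := exists_isCompl (Submodule.span R {a})
  have h1 : (1 : R) ∈ Submodule.span R {a} ⊔ J := by rw [hJ.sup_eq_top]; trivial
  obtain ⟨y, hy, z, hz, hyz⟩ := Submodule.mem_sup.1 h1
  obtain ⟨b, rfl⟩ := Submodule.mem_span_singleton.1 hy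
  refine ⟨b, ?_⟩
  have h2 : a * z = a - a * b * a := by
    have : a * (b • a + z) = a := by rw [hyz, mul_one]
    rw [mul_add, smul_eq_mul, ← mul_assoc] at this
    exact eq_sub_of_add_eq' this
  have h3 : a * z ∈ J := J.smul_mem a hz
  have h4 : a * z ∈ Submodule.span R {a} := by
    rw [h2]
    exact Submodule.sub_mem _ (Submodule.mem_span_singleton_self a)
      (Submodule.smul_mem _ (a * b) (Submodule.mem_span_singleton_self a))
  have h5 := (Submodule.disjoint_def.1 hJ.disjoint) _ h4 h3
  rw [h2] at h5
  exact sub_eq_zero.1 h5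

theorem lpa_ss_zero (A : Type) [Ring A] :
    IsSemisimpleModule A (Submodule.span A {(0 : A)}) := by
  have : Subsingleton (Submodule.span A {(0 : A)}) := by
    rw [Submodule.span_zero_singleton]; infer_instance
  rw [isSemisimpleModule_iff]
  refine ⟨fun a => ⟨a, ?_⟩⟩
  have h1 : a = ⊥ := Subsingleton.elim _ _
  have h2 : (⊥ : Submodule A (Submodule.span A {(0 : A)})) = ⊤ := Subsingleton.elim _ _
  rw [h1]
  nth_rewrite 2 [h2]
  exact isCompl_bot_top

/-- Cohn family of a graph in an algebra. -/
structure LPACohn (A V E : Type) [Ring A] [Fintype V] (s r : E → V) where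
  P : V → A
  S : E → A
  T : E → A
  orth : ∀ v w, v ≠ w → P v * P w = 0
  idem : ∀ v, P v * P v = P v
  PS : ∀ e, P (s e) * S e = S e
  SP : ∀ e, S e * P (r e) = S e
  PT : ∀ e, P (r e) * T e = T e
  TP : ∀ e, T e * P (s e) = T e
  TS0 : ∀ e f, e ≠ f → T e * S f = 0
  TS1 : ∀ e, T e * S e = P (r e)
  one : ∑ v, P v = 1

/-- Elements obtained from `f` by left multiplication with paths. -/
inductive LPAPath {A E : Type} [Ring A] (S : E → A) (f : A) : A → Prop
  | base : LPAPath S f f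
  | step (e : E) (x : A) : LPAPath S f x → LPAPath S f (S e * x)

namespace LPACohn

variable {K A V E : Type} [Field K] [Ring A] [Algebra K A] [Fintype V] [DecidableEq V]
  [Fintype E] {s r : E → V} (F : LPACohn A V E s r)

/-- The gap projection. -/
def gap (v : V) : A := F.P v - ∑ e : E, if s e = v then F.S e * F.T e else 0

theorem PS0 (v : V) (e : E) (h : v ≠ s e) : F.P v * F.S e = 0 := by
  rw [← F.PS, ← mul_assoc, F.orth _ _ h, zero_mul]

theorem TP0 (v : V) (e : E) (h : s e ≠ v) : F.T e * F.P v = 0 := by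
  rw [← F.TP, mul_assoc, F.orth _ _ h, mul_zero]

theorem P_gap (v : V) : F.P v * F.gap v = F.gap v := by
  rw [gap, mul_sub, F.idem, Finset.mul_sum]
  congr 1
  refine Finset.sum_congr rfl fun e _ => ?_
  split_ifs with h
  · subst h; rw [← mul_assoc, F.PS]
  · simp

theorem P_gap0 (v w : V) (h : w ≠ v) : F.P w * F.gap v = 0 := by
  rw [← F.P_gap, ← mul_assoc, F.orth _ _ h, zero_mul]

theorem gap_P (v : V) : F.gap v * F.P v = F.gap v := by
  rw [gap, sub_mul, F.idem, Finset.sum_mul]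
  congr 1
  refine Finset.sum_congr rfl fun e _ => ?_
  split_ifs with h
  · subst h; rw [mul_assoc, F.TP]
  · simp

theorem gap_S (v : V) (e : E) : F.gap v * F.S e = 0 := by
  classical
  rw [gap, sub_mul, Finset.sum_mul, Finset.sum_eq_single e]
  · split_ifs with h
    · subst h; rw [F.PS, mul_assoc, F.TS1, F.SP, sub_self]
    · rw [F.PS0 _ _ (Ne.symm h)]; simp
  · intro f _ hf
    split_ifs
    · rw [mul_assoc, F.TS0 _ _ hf, mul_zero]
    · simp
  · simp

theorem T_gap (v : V) (e : E) : F.T e * F.gap v = 0 := by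
  classical
  rw [gap, mul_sub, Finset.mul_sum, Finset.sum_eq_single e]
  · split_ifs with h
    · subst h; rw [F.TP, ← mul_assoc, F.TS1, F.PT, sub_self]
    · rw [F.TP0 _ _ h]; simp
  · intro f _ hf
    split_ifs
    · rw [← mul_assoc, F.TS0 _ _ hf.symm, zero_mul]
    · simp
  · simp

theorem gap_idem (v : V) : F.gap v * F.gap v = F.gap v := by
  nth_rewrite 2 [gap]
  rw [mul_sub, F.gap_P, Finset.mul_sum, Finset.sum_eq_zero, sub_zero]
  intro e _
  split_ifs
  · rw [← mul_assoc, F.gap_S, zero_mul]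
  · simp

theorem gap_gap0 (v w : V) (h : w ≠ v) : F.gap w * F.gap v = 0 := by
  rw [← F.gap_P, mul_assoc, F.P_gap0 _ _ h, mul_zero]

/-- The generators. -/
def gens : Set A := Set.range F.P ∪ Set.range F.S ∪ Set.range F.T

theorem P_path {f : A} (hf : ∀ w, F.P w * f = 0 ∨ F.P w * f = f) (w : V) {x : A}
    (hx : LPAPath F.S f x) : F.P w * x ∈ Submodule.span K {y | LPAPath F.S f y} := by
  cases hx with
  | base =>
    rcases hf w with h | h <;> rw [h]
    · exact Submodule.zero_mem _
    · exact Submodule.subset_span LPAPath.base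
  | step e x hx =>
    rw [← mul_assoc]
    by_cases h : w = s e
    · subst h; rw [F.PS]; exact Submodule.subset_span (LPAPath.step e x hx)
    · rw [F.PS0 _ _ h, zero_mul]; exact Submodule.zero_mem _

theorem left_ideal (hg : Algebra.adjoin K F.gens = ⊤) (v : V) (a : A) :
    ∀ x ∈ Submodule.span K {y | LPAPath F.S (F.gap v) y},
      a * x ∈ Submodule.span K {y | LPAPath F.S (F.gap v) y} := by
  classical
  have hf : ∀ w, F.P w * F.gap v = 0 ∨ F.P w * F.gap v = F.gap v := by
    intro w
    by_cases h : w = v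
    · subst h; exact Or.inr (F.P_gap w)
    · exact Or.inl (F.P_gap0 _ _ h)
  have ha : a ∈ Algebra.adjoin K F.gens := by rw [hg]; trivial
  induction ha using Algebra.adjoin_induction with
  | mem g hgm =>
    intro x hx
    induction hx using Submodule.span_induction with
    | zero => rw [mul_zero]; exact Submodule.zero_mem _
    | add x y _ _ h1 h2 => rw [mul_add]; exact Submodule.add_mem _ h1 h2
    | smul k x _ h => rw [mul_smul_comm]; exact Submodule.smul_mem _ _ h
    | mem x hx =>
      rcases hgm with (⟨w, rfl⟩ | ⟨e, rfl⟩) | ⟨e, rfl⟩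
      · exact F.P_path hf w hx
      · exact Submodule.subset_span (LPAPath.step e x hx)
      · cases hx with
        | base => rw [F.T_gap]; exact Submodule.zero_mem _
        | step e' x hx =>
          rw [← mul_assoc]
          by_cases h : e = e'
          · subst h; rw [F.TS1]; exact F.P_path hf _ hx
          · rw [F.TS0 _ _ h, zero_mul]; exact Submodule.zero_mem _
  | algebraMap k =>
    intro x hx
    rw [← Algebra.smul_def]; exact Submodule.smul_mem _ _ hx
  | add x y _ _ h1 h2 =>
    intro z hz
    rw [add_mul]; exact Submodule.add_mem _ (h1 z hz) (h2 z hz)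
  | mul x y _ _ h1 h2 =>
    intro z hz
    rw [mul_assoc]; exact h1 _ (h2 z hz)

theorem gap_mul (hg : Algebra.adjoin K F.gens = ⊤) (v w : V) (a : A) :
    ∃ k : K, F.gap w * (a * F.gap v) = k • F.gap v := by
  have h := F.left_ideal hg v a (F.gap v) (Submodule.subset_span LPAPath.base)
  generalize a * F.gap v = y at h
  induction h using Submodule.span_induction with
  | zero => exact ⟨0, by simp⟩
  | add x y _ _ h1 h2 =>
    obtain ⟨k, hk⟩ := h1
    obtain ⟨l, hl⟩ := h2
    exact ⟨k + l, by rw [mul_add, hk, hl, add_smul]⟩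
  | smul c x _ h =>
    obtain ⟨k, hk⟩ := h
    exact ⟨c * k, by rw [mul_smul_comm, hk, mul_smul]⟩
  | mem x hx =>
    cases hx with
    | base =>
      by_cases h : w = v
      · subst h; exact ⟨1, by rw [F.gap_idem, one_smul]⟩
      · exact ⟨0, by rw [F.gap_gap0 _ _ h, zero_smul]⟩
    | step e x hx => exact ⟨0, by rw [← mul_assoc, F.gap_S, zero_mul, zero_smul]⟩

theorem P_eq (v : V) : F.P v = F.gap v + ∑ e : E, if s e = v then F.S e * F.T e else 0 := by
  rw [gap, sub_add_cancel]

theorem exists_mul (hg : Algebra.adjoin K F.gens = ⊤)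
    (wf : WellFounded fun v w : V => ∃ e, s e = w ∧ r e = v) (v w : V) :
    ∀ a : A, F.P w * (a * F.gap v) ≠ 0 → ∃ z, z * (F.P w * (a * F.gap v)) = F.gap v := by
  induction w using wf.induction with
  | _ w ih =>
    intro a hne
    by_cases h : ∃ e, s e = w ∧ F.T e * (F.P w * (a * F.gap v)) ≠ 0
    · obtain ⟨e, he, h⟩ := h
      have h1 : F.P (r e) * ((F.T e * a) * F.gap v) = F.T e * (F.P w * (a * F.gap v)) := by
        subst he
        rw [← mul_assoc (F.T e) (F.P _), F.TP, mul_assoc (F.T e) a, ← mul_assoc, F.PT]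
      obtain ⟨z, hz⟩ := ih (r e) ⟨e, he, rfl⟩ (F.T e * a) (by rwa [h1])
      exact ⟨z * F.T e, by rw [mul_assoc, ← h1, hz]⟩
    · push Not at h
      have h2 : F.P w * (a * F.gap v) = F.gap w * (a * F.gap v) := by
        rw [← F.idem, mul_assoc]
        nth_rewrite 1 [F.P_eq w]
        rw [add_mul, Finset.sum_mul, Finset.sum_eq_zero, add_zero, ← mul_assoc, F.gap_P]
        intro e _
        split_ifs with he
        · rw [mul_assoc, h e he, mul_zero]
        · simp
      obtain ⟨k, hk⟩ := F.gap_mul hg v w a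
      rw [h2, hk] at hne ⊢
      have hk0 : k ≠ 0 := by rintro rfl; simp at hne
      exact ⟨algebraMap K A k⁻¹, by
        rw [← Algebra.smul_def, smul_smul, inv_mul_cancel₀ hk0, one_smul]⟩

theorem gap_semisimple (hg : Algebra.adjoin K F.gens = ⊤)
    (wf : WellFounded fun v w : V => ∃ e, s e = w ∧ r e = v) (v : V) :
    IsSemisimpleModule A (Submodule.span A {F.gap v}) := by
  by_cases h0 : F.gap v = 0
  · rw [h0]; exact lpa_ss_zero A
  · have : IsSimpleModule A (Submodule.span A {F.gap v}) := by
      rw [isSimpleModule_iff_isAtom]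
      refine ⟨by simpa using h0, fun b hb => ?_⟩
      by_contra hbot
      obtain ⟨x, hx, hx0⟩ := Submodule.exists_mem_ne_zero_of_ne_bot hbot
      obtain ⟨a, rfl⟩ := Submodule.mem_span_singleton.1 (hb.le hx)
      rw [smul_eq_mul] at hx hx0
      have : ∃ w, F.P w * (a * F.gap v) ≠ 0 := by
        by_contra hc
        push Not at hc
        apply hx0
        rw [← one_mul (a * F.gap v), ← F.one, Finset.sum_mul]
        exact Finset.sum_eq_zero fun w _ => hc w
      obtain ⟨w, hw⟩ := this
      obtain ⟨z, hz⟩ := F.exists_mul hg wf v w a hw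
      apply hb.not_ge
      rw [Submodule.span_singleton_le_iff_mem, ← hz, ← mul_assoc]
      exact b.smul_mem (z * F.P w) hx
    infer_instance

theorem _root_.lpa_ss_of_mem {N : Submodule A A} (hN : IsSemisimpleModule A N) {x : A}
    (hx : x ∈ N) : IsSemisimpleModule A (Submodule.span A {x}) :=
  IsSemisimpleModule.of_injective (Submodule.inclusion
    ((Submodule.span_singleton_le_iff_mem x N).2 hx)) (Submodule.inclusion_injective _)

theorem _root_.lpa_ss_add {x y : A} (hx : IsSemisimpleModule A (Submodule.span A {x}))
    (hy : IsSemisimpleModule A (Submodule.span A {y})) :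
    IsSemisimpleModule A (Submodule.span A {x + y}) :=
  lpa_ss_of_mem (IsSemisimpleModule.sup hx hy)
    (Submodule.add_mem_sup (Submodule.mem_span_singleton_self x)
      (Submodule.mem_span_singleton_self y))

theorem _root_.lpa_ss_sum {ι : Type} (t : Finset ι) (x : ι → A)
    (hx : ∀ i ∈ t, IsSemisimpleModule A (Submodule.span A {x i})) :
    IsSemisimpleModule A (Submodule.span A {∑ i ∈ t, x i}) := by
  classical
  induction t using Finset.induction_on with
  | empty => rw [Finset.sum_empty]; exact lpa_ss_zero A
  | insert i t hi ih =>
    rw [Finset.sum_insert hi]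
    exact lpa_ss_add (hx i (Finset.mem_insert_self _ _))
      (ih fun j hj => hx j (Finset.mem_insert_of_mem hj))

theorem _root_.lpa_ss_mul {x : A} (hx : IsSemisimpleModule A (Submodule.span A {x})) (a b : A) :
    IsSemisimpleModule A (Submodule.span A {a * (x * b)}) := by
  have h := IsSemisimpleModule.range
    ((LinearMap.toSpanSingleton A A b).domRestrict (Submodule.span A {x}))
  refine lpa_ss_of_mem h ?_
  refine ⟨⟨a * x, Submodule.smul_mem _ a (Submodule.mem_span_singleton_self x)⟩, ?_⟩
  simp [mul_assoc]

theorem P_semisimple (hg : Algebra.adjoin K F.gens = ⊤)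
    (wf : WellFounded fun v w : V => ∃ e, s e = w ∧ r e = v) (v : V) :
    IsSemisimpleModule A (Submodule.span A {F.P v}) := by
  induction v using wf.induction with
  | _ v ih =>
    rw [F.P_eq v]
    refine lpa_ss_add (F.gap_semisimple hg wf v) (lpa_ss_sum _ _ fun e _ => ?_)
    by_cases h : s e = v
    · have := lpa_ss_mul (ih (r e) ⟨e, h, rfl⟩) (F.S e) (F.T e)
      rw [F.PT] at this
      rwa [if_pos h]
    · rw [if_neg h]; exact lpa_ss_zero A

theorem regular (hg : Algebra.adjoin K F.gens = ⊤)
    (wf : WellFounded fun v w : V => ∃ e, s e = w ∧ r e = v) (a : A) :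
    ∃ b : A, a = a * b * a := by
  have h : IsSemisimpleModule A (Submodule.span A {(1 : A)}) := by
    rw [← F.one]
    exact lpa_ss_sum _ _ fun v _ => F.P_semisimple hg wf v
  have : IsSemisimpleModule A A := by
    refine IsSemisimpleModule.of_surjective (Submodule.span A {(1 : A)}).subtype fun x => ?_
    exact ⟨⟨x, Submodule.mem_span_singleton.2 ⟨x, by simp⟩⟩, rfl⟩
  exact lpa_regular_of_semisimple A a

end LPACohn

theorem LPACohn.locally_regular {K A V E : Type} [Field K] [Ring A] [Algebra K A] [Fintype V]
    [Fintype E] {s r : E → V} (F : LPACohn A V E s r)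
    (wf : WellFounded fun v w : V => ∃ e, s e = w ∧ r e = v) (a : A)
    (ha : a ∈ Algebra.adjoin K F.gens) : ∃ b : A, a = a * b * a := by
  classical
  have hP : ∀ v, F.P v ∈ Algebra.adjoin K F.gens := fun v =>
    Algebra.subset_adjoin (Or.inl (Or.inl ⟨v, rfl⟩))
  have hS : ∀ v, F.S v ∈ Algebra.adjoin K F.gens := fun v =>
    Algebra.subset_adjoin (Or.inl (Or.inr ⟨v, rfl⟩))
  have hT : ∀ v, F.T v ∈ Algebra.adjoin K F.gens := fun v =>
    Algebra.subset_adjoin (Or.inr ⟨v, rfl⟩)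
  let G : LPACohn (Algebra.adjoin K F.gens) V E s r :=
    { P := fun v => ⟨F.P v, hP v⟩
      S := fun v => ⟨F.S v, hS v⟩
      T := fun v => ⟨F.T v, hT v⟩
      orth := fun v w h => Subtype.ext (F.orth v w h)
      idem := fun v => Subtype.ext (F.idem v)
      PS := fun v => Subtype.ext (F.PS v)
      SP := fun v => Subtype.ext (F.SP v)
      PT := fun v => Subtype.ext (F.PT v)
      TP := fun v => Subtype.ext (F.TP v)
      TS0 := fun v w h => Subtype.ext (F.TS0 v w h)
      TS1 := fun v => Subtype.ext (F.TS1 v)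
      one := Subtype.ext (by simpa using F.one) }
  have hG : Algebra.adjoin K G.gens = ⊤ := by
    rw [← Algebra.adjoin_adjoin_coe_preimage (R := K) (s := F.gens)]
    congr 1
    ext ⟨x, hx⟩
    constructor
    · rintro ((⟨w, h⟩ | ⟨e, h⟩) | ⟨e, h⟩)
      · exact Or.inl (Or.inl ⟨w, congrArg Subtype.val h⟩)
      · exact Or.inl (Or.inr ⟨e, congrArg Subtype.val h⟩)
      · exact Or.inr ⟨e, congrArg Subtype.val h⟩
    · rintro ((⟨w, h⟩ | ⟨e, h⟩) | ⟨e, h⟩)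
      · exact Or.inl (Or.inl ⟨w, Subtype.ext h⟩)
      · exact Or.inl (Or.inr ⟨e, Subtype.ext h⟩)
      · exact Or.inr ⟨e, Subtype.ext h⟩
  obtain ⟨b, hb⟩ := G.regular hG wf ⟨a, ha⟩
  exact ⟨b, congrArg Subtype.val hb⟩

section LPAMain

variable (K V E : Type) [Field K] [Fintype V] (s r : E → V)

/-- The image of a generator in the Leavitt path algebra. -/
noncomputable def lpaGen (g : LPAGen V E) : LeavittPathAlgebra K V E s r :=
  RingQuot.mkAlgHom K (LPARel K V E s r) (FreeAlgebra.ι K g)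

/-- The canonical family. -/
noncomputable def lpaFam : LPACohn (LeavittPathAlgebra K V E s r) V E s r where
  P v := lpaGen K V E s r (.vertex v)
  S v := lpaGen K V E s r (.edge v)
  T v := lpaGen K V E s r (.ghost v)
  orth v w h := by
    simpa [lpaGen] using RingQuot.mkAlgHom_rel K (LPARel.vertex_orth (K := K) (s := s) (r := r) v w h)
  idem v := by
    simpa [lpaGen] using RingQuot.mkAlgHom_rel K (LPARel.vertex_idem (K := K) (s := s) (r := r) v)
  PS v := by
    simpa [lpaGen] using RingQuot.mkAlgHom_rel K (LPARel.edge_src (K := K) (s := s) (r := r) v)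
  SP v := by
    simpa [lpaGen] using RingQuot.mkAlgHom_rel K (LPARel.edge_rng (K := K) (s := s) (r := r) v)
  PT v := by
    simpa [lpaGen] using RingQuot.mkAlgHom_rel K (LPARel.ghost_rng (K := K) (s := s) (r := r) v)
  TP v := by
    simpa [lpaGen] using RingQuot.mkAlgHom_rel K (LPARel.ghost_src (K := K) (s := s) (r := r) v)
  TS0 v w h := by
    simpa [lpaGen] using RingQuot.mkAlgHom_rel K (LPARel.ck1_distinct (K := K) (s := s) (r := r) v w h)
  TS1 v := by
    simpa [lpaGen] using RingQuot.mkAlgHom_rel K (LPARel.ck1_same (K := K) (s := s) (r := r) v)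
  one := by
    simpa [lpaGen] using (RingQuot.mkAlgHom_rel K (LPARel.unit (K := K) (s := s) (r := r))).symm

/-- Restriction of a Cohn family to a set of edges. -/
def LPACohn.restrict {A V E : Type} [Ring A] [Fintype V] {s r : E → V} (F : LPACohn A V E s r)
    (t : Finset E) : LPACohn A V t (fun e => s e) (fun e => r e) where
  P := F.P
  S e := F.S e
  T e := F.T e
  orth := F.orth
  idem := F.idem
  PS e := F.PS e
  SP e := F.SP e
  PT e := F.PT e
  TP e := F.TP e
  TS0 e f h := F.TS0 e f fun h' => h (Subtype.ext h')
  TS1 e := F.TS1 e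
  one := F.one

theorem LPACohn.restrict_mono {A V E : Type} [Ring A] [Fintype V] {s r : E → V}
    (F : LPACohn A V E s r) {t t' : Finset E} (h : t ⊆ t') :
    (F.restrict t).gens ⊆ (F.restrict t').gens := by
  rintro x ((⟨w, rfl⟩ | ⟨e, rfl⟩) | ⟨e, rfl⟩)
  · exact Or.inl (Or.inl ⟨w, rfl⟩)
  · exact Or.inl (Or.inr ⟨⟨e, h e.2⟩, rfl⟩)
  · exact Or.inr ⟨⟨e, h e.2⟩, rfl⟩

theorem lpa_mem_finite (a : LeavittPathAlgebra K V E s r) :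
    ∃ t : Finset E, a ∈ Algebra.adjoin K ((lpaFam K V E s r).restrict t).gens := by
  classical
  obtain ⟨x, rfl⟩ := RingQuot.mkAlgHom_surjective K (LPARel K V E s r) a
  induction x using FreeAlgebra.induction with
  | grade0 k => exact ⟨∅, by rw [AlgHom.commutes]; exact Subalgebra.algebraMap_mem _ _⟩
  | grade1 g =>
    cases g with
    | vertex v => exact ⟨∅, Algebra.subset_adjoin (Or.inl (Or.inl ⟨v, rfl⟩))⟩
    | edge e =>
      exact ⟨{e}, Algebra.subset_adjoin (Or.inl (Or.inr ⟨⟨e, Finset.mem_singleton_self e⟩, rfl⟩))⟩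
    | ghost e =>
      exact ⟨{e}, Algebra.subset_adjoin (Or.inr ⟨⟨e, Finset.mem_singleton_self e⟩, rfl⟩)⟩
  | mul a b ha hb =>
    obtain ⟨t, ht⟩ := ha
    obtain ⟨u, hu⟩ := hb
    refine ⟨t ∪ u, ?_⟩
    rw [map_mul]
    exact mul_mem
      (Algebra.adjoin_mono (LPACohn.restrict_mono _ Finset.subset_union_left) ht)
      (Algebra.adjoin_mono (LPACohn.restrict_mono _ Finset.subset_union_right) hu)
  | add a b ha hb =>
    obtain ⟨t, ht⟩ := ha
    obtain ⟨u, hu⟩ := hb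
    refine ⟨t ∪ u, ?_⟩
    rw [map_add]
    exact add_mem
      (Algebra.adjoin_mono (LPACohn.restrict_mono _ Finset.subset_union_left) ht)
      (Algebra.adjoin_mono (LPACohn.restrict_mono _ Finset.subset_union_right) hu)

theorem lpa_regular_of_wf (wf : WellFounded fun v w : V => ∃ e, s e = w ∧ r e = v)
    (a : LeavittPathAlgebra K V E s r) : ∃ b, a = a * b * a := by
  obtain ⟨t, ht⟩ := lpa_mem_finite K V E s r a
  refine LPACohn.locally_regular _ ?_ a ht
  refine Subrelation.wf ?_ wf
  rintro v w ⟨e, h1, h2⟩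
  exact ⟨e, h1, h2⟩

/-- Universal property. -/
theorem lpa_lift {B : Type} [Ring B] [Algebra K B] (F : LPACohn B V E s r)
    (ck2 : ∀ (v : V) (h : {e : E | s e = v}.Finite), {e : E | s e = v}.Nonempty →
      F.P v = ∑ e ∈ h.toFinset, F.S e * F.T e) :
    ∃ φ : LeavittPathAlgebra K V E s r →ₐ[K] B,
      (∀ v, φ ((lpaFam K V E s r).P v) = F.P v) ∧ (∀ v, φ ((lpaFam K V E s r).S v) = F.S v) ∧
      (∀ v, φ ((lpaFam K V E s r).T v) = F.T v) := by
  let g : LPAGen V E → B := fun x => match x with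
    | .vertex v => F.P v
    | .edge v => F.S v
    | .ghost v => F.T v
  have hg : ∀ ⦃x y⦄, LPARel K V E s r x y → FreeAlgebra.lift K g x = FreeAlgebra.lift K g y := by
    intro x y h
    cases h with
    | vertex_orth v w h => simpa [g] using F.orth v w h
    | vertex_idem v => simpa [g] using F.idem v
    | edge_src v => simpa [g] using F.PS v
    | edge_rng v => simpa [g] using F.SP v
    | ghost_rng v => simpa [g] using F.PT v
    | ghost_src v => simpa [g] using F.TP v
    | ck1_distinct v w h => simpa [g] using F.TS0 v w h
    | ck1_same v => simpa [g] using F.TS1 v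
    | ck2 v h hne => simpa [g] using ck2 v h hne
    | unit => simpa [g] using F.one.symm
  refine ⟨RingQuot.liftAlgHom K ⟨FreeAlgebra.lift K g, hg⟩, ?_, ?_, ?_⟩ <;> intro v <;>
    simp [lpaFam, lpaGen, g]

theorem lpa_hom_ext {B : Type} [Ring B] [Algebra K B]
    {φ ψ : LeavittPathAlgebra K V E s r →ₐ[K] B}
    (h1 : ∀ v, φ ((lpaFam K V E s r).P v) = ψ ((lpaFam K V E s r).P v))
    (h2 : ∀ v, φ ((lpaFam K V E s r).S v) = ψ ((lpaFam K V E s r).S v))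
    (h3 : ∀ v, φ ((lpaFam K V E s r).T v) = ψ ((lpaFam K V E s r).T v)) : φ = ψ := by
  apply RingQuot.ringQuot_ext'
  apply FreeAlgebra.hom_ext
  funext g
  cases g with
  | vertex v => exact h1 v
  | edge v => exact h2 v
  | ghost v => exact h3 v

theorem lpa_ck2 (v : V) (h : {e : E | s e = v}.Finite) (hne : {e : E | s e = v}.Nonempty) :
    (lpaFam K V E s r).P v =
      ∑ e ∈ h.toFinset, (lpaFam K V E s r).S e * (lpaFam K V E s r).T e := by
  simpa [lpaFam, lpaGen] using
    RingQuot.mkAlgHom_rel K (LPARel.ck2 (K := K) (s := s) (r := r) v h hne)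

/-- The grading, as a homomorphism into Laurent polynomials. -/
theorem lpa_grading : ∃ φ : LeavittPathAlgebra K V E s r →ₐ[K]
      AddMonoidAlgebra (LeavittPathAlgebra K V E s r) ℤ,
    (∀ v, φ ((lpaFam K V E s r).P v) = .single 0 ((lpaFam K V E s r).P v)) ∧
    (∀ v, φ ((lpaFam K V E s r).S v) = .single 1 ((lpaFam K V E s r).S v)) ∧
    (∀ x, φ x = 0 → x = 0) := by
  let F := lpaFam K V E s r
  let G : LPACohn (AddMonoidAlgebra (LeavittPathAlgebra K V E s r) ℤ) V E s r :=
    { P := fun v => .single 0 (F.P v)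
      S := fun v => .single 1 (F.S v)
      T := fun v => .single (-1) (F.T v)
      orth := fun v w h => by simp only [AddMonoidAlgebra.single_mul_single, AddMonoidAlgebra.single_zero, add_zero, zero_add,
          neg_add_cancel, F.orth v w h]
      idem := fun v => by simp only [AddMonoidAlgebra.single_mul_single, AddMonoidAlgebra.single_zero, add_zero, zero_add,
          neg_add_cancel, F.idem v]
      PS := fun v => by simp only [AddMonoidAlgebra.single_mul_single, AddMonoidAlgebra.single_zero, add_zero, zero_add,
          neg_add_cancel, F.PS v]
      SP := fun v => by simp only [AddMonoidAlgebra.single_mul_single, AddMonoidAlgebra.single_zero, add_zero, zero_add,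
          neg_add_cancel, F.SP v]
      PT := fun v => by simp only [AddMonoidAlgebra.single_mul_single, AddMonoidAlgebra.single_zero, add_zero, zero_add,
          neg_add_cancel, F.PT v]
      TP := fun v => by simp only [AddMonoidAlgebra.single_mul_single, AddMonoidAlgebra.single_zero, add_zero, zero_add,
          neg_add_cancel, F.TP v]
      TS0 := fun v w h => by simp only [AddMonoidAlgebra.single_mul_single, AddMonoidAlgebra.single_zero, add_zero, zero_add,
          neg_add_cancel, F.TS0 v w h]
      TS1 := fun v => by simp only [AddMonoidAlgebra.single_mul_single, AddMonoidAlgebra.single_zero, add_zero, zero_add,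
          neg_add_cancel, F.TS1 v]
      one := by
        have h := map_sum (AddMonoidAlgebra.singleAddHom (R := LeavittPathAlgebra K V E s r)
          (0 : ℤ)) F.P Finset.univ
        rw [F.one] at h
        exact h.symm }
  obtain ⟨φ, h1, h2, h3⟩ := lpa_lift K V E s r G (by
    intro v h hne
    have := lpa_ck2 K V E s r v h hne
    simp only [G, AddMonoidAlgebra.single_mul_single]
    change AddMonoidAlgebra.single 0 ((lpaFam K V E s r).P v) = _
    rw [this]
    exact map_sum (AddMonoidAlgebra.singleAddHom 0) _ _)
  refine ⟨φ, h1, h2, ?_⟩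
  let ψ : AddMonoidAlgebra (LeavittPathAlgebra K V E s r) ℤ →ₐ[K] LeavittPathAlgebra K V E s r :=
    AddMonoidAlgebra.liftNCAlgHom (AlgHom.id K _) 1 (fun x y => Commute.one_right _)
  have hψ : ∀ n x, ψ (.single n x) = x := fun n x => by
    have h := AddMonoidAlgebra.liftNCRingHom_single (RingHom.id (LeavittPathAlgebra K V E s r))
      (1 : Multiplicative ℤ →* LeavittPathAlgebra K V E s r) (fun x y => Commute.one_right _) n x
    refine Eq.trans h ?_
    simp
  have hid : ψ.comp φ = AlgHom.id K _ := by
    apply lpa_hom_ext <;> intro v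
    · simp only [AlgHom.comp_apply, h1, G, hψ]; rfl
    · simp only [AlgHom.comp_apply, h2, G, hψ]; rfl
    · simp only [AlgHom.comp_apply, h3, G, hψ]; rfl
  intro x hx
  have := DFunLike.congr_fun hid x
  simpa [hx] using this.symm

theorem lpa_enc [Nonempty E] : ∃ enc : E → List E → List E,
    (∀ e e' x x', s e = s e' → enc e x = enc e' x' → e = e' ∧ x = x') ∧
    (∀ e x, ∃ e' y, s e' = s e ∧ enc e' y = x) := by
  have hβ : ∀ v, (∃ e, s e = v) → Nonempty ({e // s e = v} × List E ≃ List E) := by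
    rintro v ⟨e, he⟩
    refine Function.Embedding.antisymm ⟨fun p => p.1.1 :: p.2, ?_⟩ ⟨fun x => (⟨e, he⟩, x), ?_⟩
    · rintro ⟨⟨a, ha⟩, x⟩ ⟨⟨b, hb⟩, y⟩ h
      simpa using h
    · intro x y h
      simpa using h
  have β : ∀ v, (∃ e, s e = v) → ({e // s e = v} × List E ≃ List E) := fun v h => (hβ v h).some
  refine ⟨fun e x => β (s e) ⟨e, rfl⟩ (⟨e, rfl⟩, x), ?_, ?_⟩
  · intro e e' x x' h hx
    have key : ∀ v (h1 : s e = v) (h2 : s e' = v),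
        β v ⟨e, h1⟩ (⟨e, h1⟩, x) = β v ⟨e', h2⟩ (⟨e', h2⟩, x') → e = e' ∧ x = x' := by
      intro v h1 h2 hh
      simpa using (β v ⟨e, h1⟩).injective hh
    refine key (s e) rfl h.symm (hx.trans ?_)
    have key2 : ∀ v (h1 : s e' = v) (h2 : ∃ e, s e = v),
        β (s e') ⟨e', rfl⟩ (⟨e', rfl⟩, x') = β v h2 (⟨e', h1⟩, x') := by
      intro v h1 h2
      subst h1; rfl
    exact key2 (s e) h.symm _
  · intro e x
    refine ⟨((β (s e) ⟨e, rfl⟩).symm x).1.1, ((β (s e) ⟨e, rfl⟩).symm x).2,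
      ((β (s e) ⟨e, rfl⟩).symm x).1.2, ?_⟩
    have key : ∀ v (e' : E) (h1 : s e' = v) (h2 : ∃ e, s e = v) y,
        β (s e') ⟨e', rfl⟩ (⟨e', rfl⟩, y) = β v h2 (⟨e', h1⟩, y) := by
      intro v e' h1 h2 y
      subst h1; rfl
    refine (key (s e) _ ((β (s e) ⟨e, rfl⟩).symm x).1.2 ⟨e, rfl⟩ _).trans ?_
    exact (β (s e) ⟨e, rfl⟩).apply_symm_apply x

theorem lpa_vertex_ne_zero [Nonempty E] (v : V) : (lpaFam K V E s r).P v ≠ 0 := by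
  classical
  obtain ⟨enc, hinj, hsurj⟩ := lpa_enc V E s
  let inv : E → List E → List E := fun e => Function.invFun (enc e)
  have hinv : ∀ e x, inv e (enc e x) = x := fun e x =>
    Function.leftInverse_invFun (fun a b h => (hinj e e a b rfl h).2) x
  let P : V → Module.End K (V → List E → K) := fun v =>
    { toFun := fun f w x => if w = v then f w x else 0
      map_add' := fun f g => by funext w x; simp only [Pi.add_apply]; split_ifs <;> simp
      map_smul' := fun f g => by funext w x; simp }
  let S : E → Module.End K (V → List E → K) := fun e =>
    { toFun := fun f w x => if w = s e ∧ enc e (inv e x) = x then f (r e) (inv e x) else 0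
      map_add' := fun f g => by funext w x; simp only [Pi.add_apply]; split_ifs <;> simp
      map_smul' := fun f g => by funext w x; simp }
  let T : E → Module.End K (V → List E → K) := fun e =>
    { toFun := fun f w x => if w = r e then f (s e) (enc e x) else 0
      map_add' := fun f g => by funext w x; simp only [Pi.add_apply]; split_ifs <;> simp
      map_smul' := fun f g => by funext w x; simp }
  have hP : ∀ v f w x, P v f w x = if w = v then f w x else 0 := fun _ _ _ _ => rfl
  have hS : ∀ e f w x, S e f w x =
    if w = s e ∧ enc e (inv e x) = x then f (r e) (inv e x) else 0 := fun _ _ _ _ => rfl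
  have hT : ∀ e f w x, T e f w x = if w = r e then f (s e) (enc e x) else 0 := fun _ _ _ _ => rfl
  let G : LPACohn (Module.End K (V → List E → K)) V E s r :=
    { P := P
      S := S
      T := T
      orth := by
        intro v w h; refine LinearMap.ext fun f => funext fun u => funext fun x => ?_
        simp only [Module.End.mul_apply, hP]
        split_ifs <;> simp_all
      idem := by
        intro v; refine LinearMap.ext fun f => funext fun u => funext fun x => ?_
        simp only [Module.End.mul_apply, hP]
        split_ifs <;> simp_all
      PS := by
        intro e; refine LinearMap.ext fun f => funext fun u => funext fun x => ?_
        simp only [Module.End.mul_apply, hP, hS]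
        split_ifs <;> simp_all
      SP := by
        intro e; refine LinearMap.ext fun f => funext fun u => funext fun x => ?_
        simp only [Module.End.mul_apply, hP, hS]
        split_ifs <;> simp_all
      PT := by
        intro e; refine LinearMap.ext fun f => funext fun u => funext fun x => ?_
        simp only [Module.End.mul_apply, hP, hT]
        split_ifs <;> simp_all
      TP := by
        intro e; refine LinearMap.ext fun f => funext fun u => funext fun x => ?_
        simp only [Module.End.mul_apply, hP, hT]
        split_ifs <;> simp_all
      TS0 := by
        intro e e' h; refine LinearMap.ext fun f => funext fun u => funext fun x => ?_
        simp only [Module.End.mul_apply, hS, hT]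
        split_ifs with h1 h2
        · exact absurd (hinj e' e _ _ h2.1.symm h2.2).1.symm h
        · rfl
        · rfl
      TS1 := by
        intro e; refine LinearMap.ext fun f => funext fun u => funext fun x => ?_
        simp only [Module.End.mul_apply, hS, hT, hP, hinv]
        split_ifs <;> simp_all
      one := by
        refine LinearMap.ext fun f => funext fun u => funext fun x => ?_
        simp [LinearMap.sum_apply, Finset.sum_apply, hP] }
  obtain ⟨φ, h1, -, -⟩ := lpa_lift K V E s r G (by
    intro v h hne
    obtain ⟨e0, rfl⟩ := hne
    refine LinearMap.ext fun f => funext fun u => funext fun x => ?_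
    change P (s e0) f u x = (∑ e ∈ h.toFinset, S e * T e) f u x
    simp only [LinearMap.sum_apply, Finset.sum_apply, Module.End.mul_apply, hP, hS, hT]
    split_ifs with hu
    · subst hu
      obtain ⟨e1, y, he1, hy⟩ := hsurj e0 x
      rw [Finset.sum_eq_single e1]
      · subst hy
        simp [hinv, he1]
      · intro e he hne
        have he : s e = s e0 := by simpa using he
        rw [if_neg]
        rintro ⟨-, h2⟩
        exact hne (hinj e e1 _ _ (he.trans he1.symm) (h2.trans hy.symm)).1
      · intro hn
        exact absurd (by simpa using he1) hn
    · symm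
      apply Finset.sum_eq_zero
      intro e he
      have he : s e = s e0 := by simpa using he
      rw [if_neg]
      rintro ⟨h2, -⟩
      exact hu (h2.trans he))
  intro h0
  have h2 : P v = 0 := by
    have := h1 v
    rw [h0, map_zero] at this
    exact this.symm
  have h3 := congrFun (congrFun (DFunLike.congr_fun h2 (fun _ _ => 1)) v) []
  rw [hP] at h3
  simp at h3

theorem lpa_path (φ : LeavittPathAlgebra K V E s r →ₐ[K]
      AddMonoidAlgebra (LeavittPathAlgebra K V E s r) ℤ)
    (hφ : ∀ v, φ ((lpaFam K V E s r).S v) = .single 1 ((lpaFam K V E s r).S v)) {v w : V}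
    (h : Relation.TransGen (fun v w => ∃ e, s e = v ∧ r e = w) v w) :
    ∃ (c d : LeavittPathAlgebra K V E s r) (n : ℕ), 0 < n ∧
      d * c = (lpaFam K V E s r).P w ∧ (lpaFam K V E s r).P v * c = c ∧
      c * (lpaFam K V E s r).P w = c ∧ φ c = .single (n : ℤ) c := by
  let F := lpaFam K V E s r
  induction h with
  | single h =>
    obtain ⟨e, rfl, rfl⟩ := h
    exact ⟨F.S e, F.T e, 1, one_pos, F.TS1 e, F.PS e, F.SP e, by simpa using hφ e⟩
  | tail _ h ih =>
    obtain ⟨e, rfl, rfl⟩ := h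
    obtain ⟨c, d, n, hn, h1, h2, h3, h4⟩ := ih
    refine ⟨c * F.S e, F.T e * d, n + 1, Nat.succ_pos _, ?_, ?_, ?_, ?_⟩
    · rw [mul_assoc, ← mul_assoc d, h1, F.PS, F.TS1]
    · rw [← mul_assoc, h2]
    · rw [mul_assoc, F.SP]
    · rw [map_mul, h4, hφ, AddMonoidAlgebra.single_mul_single]; push_cast; rfl

theorem lpa_no_cycle
    (hflat : ∀ (M : Type) [AddCommGroup M] [Module (LeavittPathAlgebra K V E s r) M],
        IsSimpleModule (LeavittPathAlgebra K V E s r) M →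
        IsFlatModule (LeavittPathAlgebra K V E s r) M) (v : V)
    (h : Relation.TransGen (fun v w => ∃ e, s e = v ∧ r e = w) v v) : False := by
  have hE : Nonempty E := by
    cases h with
    | single h => exact ⟨h.choose⟩
    | tail _ h => exact ⟨h.choose⟩
  have hv := lpa_vertex_ne_zero K V E s r v
  obtain ⟨φ, hφP, hφS, hφ0⟩ := lpa_grading K V E s r
  obtain ⟨c, d, n, hn, hdc, hPc, hcP, hφc⟩ := lpa_path K V E s r φ hφS h
  have hφP := hφP v
  have hidem := (lpaFam K V E s r).idem v
  generalize (lpaFam K V E s r).P v = p at *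
  -- vanishing of coefficients far to the left
  have hn' : (n : ℤ) ≠ 0 := by exact_mod_cast hn.ne'
  have hfar : ∀ (y : AddMonoidAlgebra (LeavittPathAlgebra K V E s r) ℤ) (m : ℤ), m ≠ 0 → ∀ k : ℤ,
      ∃ j : ℕ, y.coeff (k - j * m) = 0 := by
    intro y m hn' k
    have hinf : Set.Infinite (Set.range fun j : ℕ => k - (j : ℤ) * m) := by
      apply Set.infinite_range_of_injective
      intro a b hab
      have : (a : ℤ) * m = b * m := sub_right_injective hab
      exact_mod_cast mul_right_cancel₀ hn' this
    obtain ⟨x, ⟨j, rfl⟩, hx⟩ := hinf.exists_notMem_finset y.coeff.support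
    exact ⟨j, by simpa using hx⟩
  -- claim 1
  have claim1 : ∀ a, (p - c) * a = 0 → p * a = 0 := by
    intro a ha
    have h1 : p * a = c * (p * a) := by
      rw [← mul_assoc, hcP]; rw [sub_mul, sub_eq_zero] at ha; exact ha
    generalize p * a = x at h1
    apply hφ0
    have h2 : ∀ k, (φ x).coeff k = c * (φ x).coeff (k - n) := by
      intro k
      conv_lhs => rw [h1, map_mul, hφc, AddMonoidAlgebra.coeff_single_mul_apply]
      rw [sub_eq_neg_add]
    have h3 : ∀ j : ℕ, ∀ k, (φ x).coeff (k - j * n) = 0 → (φ x).coeff k = 0 := by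
      intro j
      induction j with
      | zero => intro k hk; simpa using hk
      | succ j ih =>
        intro k hk
        rw [h2, ih (k - n), mul_zero]
        rw [← hk]; congr 1; push_cast; ring
    ext k
    obtain ⟨j, hj⟩ := hfar (φ x) n hn' k
    simpa using h3 j k hj
  have claim2 : ∀ a, a * (p - c) ≠ p := by
    intro a ha
    have h1 : p = a * p - (a * p) * c := by
      rw [mul_assoc, hPc, ← mul_sub, ha]
    generalize a * p = x at h1
    have h2 : ∀ k, (φ x).coeff k = (AddMonoidAlgebra.single 0 p).coeff k
        + (φ x).coeff (k - n) * c := by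
      intro k
      rw [← hφP]
      conv_rhs => rw [h1, map_sub, map_mul, hφc]
      rw [AddMonoidAlgebra.coeff_sub, Finsupp.sub_apply, AddMonoidAlgebra.coeff_mul_single_apply,
        ← sub_eq_add_neg, sub_add_cancel]
    have hneg : ∀ j : ℕ, ∀ k < (0 : ℤ), (φ x).coeff (k - j * n) = 0 → (φ x).coeff k = 0 := by
      intro j
      induction j with
      | zero => intro k _ hk; simpa using hk
      | succ j ih =>
        intro k hk0 hk
        rw [h2, ih (k - n) (by omega), zero_mul, add_zero]
        · rw [AddMonoidAlgebra.coeff_single, Finsupp.single_eq_of_ne (by omega)]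
        · rw [← hk]; congr 1; push_cast; ring
    have hneg' : ∀ k < (0 : ℤ), (φ x).coeff k = 0 := fun k hk => by
      obtain ⟨j, hj⟩ := hfar (φ x) n hn' k
      exact hneg j k hk hj
    have hpos : ∀ j : ℕ, ∃ y, y * (φ x).coeff (j * n) = p := by
      intro j
      induction j with
      | zero =>
        refine ⟨p, ?_⟩
        have : (φ x).coeff ((0 : ℕ) * n) = p := by
          rw [h2, hneg' _ (by simpa using hn)]
          simp
        rw [this, hidem]
      | succ j ih =>
        obtain ⟨y, hy⟩ := ih
        refine ⟨d * y, ?_⟩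
        rw [h2, AddMonoidAlgebra.coeff_single, Finsupp.single_eq_of_ne, zero_add]
        · have : ((j + 1 : ℕ) : ℤ) * n - n = j * n := by push_cast; ring
          rw [this, mul_assoc, ← mul_assoc y, hy, hPc, hdc]
        · have : (0 : ℤ) < ((j + 1 : ℕ) : ℤ) * n := by positivity
          exact this.ne'
    obtain ⟨j, hj⟩ := hfar (φ x) (-n) (neg_ne_zero.2 hn') 0
    obtain ⟨y, hy⟩ := hpos j
    rw [zero_sub, mul_neg, neg_neg] at hj
    rw [hj, mul_zero] at hy
    exact hv hy.symm
  -- a maximal left ideal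
  let I : Ideal (LeavittPathAlgebra K V E s r) := Submodule.span _ {p - c, 1 - p}
  have hI : I ≠ ⊤ := by
    intro hI
    have h1 : (1 : LeavittPathAlgebra K V E s r) ∈ I := by rw [hI]; trivial
    obtain ⟨a, b, hab⟩ := Submodule.mem_span_pair.1 h1
    apply claim2 a
    have h2 := congrArg (· * p) hab
    simp only [smul_eq_mul, add_mul, one_mul, mul_assoc, sub_mul, hidem, hcP, sub_self, mul_zero,
      add_zero] at h2
    exact h2
  obtain ⟨J, hJ, hIJ⟩ := Ideal.exists_le_maximal I hI
  have hsimple : IsSimpleModule (LeavittPathAlgebra K V E s r)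
      (LeavittPathAlgebra K V E s r ⧸ (J : Submodule _ _)) :=
    isSimpleModule_iff_isCoatom.2 hJ.out
  have hfl := hflat _ hsimple
  have hm1 : (p - c) ∈ J := hIJ (Submodule.subset_span (by simp))
  have hm2 : (1 - p) ∈ J := hIJ (Submodule.subset_span (by simp))
  obtain ⟨k, a, y, h1, h2⟩ := hfl 1 (fun _ => p - c) (fun _ => Submodule.Quotient.mk 1) (by
    simp only [Finset.univ_unique, Finset.sum_const, Finset.card_singleton, one_smul]
    rw [← Submodule.Quotient.mk_smul, Submodule.Quotient.mk_eq_zero, smul_eq_mul, mul_one]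
    exact hm1)
  have h3 := h2 0
  have h4 : p • (Submodule.Quotient.mk 1 : LeavittPathAlgebra K V E s r ⧸ (J : Submodule _ _))
      = 0 := by
    rw [h3, Finset.smul_sum]
    refine Finset.sum_eq_zero fun j _ => ?_
    rw [smul_smul, claim1 _ (by simpa using h1 j), zero_smul]
  rw [← Submodule.Quotient.mk_smul, Submodule.Quotient.mk_eq_zero, smul_eq_mul, mul_one] at h4
  apply hJ.ne_top
  rw [Ideal.eq_top_iff_one]
  have := J.add_mem hm2 h4
  rwa [sub_add_cancel] at this

end LPAMain

/-- In a regular ring finitely generated right ideals are generated by a left-unit. -/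
theorem lpa_fg {R : Type} [Ring R] (hR : ∀ a : R, ∃ b, a = a * b * a) (n : ℕ) (c : Fin n → R) :
    ∃ d : Fin n → R, ∀ i, (∑ j, c j * d j) * c i = c i := by
  induction n with
  | zero => exact ⟨fun _ => 0, fun i => i.elim0⟩
  | succ n ih =>
    obtain ⟨d, hd⟩ := ih (fun i => c i.succ)
    generalize he : ∑ j, c (Fin.succ j) * d j = e at hd
    obtain ⟨b, hb⟩ := hR (c 0 - e * c 0)
    refine ⟨Fin.cons (b * (1 - e)) fun j => d j * (1 - c 0 * b * (1 - e)), ?_⟩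
    have key : ∑ j, c j * (Fin.cons (b * (1 - e)) (fun j => d j * (1 - c 0 * b * (1 - e))) :
        Fin (n + 1) → R) j = e + (c 0 - e * c 0) * b * (1 - e) := by
      rw [Fin.sum_univ_succ]
      simp only [Fin.cons_zero, Fin.cons_succ, ← mul_assoc]
      rw [← Finset.sum_mul, he]
      noncomm_ring
    rw [key]
    intro i
    refine Fin.cases ?_ (fun i => ?_) i
    · have : (e + (c 0 - e * c 0) * b * (1 - e)) * c 0
          = e * c 0 + (c 0 - e * c 0) * b * (c 0 - e * c 0) := by noncomm_ring
      rw [this, ← hb]; noncomm_ring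
    · have : (e + (c 0 - e * c 0) * b * (1 - e)) * c i.succ
          = e * c i.succ + (c 0 - e * c 0) * b * (c i.succ - e * c i.succ) := by noncomm_ring
      rw [this, hd]; simp

theorem lpa_flat_of_regular {R : Type} [Ring R] (hR : ∀ a : R, ∃ b, a = a * b * a)
    (M : Type) [AddCommGroup M] [Module R M] : IsFlatModule R M := by
  intro n c m h
  obtain ⟨d, hd⟩ := lpa_fg hR n c
  refine ⟨n, fun i j => (if i = j then 1 else 0) - d i * c j, m, fun j => ?_, fun i => ?_⟩
  · simp only [mul_sub, mul_ite, mul_one, mul_zero, Finset.sum_sub_distrib, ← mul_assoc]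
    rw [← Finset.sum_mul, hd]; simp
  · simp only [sub_smul, ite_smul, one_smul, zero_smul, Finset.sum_sub_distrib, mul_smul]
    rw [← Finset.smul_sum, h]; simp

/-- For a directed graph `E` with finitely many vertices and a field
`K`, every simple left module over the Leavitt path algebra `L = L_K(E)` is flat if and
only if `L` is von Neumann regular. -/
theorem lpa_allSimpleFlat_iff_vonNeumannRegular (K V E : Type) [Field K] [Fintype V]
    (s r : E → V) :
    (∀ (M : Type) [AddCommGroup M] [Module (LeavittPathAlgebra K V E s r) M],
        IsSimpleModule (LeavittPathAlgebra K V E s r) M →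
        IsFlatModule (LeavittPathAlgebra K V E s r) M) ↔
      ∀ a : LeavittPathAlgebra K V E s r,
        ∃ b : LeavittPathAlgebra K V E s r, a = a * b * a := by
  constructor
  · intro hflat
    refine lpa_regular_of_wf K V E s r ?_
    let Q : V → V → Prop := fun v w => Relation.TransGen (fun v w => ∃ e, s e = v ∧ r e = w) w v
    have hir : Std.Irrefl Q := ⟨fun v h => lpa_no_cycle K V E s r hflat v h⟩
    have htr : IsTrans V Q := ⟨fun a b c h1 h2 => Relation.TransGen.trans h2 h1⟩
    have hwf : WellFounded Q := Finite.wellFounded_of_trans_of_irrefl Q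
    refine Subrelation.wf ?_ hwf
    rintro v w ⟨e, h1, h2⟩
    exact Relation.TransGen.single ⟨e, h1, h2⟩
  · intro hR M _ _ _
    exact lpa_flat_of_regular hR M
end

section
/- Let E be a finite directed graph (E⁰ and E¹ both finite) and K a field, and let L = L_K(E) be the (unital) Leavitt path algebra. Then every simple left L-module is injective if and only if L is von Neumann regular (for every a ∈ L there exists b ∈ L with a = aba). -/
namespace LPAProof

set_option linter.unusedSectionVars false

theorem ss_bot (R M : Type) [Ring R] [AddCommGroup M] [Module R M] :
    IsSemisimpleModule R (⊥ : Submodule R M) := by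
  refine (isSemisimpleModule_iff _ _).2 ⟨fun a => ⟨⊤, ?_⟩⟩
  rw [Subsingleton.elim a ⊥]
  exact isCompl_bot_top

theorem ss_of_le {R M : Type} [Ring R] [AddCommGroup M] [Module R M] {p q : Submodule R M}
    (h : p ≤ q) (hq : IsSemisimpleModule R q) : IsSemisimpleModule R p :=
  IsSemisimpleModule.of_injective (Submodule.inclusion h) (Submodule.inclusion_injective h)

section Algebra

variable (K V E : Type) [Field K] [Fintype V] (s r : E → V)

/-- image of a generator in the algebra -/
noncomputable def gen (g : LPAGen V E) : LeavittPathAlgebra K V E s r :=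
  RingQuot.mkAlgHom K (LPARel K V E s r) (FreeAlgebra.ι K g)

/-- the vertex idempotents -/
noncomputable abbrev vx (v : V) : LeavittPathAlgebra K V E s r := gen K V E s r (.vertex v)
/-- the edges -/
noncomputable abbrev ed (e : E) : LeavittPathAlgebra K V E s r := gen K V E s r (.edge e)
/-- the ghost edges -/
noncomputable abbrev gh (e : E) : LeavittPathAlgebra K V E s r := gen K V E s r (.ghost e)

theorem vx_orth {v w : V} (h : v ≠ w) : vx K V E s r v * vx K V E s r w = 0 := by
  have := RingQuot.mkAlgHom_rel K (LPARel.vertex_orth (K := K) (s := s) (r := r) v w h)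
  rwa [map_mul, map_zero] at this

theorem vx_idem (v : V) : vx K V E s r v * vx K V E s r v = vx K V E s r v := by
  have := RingQuot.mkAlgHom_rel K (LPARel.vertex_idem (K := K) (s := s) (r := r) v)
  rwa [map_mul] at this

theorem vx_ed (e : E) : vx K V E s r (s e) * ed K V E s r e = ed K V E s r e := by
  have := RingQuot.mkAlgHom_rel K (LPARel.edge_src (K := K) (s := s) (r := r) e)
  rwa [map_mul] at this

theorem ed_vx (e : E) : ed K V E s r e * vx K V E s r (r e) = ed K V E s r e := by
  have := RingQuot.mkAlgHom_rel K (LPARel.edge_rng (K := K) (s := s) (r := r) e)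
  rwa [map_mul] at this

theorem vx_gh (e : E) : vx K V E s r (r e) * gh K V E s r e = gh K V E s r e := by
  have := RingQuot.mkAlgHom_rel K (LPARel.ghost_rng (K := K) (s := s) (r := r) e)
  rwa [map_mul] at this

theorem gh_vx (e : E) : gh K V E s r e * vx K V E s r (s e) = gh K V E s r e := by
  have := RingQuot.mkAlgHom_rel K (LPARel.ghost_src (K := K) (s := s) (r := r) e)
  rwa [map_mul] at this

theorem gh_ed_ne {e f : E} (h : e ≠ f) : gh K V E s r e * ed K V E s r f = 0 := by
  have := RingQuot.mkAlgHom_rel K (LPARel.ck1_distinct (K := K) (s := s) (r := r) e f h)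
  rwa [map_mul, map_zero] at this

theorem gh_ed (e : E) : gh K V E s r e * ed K V E s r e = vx K V E s r (r e) := by
  have := RingQuot.mkAlgHom_rel K (LPARel.ck1_same (K := K) (s := s) (r := r) e)
  rwa [map_mul] at this

theorem vx_eq_sum (v : V) (h : {e : E | s e = v}.Finite) (hne : {e : E | s e = v}.Nonempty) :
    vx K V E s r v = ∑ e ∈ h.toFinset, ed K V E s r e * gh K V E s r e := by
  have := RingQuot.mkAlgHom_rel K (LPARel.ck2 (K := K) (s := s) (r := r) v h hne)
  rw [map_sum] at this
  simp only [map_mul] at this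
  exact this

theorem one_eq_sum : (1 : LeavittPathAlgebra K V E s r) = ∑ v : V, vx K V E s r v := by
  have := RingQuot.mkAlgHom_rel K (LPARel.unit (K := K) (s := s) (r := r))
  rwa [map_sum, map_one] at this

theorem lpa_induction {C : LeavittPathAlgebra K V E s r → Prop}
    (hk : ∀ k : K, C (algebraMap K _ k)) (hg : ∀ g, C (gen K V E s r g))
    (hm : ∀ a b, C a → C b → C (a * b)) (ha : ∀ a b, C a → C b → C (a + b)) (a) : C a := by
  obtain ⟨x, rfl⟩ := RingQuot.mkAlgHom_surjective K (LPARel K V E s r) a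
  induction x with
  | grade0 k => rw [AlgHom.commutes]; exact hk k
  | grade1 g => exact hg g
  | mul a b h1 h2 => rw [map_mul]; exact hm _ _ h1 h2
  | add a b h1 h2 => rw [map_add]; exact ha _ _ h1 h2

/-- real paths ending at `w`, as elements of the algebra -/
inductive PathTo (w : V) : LeavittPathAlgebra K V E s r → Prop
  | base : PathTo w (vx K V E s r w)
  | step (e : E) (y : LeavittPathAlgebra K V E s r) : PathTo w y → PathTo w (ed K V E s r e * y)

theorem vx_pathTo (w u : V) (y) (h : PathTo K V E s r w y) :
    vx K V E s r u * y = y ∨ vx K V E s r u * y = 0 := by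
  cases h with
  | base =>
    by_cases h : u = w
    · subst h; left; exact vx_idem ..
    · right; exact vx_orth _ _ _ _ _ h
  | step e y hy =>
    by_cases h : u = s e
    · subst h; left; rw [← mul_assoc, vx_ed]
    · right; rw [← vx_ed, ← mul_assoc, ← mul_assoc, vx_orth _ _ _ _ _ h, zero_mul, zero_mul]

theorem sink_span (w : V) (hw : ∀ e, s e ≠ w) (a : LeavittPathAlgebra K V E s r) :
    ∀ y ∈ Submodule.span K {y | PathTo K V E s r w y},
      a * y ∈ Submodule.span K {y | PathTo K V E s r w y} := by
  have hv : ∀ u y, PathTo K V E s r w y → vx K V E s r u * y ∈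
      Submodule.span K {y | PathTo K V E s r w y} := by
    intro u y hy
    rcases vx_pathTo K V E s r w u y hy with h | h
    · rw [h]; exact Submodule.subset_span hy
    · rw [h]; exact zero_mem _
  induction a using lpa_induction with
  | hk k => intro y hy; rw [← Algebra.smul_def]; exact Submodule.smul_mem _ _ hy
  | hm a b h1 h2 => intro y hy; rw [mul_assoc]; exact h1 _ (h2 _ hy)
  | ha a b h1 h2 => intro y hy; rw [add_mul]; exact add_mem (h1 _ hy) (h2 _ hy)
  | hg g =>
    intro y hy
    induction hy using Submodule.span_induction with
    | zero => rw [mul_zero]; exact zero_mem _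
    | add x y _ _ h1 h2 => rw [mul_add]; exact add_mem h1 h2
    | smul k x _ h => rw [mul_smul_comm]; exact Submodule.smul_mem _ _ h
    | mem y hy =>
      cases g with
      | vertex u => exact hv u y hy
      | edge e => exact Submodule.subset_span (PathTo.step (w := w) e y hy)
      | ghost e =>
        cases hy with
        | base =>
          have : gh K V E s r e * vx K V E s r w = 0 := by
            rw [← gh_vx, mul_assoc, vx_orth _ _ _ _ _ (hw e), mul_zero]
          change gh K V E s r e * vx K V E s r w ∈ _
          rw [this]; exact zero_mem _
        | step f y hy =>
          change gh K V E s r e * _ ∈ _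
          rw [← mul_assoc]
          by_cases h : e = f
          · subst h; rw [gh_ed]; exact hv _ _ hy
          · rw [gh_ed_ne _ _ _ _ _ h, zero_mul]; exact zero_mem _

theorem sink_scalar (w u : V) (hw : ∀ e, s e ≠ w) (hu : ∀ e, s e ≠ u)
    (a : LeavittPathAlgebra K V E s r) :
    ∃ k : K, vx K V E s r u * (a * vx K V E s r w) = k • vx K V E s r w := by
  have h := sink_span K V E s r w hw a _ (Submodule.subset_span (PathTo.base))
  generalize a * vx K V E s r w = z at h ⊢
  induction h using Submodule.span_induction with
  | zero => exact ⟨0, by simp⟩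
  | add x y _ _ h1 h2 =>
    obtain ⟨k, hk⟩ := h1
    obtain ⟨l, hl⟩ := h2
    exact ⟨k + l, by rw [mul_add, hk, hl, add_smul]⟩
  | smul k x _ h =>
    obtain ⟨l, hl⟩ := h
    exact ⟨k * l, by rw [mul_smul_comm, hl, mul_smul]⟩
  | mem y hy =>
    cases hy with
    | base =>
      by_cases h : u = w
      · subst h; exact ⟨1, by rw [vx_idem, one_smul]⟩
      · exact ⟨0, by rw [vx_orth _ _ _ _ _ h, zero_smul]⟩
    | step e y hy =>
      exact ⟨0, by rw [← vx_ed, ← mul_assoc, ← mul_assoc,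
        vx_orth _ _ _ _ _ (Ne.symm (hu e)), zero_mul, zero_mul, zero_smul]⟩

/-- one step along an edge, as a relation on vertices -/
def Step (w v : V) : Prop := ∃ e, s e = v ∧ r e = w

variable [Fintype E]

theorem reach_sink (hwf : WellFounded (Step V E s r)) (u : V) :
    ∀ x : LeavittPathAlgebra K V E s r, vx K V E s r u * x ≠ 0 →
      ∃ (b : LeavittPathAlgebra K V E s r) (w : V), (∀ e, s e ≠ w) ∧
        vx K V E s r w * (b * x) ≠ 0 := by
  induction u using hwf.induction with
  | _ u ih =>
    intro x hx
    by_cases hu : ∀ e, s e ≠ u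
    · exact ⟨1, u, hu, by rwa [one_mul]⟩
    · push Not at hu
      have hfin : {e : E | s e = u}.Finite := Set.toFinite _
      rw [vx_eq_sum K V E s r u hfin hu, Finset.sum_mul] at hx
      obtain ⟨e, he, hne⟩ := Finset.exists_ne_zero_of_sum_ne_zero hx
      have he : s e = u := by simpa using he
      have h0 : vx K V E s r (r e) * (gh K V E s r e * x) ≠ 0 := by
        rw [← mul_assoc, vx_gh]
        intro h0
        rw [mul_assoc, h0, mul_zero] at hne
        exact hne rfl
      obtain ⟨b, w, hw, hb⟩ := ih (r e) ⟨e, he, rfl⟩ _ h0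
      exact ⟨b * gh K V E s r e, w, hw, by rwa [mul_assoc b]⟩

theorem sink_semisimple (hwf : WellFounded (Step V E s r)) (w : V) (hw : ∀ e, s e ≠ w) :
    IsSemisimpleModule (LeavittPathAlgebra K V E s r)
      (Submodule.span (LeavittPathAlgebra K V E s r) {vx K V E s r w}) := by
  by_cases h0 : vx K V E s r w = 0
  · rw [h0, Submodule.span_zero_singleton]; exact ss_bot _ _
  suffices h : IsSimpleModule (LeavittPathAlgebra K V E s r)
      (Submodule.span (LeavittPathAlgebra K V E s r) {vx K V E s r w}) by infer_instance
  rw [isSimpleModule_iff_toSpanSingleton_surjective]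
  refine ⟨⟨⟨vx K V E s r w, Submodule.mem_span_singleton_self _⟩, 0, ?_⟩, ?_⟩
  · intro h; exact h0 (congrArg Subtype.val h)
  rintro ⟨x, hx⟩ hx0 ⟨y, hy⟩
  have hx0 : x ≠ 0 := fun h => hx0 (Subtype.ext h)
  obtain ⟨a, rfl⟩ := Submodule.mem_span_singleton.1 hx
  obtain ⟨c, rfl⟩ := Submodule.mem_span_singleton.1 hy
  have : ∃ u, vx K V E s r u * (a • vx K V E s r w) ≠ 0 := by
    by_contra! h
    apply hx0
    rw [← one_mul (a • _), one_eq_sum, Finset.sum_mul]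
    exact Finset.sum_eq_zero fun u _ => h u
  obtain ⟨u, hu⟩ := this
  obtain ⟨b, w', hw', hb⟩ := reach_sink K V E s r hwf u _ hu
  obtain ⟨k, hk⟩ := sink_scalar K V E s r w w' hw hw' (b * a)
  rw [smul_eq_mul, ← mul_assoc b, hk] at hb
  have hk0 : k ≠ 0 := by rintro rfl; simp at hb
  refine ⟨c * (k⁻¹ • (vx K V E s r w' * b)), Subtype.ext ?_⟩
  simp only [LinearMap.toSpanSingleton_apply, Submodule.coe_smul, smul_eq_mul]
  rw [mul_assoc c, smul_mul_assoc, mul_assoc, ← mul_assoc b, hk, smul_smul, inv_mul_cancel₀ hk0,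
    one_smul]

theorem vx_semisimple (hwf : WellFounded (Step V E s r)) (v : V) :
    IsSemisimpleModule (LeavittPathAlgebra K V E s r)
      (Submodule.span (LeavittPathAlgebra K V E s r) {vx K V E s r v}) := by
  induction v using hwf.induction with
  | _ v ih =>
    by_cases hv : ∀ e, s e ≠ v
    · exact sink_semisimple K V E s r hwf v hv
    · push Not at hv
      have hfin : {e : E | s e = v}.Finite := Set.toFinite _
      let p : E → Submodule (LeavittPathAlgebra K V E s r) (LeavittPathAlgebra K V E s r) :=
        fun e => (Submodule.span (LeavittPathAlgebra K V E s r) {vx K V E s r (r e)}).map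
          (LinearMap.toSpanSingleton _ _ (gh K V E s r e))
      have h1 : IsSemisimpleModule (LeavittPathAlgebra K V E s r)
          ↥(⨆ e ∈ {e : E | s e = v}, p e) := by
        apply isSemisimpleModule_biSup_of_isSemisimpleModule_submodule
        intro e he
        have := ih (r e) ⟨e, he, rfl⟩
        exact IsSemisimpleModule.of_surjective
          ((LinearMap.toSpanSingleton _ _ (gh K V E s r e)).submoduleMap _)
          (LinearMap.submoduleMap_surjective _ _)
      have h2 : Submodule.span (LeavittPathAlgebra K V E s r) {vx K V E s r v} ≤
          ⨆ e ∈ {e : E | s e = v}, p e := by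
        rw [Submodule.span_singleton_le_iff_mem, vx_eq_sum K V E s r v hfin hv]
        refine Submodule.sum_mem _ fun e he => ?_
        have he : s e = v := by simpa using he
        apply Submodule.mem_iSup_of_mem e
        apply Submodule.mem_iSup_of_mem he
        refine ⟨ed K V E s r e, ?_, rfl⟩
        exact Submodule.mem_span_singleton.2 ⟨ed K V E s r e, ed_vx ..⟩
      exact ss_of_le h2 h1

theorem semisimple_of_wf (hwf : WellFounded (Step V E s r)) :
    IsSemisimpleRing (LeavittPathAlgebra K V E s r) := by
  apply isSemisimpleModule_of_isSemisimpleModule_submodule' (vx_semisimple K V E s r hwf)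
  rw [Ideal.eq_top_iff_one]
  rw [one_eq_sum]
  refine Submodule.sum_mem _ fun v _ => Submodule.mem_iSup_of_mem v ?_
  exact Submodule.mem_span_singleton_self _

end Algebra

theorem vnr_of_semisimple (R : Type) [Ring R] [IsSemisimpleRing R] (a : R) :
    ∃ b : R, a = a * b * a := by
  obtain ⟨e, he, h⟩ := IsSemisimpleRing.ideal_eq_span_idempotent (Ideal.span {a})
  have h1 : e ∈ Ideal.span {a} := h ▸ Ideal.mem_span_singleton_self e
  have h2 : a ∈ Ideal.span {e} := h ▸ Ideal.mem_span_singleton_self a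
  obtain ⟨b, rfl⟩ := Ideal.mem_span_singleton'.1 h1
  obtain ⟨c, hc⟩ := Ideal.mem_span_singleton'.1 h2
  refine ⟨b, ?_⟩
  calc a = c * (b * a) := hc.symm
    _ = c * ((b * a) * (b * a)) := by rw [he.eq]
    _ = a * (b * a) := by rw [← mul_assoc, hc]
    _ = a * b * a := by rw [mul_assoc]

theorem pure_of_or (R : Type) [Ring R]
    (h : (∀ (M : Type) [AddCommGroup M] [Module R M], IsSimpleModule R M → Module.Injective R M) ∨
      ∀ a : R, ∃ b : R, a = a * b * a)
    (M : Type) [AddCommGroup M] [Module R M] (S : Submodule R M) (hS : IsSimpleModule R S)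
    (a : R) (m : M) (ham : a • m ∈ S) : ∃ y ∈ S, a • y = a • m := by
  rcases h with h | h
  · obtain ⟨f, hf⟩ := (h S hS).out S.subtype S.injective_subtype LinearMap.id
    refine ⟨f m, (f m).2, ?_⟩
    have := hf ⟨a • m, ham⟩
    simp only [Submodule.subtype_apply, map_smul, LinearMap.id_apply] at this
    exact congrArg Subtype.val this
  · obtain ⟨b, hb⟩ := h a
    refine ⟨b • (a • m), S.smul_mem _ ham, ?_⟩
    rw [← mul_smul, ← mul_smul, ← hb]

section Rep

variable (K V E : Type) [Field K] [Fintype V] (s r : E → V)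

/-- infinite paths -/
def InfPath : Type := {x : ℕ → E // ∀ n, r (x n) = s (x (n + 1))}

variable {V E s r}

/-- drop the first edge -/
def InfPath.shift (x : InfPath V E s r) : InfPath V E s r :=
  ⟨fun n => x.1 (n + 1), fun n => x.2 (n + 1)⟩

/-- prepend an edge -/
def InfPath.cons (e : E) (x : InfPath V E s r) (h : r e = s (x.1 0)) : InfPath V E s r :=
  ⟨fun n => Nat.casesOn n e x.1, fun n => by cases n with
    | zero => exact h
    | succ n => exact x.2 n⟩

@[simp] theorem InfPath.cons_zero (e : E) (x : InfPath V E s r) (h) : (x.cons e h).1 0 = e := rfl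

theorem InfPath.cons_succ (e : E) (x : InfPath V E s r) (h) (n) :
    (x.cons e h).1 (n + 1) = x.1 n := rfl

theorem InfPath.shift_val (x : InfPath V E s r) (n) : x.shift.1 n = x.1 (n + 1) := rfl

@[simp] theorem InfPath.shift_cons (e : E) (x : InfPath V E s r) (h) : (x.cons e h).shift = x := rfl

@[simp] theorem InfPath.cons_shift (x : InfPath V E s r) (h) :
    x.shift.cons (x.1 0) h = x := by
  apply Subtype.ext
  funext n
  cases n <;> rfl

theorem InfPath.ext_shift {x y : InfPath V E s r} (h0 : x.1 0 = y.1 0) (h : x.shift = y.shift) :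
    x = y := by
  apply Subtype.ext
  funext n
  cases n with
  | zero => exact h0
  | succ n => exact congrFun (congrArg Subtype.val h) n

variable (V E s r)

/-- the representation space -/
abbrev RepF : Type := InfPath V E s r → ℤ → K

open scoped Classical in
/-- vertex operator -/
noncomputable def opV (v : V) : Module.End K (RepF K V E s r) where
  toFun f := fun x n => if s (x.1 0) = v then f x n else 0
  map_add' f g := by funext x n; simp only [Pi.add_apply]; split_ifs <;> simp
  map_smul' k f := by funext x n; simp

open scoped Classical in
/-- edge operator -/
noncomputable def opE (e : E) : Module.End K (RepF K V E s r) where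
  toFun f := fun x n => if x.1 0 = e then f x.shift (n - 1) else 0
  map_add' f g := by funext x n; simp only [Pi.add_apply]; split_ifs <;> simp
  map_smul' k f := by funext x n; simp

open scoped Classical in
/-- ghost edge operator -/
noncomputable def opG (e : E) : Module.End K (RepF K V E s r) where
  toFun f := fun x n => if h : r e = s (x.1 0) then f (x.cons e h) (n + 1) else 0
  map_add' f g := by funext x n; simp only [Pi.add_apply]; split_ifs <;> simp
  map_smul' k f := by
    funext x n; simp only [Pi.smul_apply, RingHom.id_apply]; split_ifs <;> simp

open scoped Classical in
theorem opV_apply (v : V) (f : RepF K V E s r) (x n) :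
    opV K V E s r v f x n = if s (x.1 0) = v then f x n else 0 := rfl

open scoped Classical in
theorem opE_apply (e : E) (f : RepF K V E s r) (x n) :
    opE K V E s r e f x n = if x.1 0 = e then f x.shift (n - 1) else 0 := rfl

open scoped Classical in
theorem opG_apply (e : E) (f : RepF K V E s r) (x n) :
    opG K V E s r e f x n = if h : r e = s (x.1 0) then f (x.cons e h) (n + 1) else 0 := rfl

/-- operator of a generator -/
noncomputable def opGen : LPAGen V E → Module.End K (RepF K V E s r)
  | .vertex v => opV K V E s r v
  | .edge e => opE K V E s r e
  | .ghost e => opG K V E s r e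

theorem op_rel ⦃a b : FreeAlgebra K (LPAGen V E)⦄ (h : LPARel K V E s r a b) :
    FreeAlgebra.lift K (opGen K V E s r) a = FreeAlgebra.lift K (opGen K V E s r) b := by
  classical
  cases h with
  | vertex_orth v w h =>
    simp only [map_mul, FreeAlgebra.lift_ι_apply, opGen, map_zero]
    apply LinearMap.ext; intro f; funext x n
    simp only [Module.End.mul_apply, opV_apply]
    split_ifs with h1 h2
    · exact absurd (h1.symm.trans h2) h
    · rfl
    · rfl
  | vertex_idem v =>
    simp only [map_mul, FreeAlgebra.lift_ι_apply, opGen]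
    apply LinearMap.ext; intro f; funext x n
    simp only [Module.End.mul_apply, opV_apply]
    split_ifs <;> rfl
  | edge_src e =>
    simp only [map_mul, FreeAlgebra.lift_ι_apply, opGen]
    apply LinearMap.ext; intro f; funext x n
    simp only [Module.End.mul_apply, opV_apply, opE_apply]
    split_ifs with h1 h2 <;> simp_all
  | edge_rng e =>
    simp only [map_mul, FreeAlgebra.lift_ι_apply, opGen]
    apply LinearMap.ext; intro f; funext x n
    simp only [Module.End.mul_apply, opV_apply, opE_apply]
    split_ifs with h1 h2
    · rfl
    · exact absurd (by rw [← h1]; exact (x.2 0).symm) h2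
    · rfl
  | ghost_rng e =>
    simp only [map_mul, FreeAlgebra.lift_ι_apply, opGen]
    apply LinearMap.ext; intro f; funext x n
    simp only [Module.End.mul_apply, opV_apply, opG_apply]
    split_ifs with h1 h2 <;> simp_all
  | ghost_src e =>
    simp only [map_mul, FreeAlgebra.lift_ι_apply, opGen]
    apply LinearMap.ext; intro f; funext x n
    simp only [Module.End.mul_apply, opV_apply, opG_apply]
    split_ifs with h1 h2 <;> simp_all
  | ck1_distinct e f h =>
    simp only [map_mul, FreeAlgebra.lift_ι_apply, opGen, map_zero]
    apply LinearMap.ext; intro f; funext x n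
    simp [Module.End.mul_apply, opE_apply, opG_apply, h]
  | ck1_same e =>
    simp only [map_mul, FreeAlgebra.lift_ι_apply, opGen]
    apply LinearMap.ext; intro f; funext x n
    simp [Module.End.mul_apply, opE_apply, opG_apply, opV_apply, eq_comm]
  | ck2 v h hne =>
    simp only [map_mul, map_sum, FreeAlgebra.lift_ι_apply, opGen]
    apply LinearMap.ext; intro f; funext x n
    simp only [LinearMap.sum_apply, Finset.sum_apply, Module.End.mul_apply, opE_apply, opG_apply,
      opV_apply, Finset.sum_ite_eq, Set.Finite.mem_toFinset, Set.mem_ofPred_eq, sub_add_cancel]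
    rw [dif_pos (show r (x.1 0) = s (x.shift.1 0) from x.2 0), InfPath.cons_shift]
  | unit =>
    simp only [map_one, map_sum, FreeAlgebra.lift_ι_apply, opGen]
    apply LinearMap.ext; intro f; funext x n
    simp [LinearMap.sum_apply, Finset.sum_apply, opV_apply]

/-- the representation -/
noncomputable def rep : LeavittPathAlgebra K V E s r →ₐ[K] Module.End K (RepF K V E s r) :=
  RingQuot.liftAlgHom K ⟨FreeAlgebra.lift K (opGen K V E s r), op_rel K V E s r⟩

theorem rep_gen (g : LPAGen V E) : rep K V E s r (gen K V E s r g) = opGen K V E s r g := by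
  unfold rep gen
  rw [RingQuot.liftAlgHom_mkAlgHom_apply, FreeAlgebra.lift_ι_apply]

/-- the module structure -/
noncomputable instance : Module (LeavittPathAlgebra K V E s r) (RepF K V E s r) :=
  Module.compHom _ (rep K V E s r).toRingHom

theorem smul_rep (a : LeavittPathAlgebra K V E s r) (f : RepF K V E s r) :
    a • f = rep K V E s r a f := rfl

variable {V E s r}

/-- tail equivalence to `c` (with arbitrarily large lag) -/
def Orb (c x : InfPath V E s r) : Prop := ∀ B : ℕ, ∃ N ≥ B, InfPath.shift^[N] x = c

theorem Orb.shift {c x : InfPath V E s r} (h : Orb c x) : Orb c x.shift := by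
  intro B
  obtain ⟨N, hN, h⟩ := h (B + 1)
  obtain ⟨M, rfl⟩ : ∃ M, N = M + 1 := ⟨N - 1, by omega⟩
  exact ⟨M, by omega, h⟩

theorem Orb.of_shift {c x : InfPath V E s r} (h : Orb c x.shift) : Orb c x := by
  intro B
  obtain ⟨N, hN, h⟩ := h B
  exact ⟨N + 1, by omega, h⟩

/-- functions constant in the integer variable and finitely supported on the orbit of `c` -/
noncomputable def SK (c : InfPath V E s r) : Submodule K (RepF K V E s r) where
  carrier := {f | (∀ x n, f x n = f x 0) ∧ {x | f x 0 ≠ 0}.Finite ∧ ∀ x, f x 0 ≠ 0 → Orb c x}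
  zero_mem' := by simp
  add_mem' := by
    rintro f g ⟨f1, f2, f3⟩ ⟨g1, g2, g3⟩
    have key : ∀ x, (f + g) x 0 ≠ 0 → f x 0 ≠ 0 ∨ g x 0 ≠ 0 := by
      intro x hx
      by_contra! h
      exact hx (by simp [h.1, h.2])
    refine ⟨fun x n => by simp only [Pi.add_apply, f1 x n, g1 x n], ?_, fun x hx => ?_⟩
    · exact (f2.union g2).subset key
    · exact (key x hx).elim (f3 x) (g3 x)
  smul_mem' := by
    rintro k f ⟨f1, f2, f3⟩
    have key : ∀ x, (k • f) x 0 ≠ 0 → f x 0 ≠ 0 := by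
      intro x hx h
      exact hx (by simp [h])
    exact ⟨fun x n => by simp only [Pi.smul_apply, f1 x n], f2.subset key,
      fun x hx => f3 x (key x hx)⟩

theorem SK_gen (c : InfPath V E s r) (g : LPAGen V E) (f : RepF K V E s r) (hf : f ∈ SK K c) :
    opGen K V E s r g f ∈ SK K c := by
  classical
  obtain ⟨f1, f2, f3⟩ := hf
  cases g with
  | vertex v =>
    have key : ∀ x, opV K V E s r v f x 0 ≠ 0 → f x 0 ≠ 0 := by
      intro x hx h
      exact hx (by simp [opV_apply, h])
    exact ⟨fun x n => by simp only [opGen, opV_apply, f1 x n], f2.subset key,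
      fun x hx => f3 x (key x hx)⟩
  | edge e =>
    have key : ∀ x, opE K V E s r e f x 0 ≠ 0 → x.1 0 = e ∧ f x.shift 0 ≠ 0 := by
      intro x hx
      rw [opE_apply, f1] at hx
      simpa using hx
    refine ⟨fun x n => by simp only [opGen, opE_apply, f1 _ (n - 1), f1 _ (0 - 1)], ?_,
      fun x hx => (f3 _ (key x hx).2).of_shift⟩
    have : Set.InjOn InfPath.shift {x : InfPath V E s r | x.1 0 = e} := by
      intro x hx y hy h
      exact InfPath.ext_shift (Eq.trans hx (Eq.symm hy)) h
    refine Set.Finite.of_finite_image (f := InfPath.shift) (f2.subset ?_)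
      (this.mono fun x hx => (key x hx).1)
    rintro _ ⟨x, hx, rfl⟩
    exact (key x hx).2
  | ghost e =>
    have key : ∀ x, opG K V E s r e f x 0 ≠ 0 → ∃ h, f (x.cons e h) 0 ≠ 0 := by
      intro x hx
      rw [opG_apply] at hx
      split_ifs at hx with h
      · exact ⟨h, by rwa [f1] at hx⟩
      · exact absurd rfl hx
    refine ⟨fun x n => ?_, ?_, fun x hx => ?_⟩
    · simp only [opGen, opG_apply]
      split_ifs with h
      · rw [f1, f1 _ (0 + 1)]
      · rfl
    · refine (f2.image InfPath.shift).subset fun x hx => ?_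
      obtain ⟨h, h'⟩ := key x hx
      exact ⟨_, h', rfl⟩
    · obtain ⟨h, h'⟩ := key x hx
      exact (f3 _ h').shift

theorem SK_smul (c : InfPath V E s r) (a : LeavittPathAlgebra K V E s r) :
    ∀ f : RepF K V E s r, f ∈ SK K c → a • f ∈ SK K c := by
  induction a using lpa_induction with
  | hk k =>
    intro f hf
    rw [smul_rep, AlgHom.commutes]
    exact Submodule.smul_mem _ k hf
  | hg g => intro f hf; rw [smul_rep, rep_gen]; exact SK_gen K c g f hf
  | hm a b h1 h2 => intro f hf; rw [mul_smul]; exact h1 _ (h2 _ hf)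
  | ha a b h1 h2 => intro f hf; rw [add_smul]; exact add_mem (h1 _ hf) (h2 _ hf)

open scoped Classical in
/-- indicator of `c` times a function of the integer variable -/
noncomputable def ind (c : InfPath V E s r) (φ : ℤ → K) : RepF K V E s r :=
  fun x n => if x = c then φ n else 0

theorem ind_mem (c : InfPath V E s r) (hc : Orb c c) : ind K c (fun _ => 1) ∈ SK K c := by
  have key : ∀ x, ind K c (fun _ => 1) x 0 ≠ 0 → x = c := by
    intro x hx
    by_contra h
    exact hx (by simp [ind, h])
  refine ⟨fun x n => rfl, (Set.finite_singleton c).subset key, fun x hx => ?_⟩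
  rw [key x hx]; exact hc

theorem reach_ind (c : InfPath V E s r) (N : ℕ) :
    ∀ (x : InfPath V E s r) (y : RepF K V E s r), y ∈ SK K c → y x 0 ≠ 0 →
      InfPath.shift^[N] x = c →
      (∀ z, y z 0 ≠ 0 → (∀ i < N, z.1 i = x.1 i) → z = x) →
      ∃ a : LeavittPathAlgebra K V E s r, a • y = ind K c (fun _ => 1) := by
  classical
  induction N with
  | zero =>
    intro x y hy hx hc h
    have hc : x = c := hc
    subst hc
    refine ⟨algebraMap K _ (y x 0)⁻¹, ?_⟩
    rw [smul_rep, AlgHom.commutes]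
    change (y x 0)⁻¹ • y = _
    funext z n
    simp only [Pi.smul_apply, smul_eq_mul, ind]
    rw [hy.1 z n]
    split_ifs with hz
    · subst hz; exact inv_mul_cancel₀ hx
    · have : y z 0 = 0 := by
        by_contra h0
        exact hz (h z h0 (by simp))
      rw [this, mul_zero]
  | succ N ih =>
    intro x y hy hx hc h
    have hy' := SK_gen K c (.ghost (x.1 0)) y hy
    obtain ⟨a, ha⟩ := ih x.shift _ hy' (by
      simp only [opGen, opG_apply]
      rw [dif_pos (show r (x.1 0) = s (x.shift.1 0) from x.2 0), InfPath.cons_shift, hy.1]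
      exact hx) hc (by
      intro z hz hzi
      simp only [opGen, opG_apply] at hz
      split_ifs at hz with h0
      · rw [hy.1] at hz
        have := h _ hz (by
          intro i hi
          cases i with
          | zero => rfl
          | succ i => exact hzi i (by omega))
        rw [← InfPath.shift_cons _ z h0, this]
      · exact absurd rfl hz)
    refine ⟨a * gh K V E s r (x.1 0), ?_⟩
    rw [mul_smul, smul_rep K V E s r (gh K V E s r (x.1 0)), rep_gen]
    exact ha

theorem exists_sep (x : InfPath V E s r) (T : Set (InfPath V E s r)) (hT : T.Finite) :
    ∃ B : ℕ, ∀ z ∈ T, (∀ i < B, z.1 i = x.1 i) → z = x := by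
  induction T, hT using Set.Finite.induction_on with
  | empty => exact ⟨0, by simp⟩
  | @insert w T _ _ ih =>
    obtain ⟨B, hB⟩ := ih
    by_cases hw : w = x
    · refine ⟨B, fun z hz h => ?_⟩
      rcases hz with rfl | hz
      · exact hw
      · exact hB z hz h
    · obtain ⟨j, hj⟩ : ∃ j, w.1 j ≠ x.1 j := by
        by_contra! h
        exact hw (Subtype.ext (funext h))
      refine ⟨max B (j + 1), fun z hz h => ?_⟩
      rcases hz with rfl | hz
      · exact absurd (h j (by omega)) hj
      · exact hB z hz fun i hi => h i (by omega)

theorem reach_ind' (c : InfPath V E s r) (y : RepF K V E s r) (hy : y ∈ SK K c) (h0 : y ≠ 0) :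
    ∃ a : LeavittPathAlgebra K V E s r, a • y = ind K c (fun _ => 1) := by
  obtain ⟨x, hx⟩ : ∃ x, y x 0 ≠ 0 := by
    by_contra! h
    apply h0
    funext x n
    rw [hy.1, h]; rfl
  obtain ⟨B, hB⟩ := exists_sep x _ hy.2.1
  obtain ⟨N, hN, hc⟩ := hy.2.2 x hx B
  exact reach_ind K c N x y hy hx hc fun z hz h => hB z hz fun i hi => h i (by omega)

/-- the simple module -/
noncomputable def SL (c : InfPath V E s r) :
    Submodule (LeavittPathAlgebra K V E s r) (RepF K V E s r) :=
  Submodule.span _ {ind K c (fun _ => 1)}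

theorem SL_simple (c : InfPath V E s r) (hc : Orb c c) :
    IsSimpleModule (LeavittPathAlgebra K V E s r) (SL K c) := by
  have h0 : ind K c (fun _ => 1) ≠ 0 := by
    intro h
    have := congrFun (congrFun h c) 0
    simp [ind] at this
  rw [isSimpleModule_iff_toSpanSingleton_surjective]
  refine ⟨⟨⟨_, Submodule.mem_span_singleton_self _⟩, 0, fun h => h0 (congrArg Subtype.val h)⟩, ?_⟩
  rintro ⟨x, hx⟩ hx0 ⟨y, hy⟩
  have hx0 : x ≠ 0 := fun h => hx0 (Subtype.ext h)
  obtain ⟨a, rfl⟩ := Submodule.mem_span_singleton.1 hx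
  obtain ⟨b, rfl⟩ := Submodule.mem_span_singleton.1 hy
  obtain ⟨d, hd⟩ := reach_ind' K c _ (SK_smul K c a _ (ind_mem K c hc)) hx0
  refine ⟨b * d, Subtype.ext ?_⟩
  simp only [LinearMap.toSpanSingleton_apply, Submodule.coe_smul]
  rw [mul_smul, hd]

/-- product of the first `k` edges of `x` -/
noncomputable def word : ℕ → InfPath V E s r → LeavittPathAlgebra K V E s r
  | 0, _ => 1
  | k + 1, x => ed K V E s r (x.1 0) * word k x.shift

open scoped Classical in
theorem word_smul (k : ℕ) : ∀ (x : InfPath V E s r) (f : RepF K V E s r) (z n),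
    (word K k x • f) z n =
      if ∀ i < k, z.1 i = x.1 i then f (InfPath.shift^[k] z) (n - k) else 0 := by
  induction k with
  | zero => intro x f z n; simp [word]
  | succ k ih =>
    intro x f z n
    rw [word, mul_smul, smul_rep, rep_gen]
    simp only [opGen, opE_apply]
    by_cases h0 : z.1 0 = x.1 0
    · rw [if_pos h0, ih]
      have : (∀ i < k + 1, z.1 i = x.1 i) ↔ (∀ i < k, z.shift.1 i = x.shift.1 i) := by
        constructor
        · intro h i hi; exact h (i + 1) (by omega)
        · intro h i hi
          cases i with
          | zero => exact h0
          | succ i => exact h i (by omega)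
      simp only [this, Function.iterate_succ_apply]
      congr 2
      push_cast; ring
    · rw [if_neg h0, if_neg]
      intro h; exact h0 (h 0 (by omega))

theorem shift_iter (k : ℕ) : ∀ (x : InfPath V E s r) (n), (InfPath.shift^[k] x).1 n = x.1 (n + k) := by
  induction k with
  | zero => intro x n; rfl
  | succ k ih => intro x n; rw [Function.iterate_succ_apply, ih]; rfl

theorem not_pure (c : InfPath V E s r) (k : ℕ) (hk : 0 < k) (hc : InfPath.shift^[k] c = c)
    (h : ∀ (S : Submodule (LeavittPathAlgebra K V E s r) (RepF K V E s r)),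
      IsSimpleModule (LeavittPathAlgebra K V E s r) S →
      ∀ (a : LeavittPathAlgebra K V E s r) (m : RepF K V E s r), a • m ∈ S →
        ∃ y ∈ S, a • y = a • m) : False := by
  classical
  have horb : Orb c c := by
    intro B
    refine ⟨k * B, Nat.le_mul_of_pos_left B hk, ?_⟩
    rw [Function.iterate_mul]
    exact Function.iterate_fixed hc B
  have key : (1 - word K k c) • ind K c (fun n => ((n / (k : ℤ) : ℤ) : K)) =
      ind K c (fun _ => 1) := by
    funext z n
    rw [sub_smul, one_smul]
    simp only [Pi.sub_apply, word_smul]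
    by_cases hz : z = c
    · subst hz
      have : (n - k) / (k : ℤ) = n / k - 1 := by
        rw [Int.sub_ediv_of_dvd _ (dvd_refl _), Int.ediv_self (by omega)]
      simp [ind, hc, this]
    · have h1 : ¬ ((∀ i < k, z.1 i = c.1 i) ∧ InfPath.shift^[k] z = c) := by
        rintro ⟨h1, h2⟩
        apply hz
        apply Subtype.ext
        funext i
        by_cases hi : i < k
        · exact h1 i hi
        · have e1 := shift_iter k z (i - k)
          have e2 := shift_iter k c (i - k)
          rw [Nat.sub_add_cancel (by omega)] at e1 e2
          rw [← e1, ← e2, h2, hc]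
      by_cases h2 : ∀ i < k, z.1 i = c.1 i
      · have h3 : ¬ InfPath.shift^[k] z = c := fun h3 => h1 ⟨h2, h3⟩
        simp [ind, hz, h3]
      · simp [ind, hz, h2]
  obtain ⟨y, hy, hay⟩ := h (SL K c) (SL_simple K c horb) (1 - word K k c) _
    (by rw [key]; exact Submodule.mem_span_singleton_self _)
  obtain ⟨b, rfl⟩ := Submodule.mem_span_singleton.1 hy
  have hb := SK_smul K c b _ (ind_mem K c horb)
  rw [key] at hay
  generalize b • ind K c (fun _ => 1) = y at hay hb
  have := congrFun (congrFun hay c) 0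
  rw [sub_smul, one_smul, Pi.sub_apply, Pi.sub_apply, word_smul, hb.1 _ (0 - k), hc] at this
  simp [ind] at this

theorem exists_periodic (hwf : ¬ WellFounded (Step V E s r)) :
    ∃ (c : InfPath V E s r) (k : ℕ), 0 < k ∧ InfPath.shift^[k] c = c := by
  rw [wellFounded_iff_isEmpty_descending_chain, not_isEmpty_iff] at hwf
  obtain ⟨v, hv⟩ := hwf
  choose e he1 he2 using hv
  obtain ⟨i, j, hij, heq⟩ : ∃ i j, i < j ∧ v i = v j := by
    obtain ⟨i, j, hne, h⟩ := Finite.exists_ne_map_eq_of_infinite v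
    rcases lt_or_gt_of_ne hne with h1 | h1
    · exact ⟨i, j, h1, h⟩
    · exact ⟨j, i, h1, h.symm⟩
  obtain ⟨k, rfl⟩ : ∃ k, j = i + k := ⟨j - i, by omega⟩
  have hk : 0 < k := by omega
  refine ⟨⟨fun n => e (i + n % k), fun n => ?_⟩, k, hk, ?_⟩
  · rw [he1, he2]
    have hn : n % k < k := Nat.mod_lt _ hk
    by_cases h : n % k + 1 = k
    · have : (n + 1) % k = 0 := by
        rw [Nat.add_mod]
        rcases Nat.lt_or_ge 1 k with h1 | h1
        · rw [Nat.mod_eq_of_lt h1, h, Nat.mod_self]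
        · have : k = 1 := by omega
          subst this; exact Nat.mod_one _
      rw [this, add_zero, heq, add_assoc, h]
    · have : (n + 1) % k = n % k + 1 := by
        rw [Nat.add_mod, Nat.mod_eq_of_lt (show 1 < k by omega), Nat.mod_eq_of_lt (by omega)]
      rw [this, add_assoc]
  · apply Subtype.ext
    funext n
    refine (shift_iter k _ n).trans ?_
    change e (i + (n + k) % k) = e (i + n % k)
    rw [Nat.add_mod_right]

end Rep

theorem wf_of_or (K V E : Type) [Field K] [Fintype V] (s r : E → V)
    (h : (∀ (M : Type) [AddCommGroup M] [Module (LeavittPathAlgebra K V E s r) M],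
        IsSimpleModule (LeavittPathAlgebra K V E s r) M →
        Module.Injective (LeavittPathAlgebra K V E s r) M) ∨
      ∀ a : LeavittPathAlgebra K V E s r, ∃ b : LeavittPathAlgebra K V E s r, a = a * b * a) :
    WellFounded (Step V E s r) := by
  by_contra hwf
  obtain ⟨c, k, hk, hc⟩ := exists_periodic hwf
  exact not_pure K c k hk hc fun S hS a m ham => pure_of_or _ h _ S hS a m ham

end LPAProof

/-- For a finite directed graph `E` and a field `K`, every simple left
module over the Leavitt path algebra `L = L_K(E)` is injective if and only if `L` is von
Neumann regular. -/
theorem lpa_allSimpleInjective_iff_vonNeumannRegular (K V E : Type) [Field K] [Fintype V]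
    [Fintype E] (s r : E → V) :
    (∀ (M : Type) [AddCommGroup M] [Module (LeavittPathAlgebra K V E s r) M],
        IsSimpleModule (LeavittPathAlgebra K V E s r) M →
        Module.Injective (LeavittPathAlgebra K V E s r) M) ↔
      ∀ a : LeavittPathAlgebra K V E s r,
        ∃ b : LeavittPathAlgebra K V E s r, a = a * b * a := by

  constructor
  · intro h
    have := LPAProof.semisimple_of_wf K V E s r (LPAProof.wf_of_or K V E s r (Or.inl h))
    exact LPAProof.vnr_of_semisimple _
  · intro h M _ _ _
    have := LPAProof.semisimple_of_wf K V E s r (LPAProof.wf_of_or K V E s r (Or.inr h))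
    exact Module.injective_of_isSemisimpleRing _ _
end

section
/- Let E be a finite directed graph (E⁰ and E¹ both finite) and K a field, and let L = L_K(E) be the (unital) Leavitt path algebra. Then every simple left L-module is finitely presented if and only if no two distinct cycles in E have a common vertex. -/
/-- A list of edges is a path chain if the range of each edge is the source of the next. -/
def IsPathChain {V E : Type} (s r : E → V) (es : List E) : Prop :=
  ∀ (i : ℕ) (h : i + 1 < es.length), r (es[i]'(by omega)) = s (es[i+1]'h)

/-- A nonempty list of edges is a cycle if it is a closed path chain whose sources are
pairwise distinct. -/
def IsCycle {V E : Type} (s r : E → V) (es : List E) : Prop :=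
  ∃ hne : es ≠ [], IsPathChain s r es ∧ r (es.getLast hne) = s (es.head hne) ∧
    (es.map s).Nodup

/-- A path (given as a list of edges) has an exit if some edge `f` has the same source as
one of the edges of the path but differs from it. -/
def HasExit {V E : Type} (s r : E → V) (es : List E) : Prop :=
  ∃ (f : E) (i : ℕ) (h : i < es.length), s f = s (es[i]'h) ∧ f ≠ es[i]'h




set_option linter.unusedSectionVars false
set_option linter.unusedSimpArgs false

/-! ### Abstract Leavitt path algebras -/

/-- An abstract Leavitt family generating an algebra. -/
structure LPAFam (K : Type) [Field K] {V E : Type} [Fintype V] [Fintype E] (s r : E → V)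
    (L : Type) [Ring L] [Algebra K L] where
  vt : V → L
  ed : E → L
  gh : E → L
  vv : ∀ v w, v ≠ w → vt v * vt w = 0
  vi : ∀ v, vt v * vt v = vt v
  es : ∀ e, vt (s e) * ed e = ed e
  er : ∀ e, ed e * vt (r e) = ed e
  gr : ∀ e, vt (r e) * gh e = gh e
  gs : ∀ e, gh e * vt (s e) = gh e
  gne : ∀ e f, e ≠ f → gh e * ed f = 0
  geq : ∀ e, gh e * ed e = vt (r e)
  ck : ∀ v (F : Finset E), (∀ e, e ∈ F ↔ s e = v) → F.Nonempty → vt v = ∑ e ∈ F, ed e * gh e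
  one : (1 : L) = ∑ v, vt v
  gen : Algebra.adjoin K (Set.range vt ∪ Set.range ed ∪ Set.range gh) = ⊤

namespace LPAFam

variable {K : Type} [Field K] {V E : Type} [Fintype V] [Fintype E] {s r : E → V}
    {L : Type} [Ring L] [Algebra K L] (A : LPAFam K s r L)
    {M : Type} [AddCommGroup M] [Module K M] [Module L M] [IsScalarTower K L M]

theorem ve_ne (v : V) (e : E) (h : v ≠ s e) : A.vt v * A.ed e = 0 := by
  rw [← A.es e, ← mul_assoc, A.vv _ _ h, zero_mul]

theorem gv_ne (v : V) (e : E) (h : v ≠ s e) : A.gh e * A.vt v = 0 := by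
  rw [← A.gs e, mul_assoc, A.vv _ _ h.symm, mul_zero]

theorem ev_ne (v : V) (e : E) (h : v ≠ r e) : A.ed e * A.vt v = 0 := by
  rw [← A.er e, mul_assoc, A.vv _ _ h.symm, mul_zero]

theorem vg_ne (v : V) (e : E) (h : v ≠ r e) : A.vt v * A.gh e = 0 := by
  rw [← A.gr e, ← mul_assoc, A.vv _ _ h, zero_mul]

theorem sum_vt {M : Type} [AddCommGroup M] [Module L M] (m : M) : m = ∑ v, A.vt v • m := by
  rw [← Finset.sum_smul, ← A.one, one_smul]

/-- Induction along generators acting on a module. -/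
theorem smul_closed (P : M → Prop) (hadd : ∀ a b, P a → P b → P (a + b))
    (hk : ∀ (k : K) a, P a → P (k • a))
    (hv : ∀ v a, P a → P (A.vt v • a)) (he : ∀ e a, P a → P (A.ed e • a))
    (hg : ∀ e a, P a → P (A.gh e • a)) (a : L) (m : M) (hm : P m) : P (a • m) := by
  have ha : a ∈ Algebra.adjoin K (Set.range A.vt ∪ Set.range A.ed ∪ Set.range A.gh) := by
    rw [A.gen]; trivial
  induction ha using Algebra.adjoin_induction generalizing m with
  | mem x hx =>
    rcases hx with (⟨v, rfl⟩ | ⟨v, rfl⟩) | ⟨v, rfl⟩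
    · exact hv _ _ hm
    · exact he _ _ hm
    · exact hg _ _ hm
  | algebraMap k => rw [algebraMap_smul]; exact hk _ _ hm
  | add x y _ _ hx hy => rw [add_smul]; exact hadd _ _ (hx m hm) (hy m hm)
  | mul x y _ _ hx hy => rw [mul_smul]; exact hx _ (hy m hm)

/-- The filtration of the module generated by `U`. -/
inductive Fil (U : Submodule K M) : ℕ → M → Prop
  | base (n : ℕ) (u : M) (h : u ∈ U) : Fil U n u
  | add (n : ℕ) (a b : M) (ha : Fil U n a) (hb : Fil U n b) : Fil U n (a + b)
  | edge (n : ℕ) (e : E) (a : M) (ha : Fil U n a) : Fil U (n + 1) (A.ed e • a)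

variable {A} {U : Submodule K M}

theorem Fil.smul {n : ℕ} {a : M} (h : A.Fil U n a) (k : K) : A.Fil U n (k • a) := by
  induction h with
  | base n u h => exact .base _ _ (U.smul_mem _ h)
  | add n a b _ _ ha hb => rw [smul_add]; exact .add _ _ _ ha hb
  | edge n e a _ ha =>
    have : k • A.ed e • a = A.ed e • k • a := by
      rw [← algebraMap_smul L k, ← algebraMap_smul L k, ← mul_smul, ← mul_smul,
        Algebra.commutes]
    rw [this]
    exact .edge _ _ _ ha

theorem Fil.succ {n : ℕ} {a : M} (h : A.Fil U n a) : A.Fil U (n + 1) a := by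
  induction h with
  | base n u h => exact .base _ _ h
  | add n a b _ _ ha hb => exact .add _ _ _ ha hb
  | edge n e a _ ha => exact .edge _ _ _ ha

theorem Fil.mono {n k : ℕ} {a : M} (h : A.Fil U n a) (hk : n ≤ k) : A.Fil U k a := by
  induction hk with
  | refl => exact h
  | step _ ih => exact ih.succ

theorem Fil.zero_mem {n : ℕ} : A.Fil U n 0 := .base _ _ U.zero_mem

theorem Fil.vt (hv : ∀ v, ∀ u ∈ U, A.vt v • u ∈ U) {n : ℕ} {a : M} (h : A.Fil U n a) (v : V) :
    A.Fil U n (A.vt v • a) := by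
  induction h with
  | base n u h => exact .base _ _ (hv _ _ h)
  | add n a b _ _ ha hb => rw [smul_add]; exact .add _ _ _ ha hb
  | edge n e a h' ha =>
    rw [← mul_smul]
    by_cases hh : v = s e
    · subst hh; rw [A.es]; exact .edge _ _ _ h'
    · rw [A.ve_ne _ _ hh, zero_smul]; exact Fil.zero_mem

theorem Fil.gh (hv : ∀ v, ∀ u ∈ U, A.vt v • u ∈ U) (hg : ∀ e, ∀ u ∈ U, A.gh e • u ∈ U)
    {n : ℕ} {a : M} (h : A.Fil U n a) (e : E) : A.Fil U (n - 1) (A.gh e • a) := by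
  induction h with
  | base n u h => exact .base _ _ (hg _ _ h)
  | add n a b _ _ ha hb => rw [smul_add]; exact .add _ _ _ ha hb
  | edge n f a h' ha =>
    rw [← mul_smul]
    by_cases hh : e = f
    · subst hh; rw [A.geq]; exact h'.vt hv _
    · rw [A.gne _ _ hh, zero_smul]; exact Fil.zero_mem

theorem Fil.sink (hv : ∀ v, ∀ u ∈ U, A.vt v • u ∈ U) {n : ℕ} {a : M} (h : A.Fil U n a) (v : V)
    (hs : ∀ e, s e ≠ v) : A.vt v • a ∈ U := by
  induction h with
  | base n u h => exact hv _ _ h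
  | add n a b _ _ ha hb => rw [smul_add]; exact U.add_mem ha hb
  | edge n e a h' ha => rw [← mul_smul, A.ve_ne _ _ (hs e).symm, zero_smul]; exact U.zero_mem

theorem exists_fil (hv : ∀ v, ∀ u ∈ U, A.vt v • u ∈ U) (hg : ∀ e, ∀ u ∈ U, A.gh e • u ∈ U)
    (a : L) (m : M) (hm : ∃ n, A.Fil U n m) : ∃ n, A.Fil U n (a • m) := by
  refine A.smul_closed (fun m => ∃ n, A.Fil U n m) ?_ ?_ ?_ ?_ ?_ a m hm
  · rintro a b ⟨n, hn⟩ ⟨k, hk⟩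
    exact ⟨max n k, .add _ _ _ (hn.mono (le_max_left _ _)) (hk.mono (le_max_right _ _))⟩
  · rintro k a ⟨n, hn⟩; exact ⟨n, hn.smul k⟩
  · rintro v a ⟨n, hn⟩; exact ⟨n, hn.vt hv v⟩
  · rintro e a ⟨n, hn⟩; exact ⟨_, hn.edge _ e _⟩
  · rintro e a ⟨n, hn⟩; exact ⟨_, hn.gh hv hg e⟩

theorem fil_top (hv : ∀ v, ∀ u ∈ U, A.vt v • u ∈ U) (hg : ∀ e, ∀ u ∈ U, A.gh e • u ∈ U)
    (m : M) (hm : m ∈ Submodule.span L (U : Set M)) : ∃ n, A.Fil U n m := by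
  induction hm using Submodule.span_induction with
  | mem x h => exact ⟨0, .base _ _ h⟩
  | zero => exact ⟨0, .zero_mem⟩
  | add x y _ _ hx hy =>
    obtain ⟨n, hn⟩ := hx
    obtain ⟨k, hk⟩ := hy
    exact ⟨max n k, .add _ _ _ (hn.mono (le_max_left _ _)) (hk.mono (le_max_right _ _))⟩
  | smul a x _ hx => exact exists_fil hv hg a x hx

/-- A nonzero submodule of a module generated by a ghost invariant subspace meets it. -/
theorem meets (hv : ∀ v, ∀ u ∈ U, A.vt v • u ∈ U) (hg : ∀ e, ∀ u ∈ U, A.gh e • u ∈ U)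
    (hspan : Submodule.span L (U : Set M) = ⊤) (N : Submodule L M)
    (hN : ∀ u ∈ U, u ∈ N → u = 0) : N = ⊥ := by
  classical
  have key : ∀ n m, A.Fil U n m → m ∈ N → m = 0 := by
    intro n
    induction n with
    | zero =>
      intro m hm hmN
      refine hN m ?_ hmN
      clear hmN
      generalize hz : (0 : ℕ) = z at hm
      induction hm with
      | base n u h => exact h
      | add n a b _ _ ha hb => exact U.add_mem (ha hz) (hb hz)
      | edge n e a _ _ => omega
    | succ n ih =>
      intro m hm hmN
      rw [A.sum_vt m]
      refine Finset.sum_eq_zero fun w _ => ?_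
      by_cases hs : ∃ e, s e = w
      · obtain ⟨e, he⟩ := hs
        rw [A.ck w (Finset.univ.filter fun e => s e = w) (by simp) ⟨e, by simp [he]⟩,
          Finset.sum_smul]
        refine Finset.sum_eq_zero fun f _ => ?_
        rw [mul_smul, ih _ (hm.gh hv hg f) (N.smul_mem _ hmN), smul_zero]
      · push Not at hs
        exact hN _ (hm.sink hv w hs) (N.smul_mem _ hmN)
  rw [eq_bot_iff]
  intro m hm
  obtain ⟨n, hn⟩ := fil_top hv hg m (by rw [hspan]; trivial)
  exact key n m hn hm

/-- A simple module with a finite dimensional ghost invariant subspace is finitely presented. -/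
theorem fp_of_fd [IsSimpleModule L M] [FiniteDimensional K U] (hU : U ≠ ⊥)
    (hv : ∀ v, ∀ u ∈ U, A.vt v • u ∈ U) (hg : ∀ e, ∀ u ∈ U, A.gh e • u ∈ U) :
    ∃ (m n : ℕ) (f : (Fin m → L) →ₗ[L] (Fin n → L)) (g : (Fin n → L) →ₗ[L] M),
      Function.Surjective g ∧ LinearMap.range f = LinearMap.ker g := by
  classical
  obtain ⟨d, ⟨b⟩⟩ : ∃ d, Nonempty (Module.Basis (Fin d) K U) :=
    ⟨_, ⟨Module.finBasis K U⟩⟩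
  let g : (Fin d → L) →ₗ[L] M := Fintype.linearCombination L (fun i => (b i : M))
  have hgs (i : Fin d) : g (Pi.single i 1) = b i := by
    simp [g, Fintype.linearCombination_apply_single]
  have hgK (c : Fin d → K) : g (∑ j, c j • Pi.single j 1) = ((∑ j, c j • b j : U) : M) := by
    rw [map_sum]
    simp only [LinearMap.map_smul_of_tower, hgs]
    simp
  have hsurj : Function.Surjective g := by
    rw [← LinearMap.range_eq_top]
    rcases eq_bot_or_eq_top (LinearMap.range g) with h | h
    · exfalso
      apply hU
      rw [eq_bot_iff]
      intro u hu
      have : (⟨u, hu⟩ : U) = 0 := by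
        rw [← b.sum_repr ⟨u, hu⟩]
        refine Finset.sum_eq_zero fun i _ => ?_
        have : (b i : M) = 0 := by
          have h1 : g (Pi.single i 1) ∈ LinearMap.range g := ⟨_, rfl⟩
          rw [h, hgs] at h1
          simpa using h1
        rw [show b i = 0 from Subtype.ext this, smul_zero]
      simpa using congrArg Subtype.val this
    · exact h
  let cv (v : V) (i : Fin d) : Fin d → K := fun j => b.repr ⟨A.vt v • (b i : M), hv v _ (b i).2⟩ j
  let cg (e : E) (i : Fin d) : Fin d → K := fun j => b.repr ⟨A.gh e • (b i : M), hg e _ (b i).2⟩ j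
  let Rv : V × Fin d → (Fin d → L) := fun x =>
    A.vt x.1 • Pi.single x.2 1 - ∑ j, cv x.1 x.2 j • (Pi.single j 1 : Fin d → L)
  let Rg : E × Fin d → (Fin d → L) := fun x =>
    A.gh x.1 • Pi.single x.2 1 - ∑ j, cg x.1 x.2 j • (Pi.single j 1 : Fin d → L)
  let N : Submodule L (Fin d → L) := Submodule.span L (Set.range Rv ∪ Set.range Rg)
  have hNg : N ≤ LinearMap.ker g := by
    refine Submodule.span_le.2 ?_
    rintro _ (⟨⟨v, i⟩, rfl⟩ | ⟨⟨v, i⟩, rfl⟩)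
    · simp only [Rv, SetLike.mem_coe, LinearMap.mem_ker, map_sub, hgK, map_smul, hgs, cv,
        b.sum_repr, sub_self]
    · simp only [Rg, SetLike.mem_coe, LinearMap.mem_ker, map_sub, hgK, map_smul, hgs, cg,
        b.sum_repr, sub_self]
  have hNfg : N.FG := Submodule.fg_span ((Set.finite_range _).union (Set.finite_range _))
  let q : Fin d → ((Fin d → L) ⧸ N) := fun i => N.mkQ (Pi.single i 1)
  let W : Submodule K ((Fin d → L) ⧸ N) := Submodule.span K (Set.range q)
  have hWv : ∀ v, ∀ u ∈ W, A.vt v • u ∈ W := by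
    intro v u hu
    induction hu using Submodule.span_induction with
    | mem x h =>
      obtain ⟨i, rfl⟩ := h
      have : A.vt v • q i = ∑ j, cv v i j • q j := by
        have h1 : N.mkQ (Rv (v, i)) = 0 := by
          rw [Submodule.mkQ_apply, Submodule.Quotient.mk_eq_zero]
          exact Submodule.subset_span (Or.inl ⟨_, rfl⟩)
        simp only [Rv, map_sub, map_smul, map_sum, LinearMap.map_smul_of_tower] at h1
        exact sub_eq_zero.1 h1
      rw [this]
      exact W.sum_mem fun j _ => W.smul_mem _ (Submodule.subset_span ⟨j, rfl⟩)
    | zero => rw [smul_zero]; exact W.zero_mem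
    | add x y _ _ hx hy => rw [smul_add]; exact W.add_mem hx hy
    | smul a x _ hx => rw [smul_algebra_smul_comm]; exact W.smul_mem _ hx
  have hWg : ∀ e, ∀ u ∈ W, A.gh e • u ∈ W := by
    intro v u hu
    induction hu using Submodule.span_induction with
    | mem x h =>
      obtain ⟨i, rfl⟩ := h
      have : A.gh v • q i = ∑ j, cg v i j • q j := by
        have h1 : N.mkQ (Rg (v, i)) = 0 := by
          rw [Submodule.mkQ_apply, Submodule.Quotient.mk_eq_zero]
          exact Submodule.subset_span (Or.inr ⟨_, rfl⟩)
        simp only [Rg, map_sub, map_smul, map_sum, LinearMap.map_smul_of_tower] at h1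
        exact sub_eq_zero.1 h1
      rw [this]
      exact W.sum_mem fun j _ => W.smul_mem _ (Submodule.subset_span ⟨j, rfl⟩)
    | zero => rw [smul_zero]; exact W.zero_mem
    | add x y _ _ hx hy => rw [smul_add]; exact W.add_mem hx hy
    | smul a x _ hx => rw [smul_algebra_smul_comm]; exact W.smul_mem _ hx
  have hWspan : Submodule.span L (W : Set ((Fin d → L) ⧸ N)) = ⊤ := by
    rw [eq_top_iff]
    rintro x -
    obtain ⟨y, rfl⟩ := N.mkQ_surjective x
    rw [pi_eq_sum_univ' y, map_sum]
    refine Submodule.sum_mem _ fun i _ => ?_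
    rw [map_smul]
    refine Submodule.smul_mem _ _ (Submodule.subset_span (Submodule.subset_span ⟨i, ?_⟩))
    simp only [q]
  have hker := meets (A := A) hWv hWg hWspan (LinearMap.ker (N.liftQ g hNg)) (by
    intro u hu hu0
    obtain ⟨c, rfl⟩ := (Submodule.mem_span_range_iff_exists_fun K).1 hu
    have h2 : ∑ i, c i • q i = N.mkQ (∑ j, c j • Pi.single j 1) := by
      simp only [map_sum, LinearMap.map_smul_of_tower, q]
    rw [h2, LinearMap.mem_ker, Submodule.mkQ_apply, Submodule.liftQ_apply, hgK] at hu0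
    have h3 : ∑ j, c j • b j = 0 := Subtype.ext hu0
    have h4 := Fintype.linearIndependent_iff.1 b.linearIndependent c h3
    simp [h4])
  have hN : N = LinearMap.ker g := by
    refine le_antisymm hNg ?_
    intro y hy
    have h5 : N.mkQ y ∈ LinearMap.ker (N.liftQ g hNg) := by
      rw [LinearMap.mem_ker, Submodule.mkQ_apply, Submodule.liftQ_apply]
      exact hy
    rw [hker, Submodule.mem_bot, Submodule.mkQ_apply, Submodule.Quotient.mk_eq_zero] at h5
    exact h5
  obtain ⟨m, f, hf⟩ := (Submodule.fg_iff_exists_fin_linearMap _ _).1 hNfg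
  exact ⟨m, d, f, g, hsurj, hf.trans hN⟩

end LPAFam

namespace LPAFam

variable {K : Type} [Field K] {V E : Type} [Fintype V] [Fintype E] {s r : E → V}
    {L : Type} [Ring L] [Algebra K L] (A : LPAFam K s r L)
    {M : Type} [AddCommGroup M] [Module K M] [Module L M] [IsScalarTower K L M]

/-- Reachability in the graph. -/
def Reach (s r : E → V) (u w : V) : Prop :=
  Relation.ReflTransGen (fun a b => ∃ e, s e = a ∧ r e = b) u w

/-- At most one edge at each vertex lies on a closed path. -/
def Uniq (s r : E → V) : Prop :=
  ∀ e e', s e = s e' → Reach s r (r e) (s e) → Reach s r (r e') (s e') → e = e'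

theorem fd_of_ann (t : L) (x : M) (h : Polynomial K) (h0 : h ≠ 0)
    (hx : Polynomial.aeval t h • x = 0) :
    FiniteDimensional K (Submodule.span K (Set.range fun n : ℕ => t ^ n • x)) := by
  have hle : Submodule.span K (Set.range fun n : ℕ => t ^ n • x) ≤
      Submodule.span K ((fun n : ℕ => t ^ n • x) '' (Set.Iio (h.natDegree + 1))) := by
    rw [Submodule.span_le]
    rintro _ ⟨n, rfl⟩
    have h1 : t ^ n • x = Polynomial.aeval t ((Polynomial.X ^ n : Polynomial K) % h) • x := by
      conv_lhs => rw [← Polynomial.aeval_X_pow (R := K) t,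
        ← EuclideanDomain.mod_add_div (Polynomial.X ^ n : Polynomial K) h]
      rw [map_add, add_smul, mul_comm, map_mul, mul_smul, hx, smul_zero, add_zero]
    simp only [SetLike.mem_coe]
    rw [h1, Polynomial.aeval_eq_sum_range, Finset.sum_smul]
    refine Submodule.sum_mem _ fun i hi => ?_
    rw [smul_assoc]
    refine Submodule.smul_mem _ _ (Submodule.subset_span ⟨i, ?_, rfl⟩)
    have h2 : ((Polynomial.X ^ n : Polynomial K) % h).natDegree ≤ h.natDegree :=
      Polynomial.natDegree_le_natDegree (le_of_lt (EuclideanDomain.mod_lt _ h0))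
    have := Finset.mem_range.1 hi
    simp only [Set.mem_Iio]
    omega
  have : FiniteDimensional K
      (Submodule.span K ((fun n : ℕ => t ^ n • x) '' (Set.Iio (h.natDegree + 1)))) :=
    FiniteDimensional.span_of_finite K ((Set.finite_Iio _).image _)
  exact Submodule.finiteDimensional_of_le hle

theorem case2 [IsSimpleModule L M] (C : V → Prop) (v0 : V) (hv0 : C v0)
    (hCX : ∀ w, C w → ∃ m : M, A.vt w • m ≠ 0) (σ : V → E)
    (hσ : ∀ w, C w → s (σ w) = w ∧ C (r (σ w)) ∧
      ∀ e', s e' = w → (∃ m : M, A.vt (r e') • m ≠ 0) → e' = σ w) :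
    ∃ U : Submodule K M, FiniteDimensional K U ∧ U ≠ ⊥ ∧
      (∀ v, ∀ u ∈ U, A.vt v • u ∈ U) ∧ (∀ e, ∀ u ∈ U, A.gh e • u ∈ U) := by
  classical
  let nxt : V → V := fun w => r (σ w)
  have hit : ∀ w, C w → ∀ n, C (nxt^[n] w) := by
    intro w hw n
    induction n with
    | zero => exact hw
    | succ n ih => rw [Function.iterate_succ_apply']; exact (hσ _ ih).2.1
  obtain ⟨v, hv, N, hN, hper⟩ : ∃ v, C v ∧ ∃ N, 0 < N ∧ nxt^[N] v = v := by
    obtain ⟨i, j, hij, heq⟩ := Finite.exists_ne_map_eq_of_infinite (fun n : ℕ => nxt^[n] v0)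
    wlog hlt : i < j generalizing i j
    · exact this j i hij.symm heq.symm (by omega)
    refine ⟨nxt^[i] v0, hit _ hv0 i, j - i, by omega, ?_⟩
    rw [← Function.iterate_add_apply, Nat.sub_add_cancel hlt.le]
    exact heq.symm
  let T : L := ∑ w ∈ Finset.univ.filter C, A.gh (σ w)
  have hT : ∀ w, C w → ∀ y : M, A.vt w • y = y → T • y = A.gh (σ w) • y := by
    intro w hw y hy
    simp only [T, Finset.sum_smul]
    rw [Finset.sum_eq_single w]
    · intro w' hw' hne
      rw [← hy, ← mul_smul, A.gv_ne, zero_smul]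
      rw [(hσ w' (by simpa using hw')).1]
      exact hne.symm
    · intro h; simp [hw] at h
  have hTn : ∀ z : M, A.vt v • z = z → ∀ n, A.vt (nxt^[n] v) • (T ^ n • z) = T ^ n • z := by
    intro z hz n
    induction n with
    | zero => simpa using hz
    | succ n ih =>
      rw [Function.iterate_succ_apply', pow_succ', mul_smul, hT _ (hit _ hv n) _ ih, ← mul_smul,
        A.gr]
  have hvne : ∀ (w w' : V) (y : M), A.vt w • y = y → w' ≠ w → A.vt w' • y = 0 := by
    intro w w' y hy hne
    rw [← hy, ← mul_smul, A.vv _ _ hne, zero_smul]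
  let Z : M → Submodule K M := fun z => Submodule.span K (Set.range fun n : ℕ => T ^ n • z)
  have hZv : ∀ z, A.vt v • z = z → ∀ w, ∀ u ∈ Z z, A.vt w • u ∈ Z z := by
    intro z hz w u hu
    induction hu using Submodule.span_induction with
    | mem x h =>
      obtain ⟨n, rfl⟩ := h
      by_cases hw : w = nxt^[n] v
      · subst hw; simp only [hTn z hz n]; exact Submodule.subset_span ⟨n, rfl⟩
      · simp only [hvne _ _ _ (hTn z hz n) hw]; exact Submodule.zero_mem _
    | zero => rw [smul_zero]; exact Submodule.zero_mem _
    | add x y _ _ hx hy => rw [smul_add]; exact Submodule.add_mem _ hx hy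
    | smul a x _ hx => rw [smul_algebra_smul_comm]; exact Submodule.smul_mem _ _ hx
  have hZg : ∀ z, A.vt v • z = z → ∀ e, ∀ u ∈ Z z, A.gh e • u ∈ Z z := by
    intro z hz e u hu
    induction hu using Submodule.span_induction with
    | mem x h =>
      obtain ⟨n, rfl⟩ := h
      simp only
      by_cases hw : s e = nxt^[n] v
      · by_cases hX : ∃ m : M, A.vt (r e) • m ≠ 0
        · have := (hσ _ (hit _ hv n)).2.2 e hw hX
          rw [this, ← hT _ (hit _ hv n) _ (hTn z hz n), ← mul_smul, ← pow_succ']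
          exact Submodule.subset_span ⟨n + 1, rfl⟩
        · push Not at hX
          rw [← A.gr e, mul_smul, hX]; exact Submodule.zero_mem _
      · rw [← A.gs e, mul_smul, hvne _ _ _ (hTn z hz n) hw, smul_zero]
        exact Submodule.zero_mem _
    | zero => rw [smul_zero]; exact Submodule.zero_mem _
    | add x y _ _ hx hy => rw [smul_add]; exact Submodule.add_mem _ hx hy
    | smul a x _ hx => rw [smul_algebra_smul_comm]; exact Submodule.smul_mem _ _ hx
  have hZT : ∀ z, ∀ k, ∀ u ∈ Z z, T ^ k • u ∈ Z z := by
    intro z k u hu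
    induction hu using Submodule.span_induction with
    | mem x h =>
      obtain ⟨n, rfl⟩ := h
      simp only
      rw [← mul_smul, ← pow_add]; exact Submodule.subset_span ⟨k + n, rfl⟩
    | zero => rw [smul_zero]; exact Submodule.zero_mem _
    | add x y _ _ hx hy => rw [smul_add]; exact Submodule.add_mem _ hx hy
    | smul a x _ hx => rw [smul_algebra_smul_comm]; exact Submodule.smul_mem _ _ hx
  have hZp : ∀ z, ∀ u ∈ Z z, ∃ p : Polynomial K, u = Polynomial.aeval T p • z := by
    intro z u hu
    induction hu using Submodule.span_induction with
    | mem x h =>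
      obtain ⟨n, rfl⟩ := h
      exact ⟨Polynomial.X ^ n, by simp⟩
    | zero => exact ⟨0, by simp⟩
    | add x y _ _ hx hy =>
      obtain ⟨p, rfl⟩ := hx
      obtain ⟨q, rfl⟩ := hy
      exact ⟨p + q, by rw [map_add, add_smul]⟩
    | smul a x _ hx =>
      obtain ⟨p, rfl⟩ := hx
      exact ⟨a • p, by rw [map_smul, smul_assoc]⟩
  obtain ⟨m, hm⟩ := hCX v hv
  obtain ⟨x, hx0, hx⟩ : ∃ x : M, x ≠ 0 ∧ A.vt v • x = x :=
    ⟨A.vt v • m, hm, by rw [← mul_smul, A.vi]⟩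
  refine ⟨Z x, ?_, ?_, hZv x hx, hZg x hx⟩
  swap
  · intro h
    have : T ^ 0 • x ∈ Z x := Submodule.subset_span ⟨0, rfl⟩
    rw [h] at this
    simp at this
    exact hx0 this
  have hex : ∃ h : Polynomial K, h ≠ 0 ∧ Polynomial.aeval T h • x = 0 := by
    let g0 : Polynomial K := 1 - Polynomial.X ^ N
    by_cases hz0 : Polynomial.aeval T g0 • x = 0
    · refine ⟨g0, ?_, hz0⟩
      intro h
      have := congrArg (Polynomial.eval 0) h
      simp [g0, hN.ne'] at this
    · set z := Polynomial.aeval T g0 • x with hzdef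
      have hzv : A.vt v • z = z := by
        have h1 : z = x - T ^ N • x := by simp [hzdef, g0, sub_smul]
        have h2 := hTn x hx N
        rw [hper] at h2
        rw [h1, smul_sub, hx, h2]
      have hQ : ∀ n y, A.Fil (Z z) n y → ∀ w, C w → ∃ k, T ^ k • A.vt w • y ∈ Z z := by
        intro n y hy
        induction hy with
        | base n u h => exact fun w _ => ⟨0, by simpa using hZv z hzv w u h⟩
        | add n a b _ _ ha hb =>
          intro w hw
          obtain ⟨k, hk⟩ := ha w hw
          obtain ⟨l, hl⟩ := hb w hw
          refine ⟨k + l, ?_⟩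
          rw [smul_add, smul_add]
          refine Submodule.add_mem _ ?_ ?_
          · rw [add_comm, pow_add, mul_smul]; exact hZT _ _ _ hk
          · rw [pow_add, mul_smul]; exact hZT _ _ _ hl
        | edge n e a _ ha =>
          intro w hw
          by_cases hwe : w = s e
          · by_cases hX : ∃ m : M, A.vt (r e) • m ≠ 0
            · have h1 := (hσ _ hw).2.2 e hwe.symm hX
              have h2 : C (r e) := by rw [h1]; exact (hσ _ hw).2.1
              obtain ⟨k, hk⟩ := ha _ h2
              refine ⟨k + 1, ?_⟩
              rw [pow_succ, mul_smul, hT w hw _ (by rw [← mul_smul, A.vi]), hwe,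
                ← mul_smul (A.vt (s e)), A.es, ← hwe, ← h1, ← mul_smul (A.gh e), A.geq]
              exact hk
            · push Not at hX
              refine ⟨0, ?_⟩
              rw [← A.er e, mul_smul, hX]
              simp
          · exact ⟨0, by rw [← mul_smul (A.vt w), A.ve_ne _ _ hwe]; simp⟩
      obtain ⟨a, ha⟩ : ∃ a : L, a • z = x := by
        have := IsSimpleModule.toSpanSingleton_surjective L hz0
        exact this x
      obtain ⟨n, hn⟩ := exists_fil (hZv z hzv) (hZg z hzv) a z
        ⟨0, .base _ _ (Submodule.subset_span ⟨0, by simp⟩)⟩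
      obtain ⟨k, hk⟩ := hQ n _ hn v hv
      rw [ha, hx] at hk
      obtain ⟨p, hp⟩ := hZp _ _ hk
      refine ⟨Polynomial.X ^ k - p * g0, ?_, ?_⟩
      · intro h
        have := congrArg (Polynomial.eval 1) h
        simp [g0] at this
      · rw [map_sub, sub_smul, map_mul, mul_smul, ← hzdef, ← hp]; simp
  obtain ⟨h, h0, hh⟩ := hex
  exact fd_of_ann T x h h0 hh

theorem backward (hU : Uniq s r) [IsSimpleModule L M] :
    ∃ U : Submodule K M, FiniteDimensional K U ∧ U ≠ ⊥ ∧
      (∀ v, ∀ u ∈ U, A.vt v • u ∈ U) ∧ (∀ e, ∀ u ∈ U, A.gh e • u ∈ U) := by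
  classical
  let X : V → Prop := fun v => ∃ m : M, A.vt v • m ≠ 0
  have hXne : ∃ v, X v := by
    by_contra hcon
    simp only [X] at hcon
    push Not at hcon
    have := IsSimpleModule.nontrivial L M
    obtain ⟨m, hm⟩ := exists_ne (0 : M)
    apply hm
    rw [A.sum_vt m]
    exact Finset.sum_eq_zero fun w _ => hcon w m
  have hXout : ∀ v, X v → (∃ e, s e = v) → ∃ e, s e = v ∧ X (r e) := by
    rintro v ⟨m, hm⟩ ⟨e, he⟩
    rw [A.ck v (Finset.univ.filter fun e => s e = v) (by simp) ⟨e, by simp [he]⟩,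
      Finset.sum_smul] at hm
    obtain ⟨f, hf, hfm⟩ := Finset.exists_ne_zero_of_sum_ne_zero hm
    refine ⟨f, by simpa using hf, A.gh f • m, ?_⟩
    rw [← mul_smul, A.gr]
    intro h
    rw [mul_smul, h, smul_zero] at hfm
    exact hfm rfl
  obtain ⟨v, hv, hmin⟩ : ∃ v, X v ∧ ∀ w, X w → Reach s r v w → Reach s r w v := by
    obtain ⟨v, hv, hmin⟩ := Finset.exists_min_image (Finset.univ.filter X)
      (fun v => (Finset.univ.filter fun w => X w ∧ Reach s r v w).card)
      (by obtain ⟨v, hv⟩ := hXne; exact ⟨v, by simpa using hv⟩)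
    simp only [Finset.mem_filter, Finset.mem_univ, true_and] at hv hmin
    refine ⟨v, hv, fun w hw hvw => ?_⟩
    have hsub : (Finset.univ.filter fun u => X u ∧ Reach s r w u) ⊆
        (Finset.univ.filter fun u => X u ∧ Reach s r v u) := by
      intro u hu
      simp only [Finset.mem_filter, Finset.mem_univ, true_and] at hu ⊢
      exact ⟨hu.1, hvw.trans hu.2⟩
    have heq := Finset.eq_of_subset_of_card_le hsub (hmin w hw)
    have : v ∈ (Finset.univ.filter fun u => X u ∧ Reach s r v u) := by
      simp only [Finset.mem_filter, Finset.mem_univ, true_and]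
      exact ⟨hv, .refl⟩
    rw [← heq] at this
    simp only [Finset.mem_filter, Finset.mem_univ, true_and] at this
    exact this.2
  by_cases hs : ∃ e, s e = v
  · have hC : ∀ w, (X w ∧ Reach s r v w) → ∃ e, s e = w ∧ (X (r e) ∧ Reach s r v (r e)) ∧
        ∀ e', s e' = w → X (r e') → e' = e := by
      rintro w ⟨hw, hvw⟩
      have hwv := hmin w hw hvw
      have hout : ∃ e, s e = w := by
        rcases Relation.ReflTransGen.cases_head hwv with h | ⟨c, ⟨e, he, _⟩, _⟩
        · rw [← h] at hs; exact hs
        · exact ⟨e, he⟩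
      obtain ⟨e, he, hXe⟩ := hXout w hw hout
      have step : ∀ e', s e' = w → Reach s r v (r e') :=
        fun e' he' => hvw.tail ⟨e', he', rfl⟩
      refine ⟨e, he, ⟨hXe, step e he⟩, fun e' he' hXe' => ?_⟩
      refine hU e' e (he'.trans he.symm) ?_ ?_
      · rw [he']; exact (hmin _ hXe' (step e' he')).trans hvw
      · rw [he]; exact (hmin _ hXe (step e he)).trans hvw
    obtain ⟨e0, -⟩ := id hs
    let σ : V → E := fun w => if h : X w ∧ Reach s r v w then (hC w h).choose else e0
    refine A.case2 (fun w => X w ∧ Reach s r v w) v ⟨hv, .refl⟩ (fun w hw => hw.1) σ ?_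
    intro w hw
    have := (hC w hw).choose_spec
    simp only [σ, dif_pos hw]
    exact this
  · push Not at hs
    obtain ⟨m, hm⟩ := hv
    refine ⟨Submodule.span K {A.vt v • m}, inferInstance, ?_, ?_, ?_⟩
    · rw [Ne, Submodule.span_singleton_eq_bot]; exact hm
    · intro w u hu
      obtain ⟨k, rfl⟩ := Submodule.mem_span_singleton.1 hu
      rw [smul_algebra_smul_comm, ← mul_smul]
      by_cases h : w = v
      · rw [h, A.vi]; exact hu
      · rw [A.vv _ _ h]; simp
    · intro e u hu
      obtain ⟨k, rfl⟩ := Submodule.mem_span_singleton.1 hu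
      rw [smul_algebra_smul_comm, ← mul_smul, A.gv_ne _ _ (hs e).symm]; simp

end LPAFam

namespace LPAGraph

open LPAFam

variable {V E : Type} {s r : E → V}

/-- `l` is a path from `u` to `w`. -/
def Pth (s r : E → V) : V → List E → V → Prop
  | u, [], w => u = w
  | u, e :: l, w => s e = u ∧ Pth s r (r e) l w

theorem Pth.suffix {u w : V} {l1 l2 : List E} {f : E} (h : Pth s r u (l1 ++ f :: l2) w) :
    Pth s r (s f) (f :: l2) w := by
  induction l1 generalizing u with
  | nil => exact ⟨rfl, h.2⟩
  | cons a l ih => exact ih h.2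

theorem exists_simple {u w : V} (h : Reach s r u w) :
    ∃ l, Pth s r u l w ∧ (l.map s).Nodup ∧ w ∉ l.map s := by
  classical
  induction h using Relation.ReflTransGen.head_induction_on with
  | refl => exact ⟨[], rfl, by simp, by simp⟩
  | head h1 _ ih =>
    obtain ⟨e, he, he'⟩ := h1
    obtain ⟨l, hl, hn, hw⟩ := ih
    rename_i a c _
    by_cases haw : a = w
    · exact ⟨[], haw, by simp, by simp⟩
    by_cases hal : a ∈ l.map s
    · obtain ⟨f, hf, rfl⟩ := List.mem_map.1 hal
      obtain ⟨l1, l2, rfl⟩ := List.append_of_mem hf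
      refine ⟨f :: l2, hl.suffix, ?_, ?_⟩
      · rw [List.map_append] at hn
        exact (List.nodup_append.1 hn).2.1
      · intro h
        apply hw
        rw [List.map_append]
        exact List.mem_append_right _ h
    · refine ⟨e :: l, ⟨he, he' ▸ hl⟩, ?_, ?_⟩
      · rw [List.map_cons, List.nodup_cons, he]; exact ⟨hal, hn⟩
      · rw [List.map_cons, List.mem_cons, he]
        rintro (h | h)
        · exact haw h.symm
        · exact hw h

theorem Pth.chain {u w : V} {l : List E} (h : Pth s r u l w) : IsPathChain s r l := by
  induction l generalizing u with
  | nil => intro i hi; simp at hi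
  | cons e l ih =>
    intro i hi
    cases i with
    | zero =>
      cases l with
      | nil => simp at hi
      | cons f l => exact h.2.1.symm
    | succ i => exact ih h.2 i (by simpa using hi)

theorem Pth.last {u w : V} {l : List E} (h : Pth s r u l w) (hl : l ≠ []) :
    r (l.getLast hl) = w := by
  induction l generalizing u with
  | nil => exact absurd rfl hl
  | cons e l ih =>
    cases l with
    | nil => exact h.2
    | cons f l => rw [List.getLast_cons (by simp)]; exact ih h.2 _

theorem exists_cycle {e : E} (h : Reach s r (r e) (s e)) : ∃ l, IsCycle s r (e :: l) := by
  obtain ⟨l, hl, hn, hw⟩ := exists_simple h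
  have hp : Pth s r (s e) (e :: l) (s e) := ⟨rfl, hl⟩
  exact ⟨l, by simp, hp.chain, hp.last _, by rw [List.map_cons, List.nodup_cons]; exact ⟨hw, hn⟩⟩

theorem uniq_of_disjoint
    (h : ∀ es₁ es₂ : List E, IsCycle s r es₁ → IsCycle s r es₂ →
        (∃ (i j : ℕ) (hi : i < es₁.length) (hj : j < es₂.length),
          s (es₁[i]'hi) = s (es₂[j]'hj)) → es₁.IsRotated es₂) : Uniq s r := by
  intro e e' hs he he'
  obtain ⟨l, hl⟩ := exists_cycle he
  obtain ⟨l', hl'⟩ := exists_cycle he'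
  have hrot := h _ _ hl hl' ⟨0, 0, by simp, by simp, by simpa using hs⟩
  have hmem : e' ∈ e :: l := hrot.mem_iff.2 (by simp)
  obtain ⟨_, _, _, hn⟩ := hl
  exact List.inj_on_of_nodup_map hn (by simp) hmem hs

theorem cyc_next {es : List E} (h : IsCycle s r es) (k : ℕ) (h1 : k % es.length < es.length)
    (h2 : (k + 1) % es.length < es.length) :
    r (es[k % es.length]'h1) = s (es[(k + 1) % es.length]'h2) := by
  obtain ⟨hne, hc, hl, -⟩ := h
  have hpos : 0 < es.length := List.length_pos_iff.2 hne
  by_cases hk : k % es.length + 1 < es.length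
  · have h3 : (k + 1) % es.length = k % es.length + 1 := by
      rw [Nat.add_mod]
      rw [Nat.mod_eq_of_lt (a := 1) (by omega), Nat.mod_eq_of_lt hk]
    simp only [h3]
    exact hc _ hk
  · have h4 : k % es.length = es.length - 1 := by omega
    have h3 : (k + 1) % es.length = 0 := by
      have : es.length ∣ k + 1 := by
        refine ⟨k / es.length + 1, ?_⟩
        have := Nat.div_add_mod k es.length
        rw [mul_add]
        omega
      exact Nat.mod_eq_zero_of_dvd this
    simp only [h3, h4]
    rw [List.getLast_eq_getElem, List.head_eq_getElem] at hl
    exact hl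

theorem cyc_reach {es : List E} (h : IsCycle s r es) (hm : ∀ k, k % es.length < es.length)
    (k m : ℕ) :
    Reach s r (s (es[k % es.length]'(hm k))) (s (es[(k + m) % es.length]'(hm _))) := by
  induction m with
  | zero => exact .refl
  | succ m ih => exact ih.tail ⟨_, rfl, cyc_next h (k + m) (hm _) (hm _)⟩

theorem cyc_rec {es : List E} (h : IsCycle s r es) (hm : ∀ k, k % es.length < es.length)
    (k : ℕ) : Reach s r (r (es[k % es.length]'(hm k))) (s (es[k % es.length]'(hm k))) := by
  rw [cyc_next h k (hm _) (hm _)]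
  have h1 := cyc_reach h hm (k + 1) (es.length - 1)
  have h2 : (k + 1 + (es.length - 1)) % es.length = k % es.length := by
    have := hm 0
    rw [show k + 1 + (es.length - 1) = k + es.length by omega, Nat.add_mod_right]
  simp only [h2] at h1
  exact h1

theorem disjoint_of_uniq (hU : Uniq s r) (es₁ es₂ : List E) (h₁ : IsCycle s r es₁)
    (h₂ : IsCycle s r es₂)
    (hij : ∃ (i j : ℕ) (hi : i < es₁.length) (hj : j < es₂.length),
          s (es₁[i]'hi) = s (es₂[j]'hj)) : es₁.IsRotated es₂ := by
  obtain ⟨i, j, hi, hj, hij⟩ := hij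
  have hm₁ : ∀ k, k % es₁.length < es₁.length := fun k => Nat.mod_lt _ (by omega)
  have hm₂ : ∀ k, k % es₂.length < es₂.length := fun k => Nat.mod_lt _ (by omega)
  have hs : ∀ k, s (es₁[(i + k) % es₁.length]'(hm₁ _)) = s (es₂[(j + k) % es₂.length]'(hm₂ _)) ∧
      es₁[(i + k) % es₁.length]'(hm₁ _) = es₂[(j + k) % es₂.length]'(hm₂ _) := by
    intro k
    have aux : ∀ k, s (es₁[(i + k) % es₁.length]'(hm₁ _)) =
        s (es₂[(j + k) % es₂.length]'(hm₂ _)) →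
        es₁[(i + k) % es₁.length]'(hm₁ _) = es₂[(j + k) % es₂.length]'(hm₂ _) :=
      fun k hk => hU _ _ hk (cyc_rec h₁ hm₁ _) (cyc_rec h₂ hm₂ _)
    induction k with
    | zero =>
      have : s (es₁[(i + 0) % es₁.length]'(hm₁ _)) = s (es₂[(j + 0) % es₂.length]'(hm₂ _)) := by
        simp only [add_zero, Nat.mod_eq_of_lt hi, Nat.mod_eq_of_lt hj]
        exact hij
      exact ⟨this, aux _ this⟩
    | succ k ih =>
      have h3 := cyc_next h₁ (i + k) (hm₁ _) (hm₁ _)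
      have h4 := cyc_next h₂ (j + k) (hm₂ _) (hm₂ _)
      rw [ih.2, h4] at h3
      exact ⟨h3.symm, aux _ h3.symm⟩
  have inj : ∀ es : List E, (es.map s).Nodup → ∀ a b (ha : a < es.length) (hb : b < es.length),
      s (es[a]'ha) = s (es[b]'hb) → a = b := by
    intro es hn a b ha hb hab
    have := List.nodup_iff_injective_getElem.1 hn
    have h5 := @this ⟨a, by simpa using ha⟩ ⟨b, by simpa using hb⟩ (by simpa using hab)
    simpa using h5
  have d1 : es₂.length ∣ es₁.length := by
    obtain ⟨_, _, _, hn⟩ := h₂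
    have h6 := (hs es₁.length).1
    simp only [Nat.add_mod_right, Nat.mod_eq_of_lt hi] at h6
    rw [hij] at h6
    have := inj _ hn _ _ _ _ h6
    have h7 : (j + 0) ≡ j + es₁.length [MOD es₂.length] := by
      unfold Nat.ModEq; rw [add_zero, Nat.mod_eq_of_lt hj]; exact this
    have h8 := Nat.ModEq.add_left_cancel' j h7
    exact (Nat.modEq_zero_iff_dvd.1 h8.symm)
  have d2 : es₁.length ∣ es₂.length := by
    obtain ⟨_, _, _, hn⟩ := h₁
    have h6 := (hs es₂.length).1
    simp only [Nat.add_mod_right, Nat.mod_eq_of_lt hj] at h6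
    rw [← hij] at h6
    have := inj _ hn _ _ _ _ h6
    have h7 : (i + es₂.length) ≡ i + 0 [MOD es₁.length] := by
      unfold Nat.ModEq; rw [add_zero, Nat.mod_eq_of_lt hi]; exact this
    have h8 := Nat.ModEq.add_left_cancel' i h7
    exact (Nat.modEq_zero_iff_dvd.1 h8)
  have hlen : es₁.length = es₂.length := Nat.dvd_antisymm d2 d1
  have hrot : es₁.rotate i = es₂.rotate j := by
    refine List.ext_getElem (by simpa using hlen) fun k _ _ => ?_
    rw [List.getElem_rotate, List.getElem_rotate]
    have := (hs k).2
    simpa only [add_comm] using this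
  exact (List.IsRotated.forall es₁ i).symm.trans (hrot ▸ List.IsRotated.forall es₂ j)

/-! ### An irrational infinite path -/

/-- Infinite path following `g` outside of `w` and reading bits at `w`. -/
noncomputable def run (r : E → V) (w : V) (e f : E) (g : V → E) [DecidableEq V] :
    ℕ → V → (ℕ → Bool) → E
  | 0, u, b => if u = w then (if b 0 then e else f) else g u
  | k + 1, u, b => if u = w then run r w e f g k (r (if b 0 then e else f)) (fun n => b (n + 1))
      else run r w e f g k (r (g u)) b

/-- Reachability in `n` steps. -/
def RN (s r : E → V) (w : V) : ℕ → V → Prop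
  | 0, u => u = w
  | n + 1, u => ∃ e, s e = u ∧ RN s r w n (r e)

theorem exists_RN {u w : V} (h : Reach s r u w) : ∃ n, RN s r w n u := by
  induction h using Relation.ReflTransGen.head_induction_on with
  | refl => exact ⟨0, rfl⟩
  | head h1 _ ih =>
    obtain ⟨e, he, rfl⟩ := h1
    obtain ⟨n, hn⟩ := ih
    exact ⟨n + 1, e, he, hn⟩

theorem exists_guide (w : V) (e0 : E) : ∃ (g : V → E) (d : V → ℕ), ∀ u, Reach s r u w → u ≠ w →
    s (g u) = u ∧ Reach s r (r (g u)) w ∧ d (r (g u)) < d u := by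
  classical
  let d : V → ℕ := fun u => if h : ∃ n, RN s r w n u then Nat.find h else 0
  have hRN : ∀ n u, RN s r w n u → Reach s r u w := by
    intro n
    induction n with
    | zero => rintro u rfl; exact .refl
    | succ n ih => rintro u ⟨e, rfl, h⟩; exact (ih _ h).head ⟨e, rfl, rfl⟩
  have key : ∀ u, Reach s r u w → u ≠ w → ∃ e, s e = u ∧ Reach s r (r e) w ∧ d (r e) < d u := by
    intro u hu huw
    have h := exists_RN hu
    have h1 := Nat.find_spec h
    have hd : d u = Nat.find h := by simp only [d, dif_pos h]
    rw [← hd] at h1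
    cases hdu : d u with
    | zero => rw [hdu] at h1; exact absurd h1 huw
    | succ m =>
      rw [hdu] at h1
      obtain ⟨e, he, hm⟩ := h1
      refine ⟨e, he, hRN _ _ hm, ?_⟩
      have h2 : ∃ n, RN s r w n (r e) := ⟨m, hm⟩
      have h3 : d (r e) = Nat.find h2 := by simp only [d, dif_pos h2]
      have h4 : Nat.find h2 ≤ m := Nat.find_min' h2 hm
      omega
  refine ⟨fun u => if h : Reach s r u w ∧ u ≠ w then (key u h.1 h.2).choose else e0, d, ?_⟩
  intro u hu huw
  have := (key u hu huw).choose_spec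
  simpa only [dif_pos (show Reach s r u w ∧ u ≠ w from ⟨hu, huw⟩)] using this

/-- From failure of uniqueness we get infinite paths. -/
theorem exists_path [Finite E] (w : V) (e f : E) (hef : e ≠ f) (he : s e = w) (hf : s f = w)
    (hre : Reach s r (r e) w) (hrf : Reach s r (r f) w) :
    (∀ u, Reach s r u w → ∃ p : ℕ → E, s (p 0) = u ∧ ∀ i, r (p i) = s (p (i + 1))) ∧
    ∃ p : ℕ → E, (∀ i, r (p i) = s (p (i + 1))) ∧
      (∀ m n, m < n → ∃ i, p (m + i) ≠ p (n + i)) ∧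
      ∀ n, ∃ m, n ≤ m ∧ s (p m) = w ∧ (p m = e ∨ p m = f) := by
  classical
  obtain ⟨g, d, hg⟩ := exists_guide (s := s) (r := r) w e
  let R : V → (ℕ → Bool) → ℕ → E := fun u b k => run r w e f g k u b
  have hw0 : ∀ b, R w b 0 = if b 0 then e else f := by intro b; simp [R, run]
  have hwk : ∀ b k, R w b (k + 1) = R (r (if b 0 then e else f)) (fun n => b (n + 1)) k := by
    intro b k; simp [R, run]
  have hu0 : ∀ u b, u ≠ w → R u b 0 = g u := by intro u b h; simp [R, run, h]
  have huk : ∀ u b k, u ≠ w → R u b (k + 1) = R (r (g u)) b k := by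
    intro u b k h; simp [R, run, h]
  have hs0 : ∀ u b, Reach s r u w → s (R u b 0) = u := by
    intro u b hu
    by_cases h : u = w
    · subst h; rw [hw0]; split_ifs <;> assumption
    · rw [hu0 _ _ h]; exact (hg u hu h).1
  have hrif : ∀ c : Bool, Reach s r (r (if c then e else f)) w := by
    intro c; split_ifs <;> assumption
  have tail : ∀ u b, Reach s r u w → ∃ u' b', Reach s r u' w ∧ u' = r (R u b 0) ∧
      ∀ k, R u b (k + 1) = R u' b' k := by
    intro u b hu
    by_cases h : u = w
    · subst h; exact ⟨_, _, hrif (b 0), by rw [hw0], hwk b⟩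
    · exact ⟨_, _, (hg u hu h).2.1, by rw [hu0 _ _ h], fun k => huk u b k h⟩
  have path : ∀ i u b, Reach s r u w → r (R u b i) = s (R u b (i + 1)) := by
    intro i
    induction i with
    | zero =>
      intro u b hu
      obtain ⟨u', b', hu', rfl, hk⟩ := tail u b hu
      rw [hk, hs0 _ _ hu']
    | succ i ih =>
      intro u b hu
      obtain ⟨u', b', hu', -, hk⟩ := tail u b hu
      rw [hk, hk]; exact ih _ _ hu'
  have visit0 : ∀ n u b, d u = n → Reach s r u w → ∃ m, s (R u b m) = w ∧
      (R u b m = e ∨ R u b m = f) := by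
    intro n
    induction n using Nat.strong_induction_on with
    | _ n ih =>
      intro u b hn hu
      by_cases h : u = w
      · subst h
        refine ⟨0, hs0 _ _ hu, ?_⟩
        rw [hw0]; split_ifs <;> simp
      · obtain ⟨_, h2, h3⟩ := hg u hu h
        obtain ⟨m, hm⟩ := ih _ (hn ▸ h3) _ b rfl h2
        exact ⟨m + 1, by rw [huk _ _ _ h]; exact hm⟩
  have visit : ∀ n u b, Reach s r u w → ∃ m, n ≤ m ∧ s (R u b m) = w ∧
      (R u b m = e ∨ R u b m = f) := by
    intro n
    induction n with
    | zero =>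
      intro u b hu
      obtain ⟨m, hm⟩ := visit0 _ u b rfl hu
      exact ⟨m, by omega, hm⟩
    | succ n ih =>
      intro u b hu
      obtain ⟨u', b', hu', -, hk⟩ := tail u b hu
      obtain ⟨m, hm, hm'⟩ := ih u' b' hu'
      exact ⟨m + 1, by omega, by rw [hk]; exact hm'⟩
  have dec : ∀ n D u b b', d u = D → Reach s r u w → R u b = R u b' → b n = b' n := by
    intro n
    induction n with
    | zero =>
      intro D
      induction D using Nat.strong_induction_on with
      | _ D ih =>
        intro u b b' hD hu hR
        by_cases h : u = w
        · subst h
          have := congrFun hR 0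
          rw [hw0, hw0] at this
          cases hb : b 0 <;> cases hb' : b' 0 <;> simp_all
        · obtain ⟨_, h2, h3⟩ := hg u hu h
          refine ih _ (hD ▸ h3) (r (g u)) b b' rfl h2 (funext fun k => ?_)
          have := congrFun hR (k + 1)
          rwa [huk _ _ _ h, huk _ _ _ h] at this
    | succ n ihn =>
      intro D
      induction D using Nat.strong_induction_on with
      | _ D ih =>
        intro u b b' hD hu hR
        by_cases h : u = w
        · subst h
          have h0 : b 0 = b' 0 := by
            have := congrFun hR 0
            rw [hw0, hw0] at this
            cases hb : b 0 <;> cases hb' : b' 0 <;> simp_all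
          refine ihn _ (r (if b 0 then e else f)) (fun n => b (n + 1)) (fun n => b' (n + 1))
            rfl (hrif _) (funext fun k => ?_)
          have := congrFun hR (k + 1)
          rw [hwk, hwk, ← h0] at this
          exact this
        · obtain ⟨_, h2, h3⟩ := hg u hu h
          refine ih _ (hD ▸ h3) (r (g u)) b b' rfl h2 (funext fun k => ?_)
          have := congrFun hR (k + 1)
          rwa [huk _ _ _ h, huk _ _ _ h] at this
  have hww : Reach s r w w := .refl
  refine ⟨fun u hu => ⟨R u (fun _ => true), hs0 _ _ hu, fun i => path i _ _ hu⟩, ?_⟩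
  have hirr : ∃ b, ∀ m n, m < n → ∃ i, R w b (m + i) ≠ R w b (n + i) := by
    by_contra hcon
    push Not at hcon
    choose m n hmn hper using hcon
    let Φ : (ℕ → Bool) → Σ k : ℕ × ℕ, (Fin k.2 → E) := fun b => ⟨(m b, n b), fun i => R w b i⟩
    have hinj : Function.Injective Φ := by
      intro b b' hbb
      have h1 : m b = m b' := congrArg (fun x => x.1.1) hbb
      have h2 : n b = n b' := congrArg (fun x => x.1.2) hbb
      have h3 : ∀ i < n b, R w b i = R w b' i := by
        have aux : ∀ x y : Σ k : ℕ × ℕ, (Fin k.2 → E), x = y →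
            ∀ i (hi : i < x.1.2) (hi' : i < y.1.2), x.2 ⟨i, hi⟩ = y.2 ⟨i, hi'⟩ := by
          rintro x y rfl i _ _; rfl
        intro i hi
        exact aux _ _ hbb i hi (show i < n b' from h2 ▸ hi)
      have h4 : ∀ i, R w b i = R w b' i := by
        intro i
        induction i using Nat.strong_induction_on with
        | _ i ih =>
          by_cases hi : i < n b
          · exact h3 i hi
          · have h5 := hper b (i - n b)
            have h6 := hper b' (i - n b)
            have h7 := hmn b
            rw [show n b + (i - n b) = i by omega] at h5
            rw [← h2, ← h1, show n b + (i - n b) = i by omega] at h6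
            rw [← h5, ← h6]
            exact ih _ (by omega)
      exact funext fun k => dec k _ w b b' rfl hww (funext h4)
    have hc : Countable (ℕ → Bool) := hinj.countable
    obtain ⟨F, hF⟩ := hc
    refine Function.cantor_injective (fun S : Set ℕ => F (fun n => decide (n ∈ S))) ?_
    intro S S' hSS
    have h8 := hF hSS
    ext k
    have h9 := congrFun h8 k
    simpa using h9
  obtain ⟨b, hb⟩ := hirr
  exact ⟨R w b, fun i => path i _ _ hww, hb, fun n => visit n _ _ hww⟩

end LPAGraph

namespace LPAChen

open LPAFam

variable {V E : Type} {s r : E → V} {p : ℕ → E}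

/-- Infinite paths tail equivalent to `p`. -/
abbrev CB (s r : E → V) (p : ℕ → E) : Type :=
  {q : ℕ → E // (∀ i, r (q i) = s (q (i + 1))) ∧ ∃ m n, ∀ i, q (m + i) = p (n + i)}

/-- Prepending an edge. -/
def consS (e : E) (q : ℕ → E) : ℕ → E
  | 0 => e
  | k + 1 => q k

/-- Prepending an edge. -/
def consB (e : E) (q : CB s r p) (h : r e = s (q.1 0)) : CB s r p :=
  ⟨consS e q.1, by
    constructor
    · intro i
      cases i with
      | zero => exact h
      | succ i => exact q.2.1 i
    · obtain ⟨m, n, hmn⟩ := q.2.2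
      exact ⟨m + 1, n, fun i => by rw [← hmn, add_right_comm]; rfl⟩⟩

/-- Dropping the first edges. -/
def shiftB (k : ℕ) (q : CB s r p) : CB s r p :=
  ⟨fun i => q.1 (k + i), by
    constructor
    · intro i; exact q.2.1 (k + i)
    · obtain ⟨m, n, hmn⟩ := q.2.2
      refine ⟨m, n + k, fun i => ?_⟩
      change q.1 (k + (m + i)) = p (n + k + i)
      rw [show k + (m + i) = m + (k + i) by omega, hmn]
      congr 1; omega⟩

theorem shift_cons (e : E) (q : CB s r p) (h : r e = s (q.1 0)) : shiftB 1 (consB e q h) = q := by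
  apply Subtype.ext
  funext i
  change consS e q.1 (1 + i) = q.1 i
  rw [add_comm]; rfl

theorem cons_shift (q : CB s r p) (h : r (q.1 0) = s ((shiftB 1 q).1 0)) :
    consB (q.1 0) (shiftB 1 q) h = q := by
  apply Subtype.ext
  funext i
  cases i with
  | zero => rfl
  | succ i =>
    change q.1 (1 + i) = q.1 (i + 1)
    rw [add_comm]

theorem shift_shift (k l : ℕ) (q : CB s r p) : shiftB k (shiftB l q) = shiftB (l + k) q := by
  apply Subtype.ext
  funext i
  change q.1 (l + (k + i)) = q.1 (l + k + i)
  rw [add_assoc]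

section ops

open Classical

variable (K : Type) [Field K]

/-- Vertex operator. -/
noncomputable def Vop (v : V) : Module.End K (CB s r p →₀ K) :=
  Finsupp.linearCombination K fun q => if s (q.1 0) = v then Finsupp.single q (1 : K) else 0

/-- Edge operator. -/
noncomputable def Eop (e : E) : Module.End K (CB s r p →₀ K) :=
  Finsupp.linearCombination K fun q =>
    if h : r e = s (q.1 0) then Finsupp.single (consB e q h) (1 : K) else 0

/-- Ghost operator. -/
noncomputable def Gop (e : E) : Module.End K (CB s r p →₀ K) :=
  Finsupp.linearCombination K fun q => if q.1 0 = e then Finsupp.single (shiftB 1 q) (1 : K) else 0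

theorem Vop_single (v : V) (q : CB s r p) : Vop K v (Finsupp.single q 1) =
    if s (q.1 0) = v then Finsupp.single q (1 : K) else 0 := by
  simp [Vop]

theorem Eop_single (e : E) (q : CB s r p) : Eop K e (Finsupp.single q 1) =
    if h : r e = s (q.1 0) then Finsupp.single (consB e q h) (1 : K) else 0 := by
  simp [Eop]

theorem Gop_single (e : E) (q : CB s r p) : Gop K e (Finsupp.single q 1) =
    if q.1 0 = e then Finsupp.single (shiftB 1 q) (1 : K) else 0 := by
  simp [Gop]

theorem end_ext {f g : Module.End K (CB s r p →₀ K)}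
    (h : ∀ q, f (Finsupp.single q 1) = g (Finsupp.single q 1)) : f = g := by
  refine Finsupp.lhom_ext' fun q => LinearMap.ext_ring ?_
  simpa using h q

theorem ch_head (e : E) (q : CB s r p) (h : r e = s (q.1 0)) : (consB e q h).1 0 = e := rfl

theorem sh_head (q : CB s r p) : s ((shiftB 1 q).1 0) = r (q.1 0) := (q.2.1 0).symm

variable [Fintype V] [Fintype E]

/-- The images of generators. -/
noncomputable def genOp : LPAGen V E → Module.End K (CB s r p →₀ K)
  | .vertex v => Vop K v
  | .edge e => Eop K e
  | .ghost e => Gop K e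

/-- The Chen representation. -/
noncomputable def rho (p : ℕ → E) :
    LeavittPathAlgebra K V E s r →ₐ[K] Module.End K (CB s r p →₀ K) :=
  RingQuot.liftAlgHom K ⟨FreeAlgebra.lift K (genOp K), by
    intro x y hxy
    induction hxy with
    | vertex_orth v w h =>
      simp only [map_mul, FreeAlgebra.lift_ι_apply, map_zero, genOp]
      refine end_ext K fun q => ?_
      rw [Module.End.mul_apply, Vop_single]
      split_ifs with h1
      · rw [Vop_single, if_neg]
        · rfl
        · rw [h1]; exact h.symm
      · rw [map_zero]; rfl
    | vertex_idem v =>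
      simp only [map_mul, FreeAlgebra.lift_ι_apply, map_zero, genOp]
      refine end_ext K fun q => ?_
      rw [Module.End.mul_apply, Vop_single]
      split_ifs with h1
      · rw [Vop_single, if_pos h1]
      · rw [map_zero]
    | edge_src e =>
      simp only [map_mul, FreeAlgebra.lift_ι_apply, map_zero, genOp]
      refine end_ext K fun q => ?_
      rw [Module.End.mul_apply, Eop_single]
      split_ifs with h1
      · rw [Vop_single, if_pos (by rw [ch_head])]
      · rw [map_zero]
    | edge_rng e =>
      simp only [map_mul, FreeAlgebra.lift_ι_apply, map_zero, genOp]
      refine end_ext K fun q => ?_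
      rw [Module.End.mul_apply, Vop_single]
      split_ifs with h1
      · rfl
      · rw [map_zero, Eop_single, dif_neg (Ne.symm h1)]
    | ghost_rng e =>
      simp only [map_mul, FreeAlgebra.lift_ι_apply, map_zero, genOp]
      refine end_ext K fun q => ?_
      rw [Module.End.mul_apply, Gop_single]
      split_ifs with h1
      · rw [Vop_single, if_pos]
        exact (sh_head q).trans (by rw [h1])
      · rw [map_zero]
    | ghost_src e =>
      simp only [map_mul, FreeAlgebra.lift_ι_apply, map_zero, genOp]
      refine end_ext K fun q => ?_
      rw [Module.End.mul_apply, Vop_single]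
      split_ifs with h1
      · rfl
      · rw [map_zero, Gop_single, if_neg]
        rintro rfl; exact h1 rfl
    | ck1_distinct e f h =>
      simp only [map_mul, FreeAlgebra.lift_ι_apply, map_zero, genOp]
      refine end_ext K fun q => ?_
      rw [Module.End.mul_apply, Eop_single]
      split_ifs with h1
      · rw [Gop_single, if_neg (by rw [ch_head]; exact h.symm)]; rfl
      · rw [map_zero]; rfl
    | ck1_same e =>
      simp only [map_mul, FreeAlgebra.lift_ι_apply, map_zero, genOp]
      refine end_ext K fun q => ?_
      rw [Module.End.mul_apply, Eop_single, Vop_single]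
      split_ifs with h1 h2 h2
      · rw [Gop_single, if_pos (ch_head _ _ _), shift_cons]
      · exact absurd h1.symm h2
      · exact absurd h2.symm h1
      · rw [map_zero]
    | ck2 v h hne =>
      simp only [map_mul, map_sum, FreeAlgebra.lift_ι_apply, map_zero, genOp]
      refine end_ext K fun q => ?_
      rw [LinearMap.sum_apply, Vop_single]
      have aux : ∀ e, (Eop K e * Gop K e : Module.End K (CB s r p →₀ K)) (Finsupp.single q (1 : K)) =
          if q.1 0 = e then Finsupp.single q (1 : K) else 0 := by
        intro e
        rw [Module.End.mul_apply, Gop_single]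
        split_ifs with h1
        · subst h1
          rw [Eop_single, dif_pos (sh_head q).symm, cons_shift]
        · rw [map_zero]
      simp only [aux]
      rw [Finset.sum_ite_eq]
      simp
    | unit =>
      simp only [map_mul, map_one, map_sum, FreeAlgebra.lift_ι_apply, map_zero, genOp]
      refine end_ext K fun q => ?_
      rw [LinearMap.sum_apply]
      simp only [Vop_single]
      rw [Finset.sum_ite_eq]
      simp⟩

end ops

variable {K : Type} [Field K] [Fintype V] [Fintype E]
    {L : Type} [Ring L] [Algebra K L] (A : LPAFam K s r L)

/-- Initial segment of length `k`. -/
def pre : ℕ → (ℕ → E) → L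
  | 0, y => A.vt (s (y 0))
  | k + 1, y => A.ed (y 0) * pre k (fun i => y (1 + i))

/-- Ghost initial segment of length `k`. -/
def gpre : ℕ → (ℕ → E) → L
  | 0, _ => 1
  | k + 1, y => gpre k (fun i => y (1 + i)) * A.gh (y 0)

theorem vt_pre (k : ℕ) (y : ℕ → E) : A.vt (s (y 0)) * pre A k y = pre A k y := by
  cases k with
  | zero => exact A.vi _
  | succ k => rw [pre, ← mul_assoc, A.es]

theorem vt_pre_ne (k : ℕ) (y : ℕ → E) (v : V) (h : v ≠ s (y 0)) : A.vt v * pre A k y = 0 := by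
  rw [← vt_pre, ← mul_assoc, A.vv _ _ h, zero_mul]

theorem gpre_pre (k : ℕ) (y : ℕ → E) (hy : ∀ i, r (y i) = s (y (i + 1))) :
    gpre A k y * pre A k y = A.vt (s (y k)) := by
  induction k generalizing y with
  | zero => rw [gpre, one_mul]; rfl
  | succ k ih =>
    rw [gpre, pre, mul_assoc, ← mul_assoc (A.gh _), A.geq, hy 0]
    have h1 := vt_pre A k (fun i => y (1 + i))
    simp only [add_zero] at h1
    rw [zero_add, h1, ih _ (fun i => hy (1 + i)), add_comm]

theorem pre_ed (k : ℕ) (y : ℕ → E) (hy : ∀ i, r (y i) = s (y (i + 1))) :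
    pre A k y * A.ed (y k) = pre A (k + 1) y := by
  induction k generalizing y with
  | zero =>
    simp only [pre, add_zero]
    have h0 := hy 0
    rw [zero_add] at h0
    rw [A.es, ← h0, A.er]
  | succ k ih =>
    have h1 := ih _ (fun i => hy (1 + i))
    rw [pre, pre, ← h1, mul_assoc, add_comm k 1]

/-- The span of true paths ending at the tail of `p`. -/
def W (p : ℕ → E) (n : ℕ) : Submodule K L :=
  Submodule.span K (Set.range fun g : {g : ℕ × CB s r p // ∀ i, g.2.1 (g.1 + i) = p (n + i)} =>
    pre A g.1.1 g.1.2.1)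

variable {A}

theorem W_up {n : ℕ} {b : L} (hb : b ∈ W A p n) : b * A.ed (p n) ∈ W A p (n + 1) := by
  induction hb using Submodule.span_induction with
  | mem x h =>
    obtain ⟨⟨⟨k, y⟩, hg⟩, rfl⟩ := h
    simp only at hg ⊢
    have h0 := hg 0
    rw [add_zero, add_zero] at h0
    rw [← h0, pre_ed A k _ y.2.1]
    refine Submodule.subset_span ⟨⟨⟨k + 1, y⟩, fun i => ?_⟩, rfl⟩
    simp only
    rw [add_assoc, hg]; congr 1; omega
  | zero => rw [zero_mul]; exact Submodule.zero_mem _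
  | add x y _ _ hx hy => rw [add_mul]; exact Submodule.add_mem _ hx hy
  | smul a x _ hx => rw [smul_mul_assoc]; exact Submodule.smul_mem _ _ hx

theorem W_gh {n : ℕ} {b : L} (hb : b ∈ W A p n) (e : E) :
    A.gh e * (b * A.ed (p n)) ∈ W A p (n + 1) := by
  induction hb using Submodule.span_induction with
  | mem x h =>
    obtain ⟨⟨⟨k, y⟩, hg⟩, rfl⟩ := h
    simp only at hg ⊢
    have h0 := hg 0
    rw [add_zero, add_zero] at h0
    rw [← h0, pre_ed A k _ y.2.1, pre, ← mul_assoc]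
    by_cases he : e = y.1 0
    · rw [he, A.geq, ← sh_head y]
      change A.vt (s ((shiftB 1 y).1 0)) * pre A k (shiftB 1 y).1 ∈ _
      rw [vt_pre]
      refine Submodule.subset_span ⟨⟨⟨k, shiftB 1 y⟩, fun i => ?_⟩, rfl⟩
      change y.1 (1 + (k + i)) = _
      rw [show 1 + (k + i) = k + (1 + i) by omega, hg]; congr 1; omega
    · rw [A.gne _ _ he, zero_mul]; exact Submodule.zero_mem _
  | zero => rw [zero_mul, mul_zero]; exact Submodule.zero_mem _
  | add x y _ _ hx hy => rw [add_mul, mul_add]; exact Submodule.add_mem _ hx hy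
  | smul a x _ hx => rw [smul_mul_assoc, mul_smul_comm]; exact Submodule.smul_mem _ _ hx

theorem W_vt {n : ℕ} {b : L} (hb : b ∈ W A p n) (v : V) : A.vt v * b ∈ W A p n := by
  induction hb using Submodule.span_induction with
  | mem x h =>
    obtain ⟨⟨⟨k, y⟩, hg⟩, rfl⟩ := h
    simp only at hg ⊢
    by_cases he : v = s (y.1 0)
    · rw [he, vt_pre]
      exact Submodule.subset_span ⟨⟨⟨k, y⟩, hg⟩, rfl⟩
    · rw [vt_pre_ne _ _ _ _ he]; exact Submodule.zero_mem _
  | zero => rw [mul_zero]; exact Submodule.zero_mem _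
  | add x y _ _ hx hy => rw [mul_add]; exact Submodule.add_mem _ hx hy
  | smul a x _ hx => rw [mul_smul_comm]; exact Submodule.smul_mem _ _ hx

theorem W_ed {n : ℕ} {b : L} (hb : b ∈ W A p n) (e : E) : A.ed e * b ∈ W A p n := by
  induction hb using Submodule.span_induction with
  | mem x h =>
    obtain ⟨⟨⟨k, y⟩, hg⟩, rfl⟩ := h
    simp only at hg ⊢
    by_cases he : r e = s (y.1 0)
    · have h1 : A.ed e * pre A k y.1 = pre A (k + 1) (consB e y he).1 := by
        have h2 : (fun i => (consB e y he).1 (1 + i)) = y.1 :=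
          congrArg Subtype.val (shift_cons e y he)
        rw [pre, h2]; rfl
      rw [h1]
      refine Submodule.subset_span ⟨⟨⟨k + 1, consB e y he⟩, fun i => ?_⟩, rfl⟩
      rw [← hg]
      simp only
      rw [add_right_comm]; rfl
    · rw [← A.er, mul_assoc, vt_pre_ne _ _ _ _ he, mul_zero]; exact Submodule.zero_mem _
  | zero => rw [mul_zero]; exact Submodule.zero_mem _
  | add x y _ _ hx hy => rw [mul_add]; exact Submodule.add_mem _ hx hy
  | smul a x _ hx => rw [mul_smul_comm]; exact Submodule.smul_mem _ _ hx

theorem exists_W (hp : ∀ i, r (p i) = s (p (i + 1))) (a : L) :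
    ∃ n, a * pre A n p ∈ W A p n := by
  have up : ∀ (b : L) n m, n ≤ m → b * pre A n p ∈ W A p n → b * pre A m p ∈ W A p m := by
    intro b n m hnm hb
    induction hnm with
    | refl => exact hb
    | step _ ih =>
      rw [Nat.succ_eq_add_one, ← pre_ed A _ p hp, ← mul_assoc]
      exact W_up ih
  have h1 := A.smul_closed (M := L) (fun b => ∃ n, b * pre A n p ∈ W A p n) ?_ ?_ ?_ ?_ ?_ a 1 ?_
  · simpa using h1
  · rintro b c ⟨n, hn⟩ ⟨m, hm⟩
    refine ⟨max n m, ?_⟩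
    rw [add_mul]
    exact Submodule.add_mem _ (up _ _ _ (le_max_left _ _) hn) (up _ _ _ (le_max_right _ _) hm)
  · rintro k b ⟨n, hn⟩
    exact ⟨n, by rw [smul_mul_assoc]; exact Submodule.smul_mem _ _ hn⟩
  · rintro v b ⟨n, hn⟩
    exact ⟨n, by rw [smul_eq_mul, mul_assoc]; exact W_vt hn v⟩
  · rintro v b ⟨n, hn⟩
    exact ⟨n, by rw [smul_eq_mul, mul_assoc]; exact W_ed hn v⟩
  · rintro v b ⟨n, hn⟩
    refine ⟨n + 1, ?_⟩
    rw [smul_eq_mul, ← pre_ed A _ p hp, mul_assoc, ← mul_assoc b]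
    exact W_gh hn v
  · refine ⟨0, ?_⟩
    rw [one_mul]
    exact Submodule.subset_span ⟨⟨⟨0, ⟨p, hp, 0, 0, fun _ => rfl⟩⟩, fun _ => rfl⟩, rfl⟩

variable (A)

variable [Module L (CB s r p →₀ K)] [IsScalarTower K L (CB s r p →₀ K)]

open Classical in
/-- Compatibility of the module structure. -/
structure Compat : Prop where
  V : ∀ v (q : CB s r p), A.vt v • Finsupp.single q (1 : K) =
    if s (q.1 0) = v then Finsupp.single q (1 : K) else 0
  E : ∀ e (q : CB s r p), A.ed e • Finsupp.single q (1 : K) =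
    if h : r e = s (q.1 0) then Finsupp.single (consB e q h) (1 : K) else 0
  G : ∀ e (q : CB s r p), A.gh e • Finsupp.single q (1 : K) =
    if q.1 0 = e then Finsupp.single (shiftB 1 q) (1 : K) else 0

variable {A}

theorem pre_smul (H : Compat (p := p) A) (k : ℕ) (q : CB s r p) :
    pre A k q.1 • Finsupp.single (shiftB k q) (1 : K) = Finsupp.single q 1 := by
  induction k generalizing q with
  | zero =>
    have : shiftB 0 q = q := by
      apply Subtype.ext; funext i; change q.1 (0 + i) = _; rw [zero_add]
    rw [this, pre, H.V, if_pos rfl]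
  | succ k ih =>
    have h1 := ih (shiftB 1 q)
    rw [shift_shift] at h1
    rw [pre, mul_smul, add_comm k 1]
    change A.ed (q.1 0) • pre A k (shiftB 1 q).1 • _ = _
    rw [h1, H.E, dif_pos (sh_head q).symm, cons_shift]

open Classical in
theorem gpre_smul (H : Compat (p := p) A) (k : ℕ) (y : ℕ → E) (q : CB s r p) :
    gpre A k y • Finsupp.single q (1 : K) =
      if ∀ i < k, q.1 i = y i then Finsupp.single (shiftB k q) (1 : K) else 0 := by
  induction k generalizing q y with
  | zero =>
    have : shiftB 0 q = q := by
      apply Subtype.ext; funext i; change q.1 (0 + i) = _; rw [zero_add]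
    rw [this, gpre, one_smul, if_pos (by intro i hi; omega)]
  | succ k ih =>
    rw [gpre, mul_smul, H.G]
    by_cases h0 : q.1 0 = y 0
    · rw [if_pos h0, ih, shift_shift, add_comm 1 k]
      refine if_congr ?_ rfl rfl
      constructor
      · intro h i hi
        cases i with
        | zero => exact h0
        | succ i =>
          have := h i (by omega)
          change q.1 (1 + i) = y (1 + i) at this
          rwa [add_comm] at this
      · intro h i hi
        exact h (1 + i) (by omega)
    · rw [if_neg h0, smul_zero, if_neg]
      intro h
      exact h0 (h 0 (by omega))

theorem chen_simple (H : Compat (p := p) A) (hp : ∀ i, r (p i) = s (p (i + 1))) : IsSimpleModule L (CB s r p →₀ K) := by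
  classical
  rw [isSimpleModule_iff_toSpanSingleton_surjective]
  have : Nonempty (CB s r p) := ⟨⟨p, hp, 0, 0, fun i => rfl⟩⟩
  refine ⟨inferInstance, fun x hx => ?_⟩
  rw [← LinearMap.range_eq_top]
  set N := LinearMap.range (LinearMap.toSpanSingleton L (CB s r p →₀ K) x) with hN
  have hxN : x ∈ N := ⟨1, by simp⟩
  obtain ⟨y, hy⟩ := Finsupp.support_nonempty_iff.2 hx
  have hk : ∃ k, ∀ q ∈ x.support, q ≠ y → ¬ ∀ i < k, q.1 i = y.1 i := by
    have h1 : ∀ q : CB s r p, ∃ k, q ≠ y → ¬ ∀ i < k, q.1 i = y.1 i := by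
      intro q
      by_cases h : q = y
      · exact ⟨0, fun h' => absurd h h'⟩
      · have : ∃ i, q.1 i ≠ y.1 i := by
          by_contra hc
          push Not at hc
          exact h (Subtype.ext (funext hc))
        obtain ⟨i, hi⟩ := this
        exact ⟨i + 1, fun _ h' => hi (h' i (by omega))⟩
    choose κ hκ using h1
    refine ⟨x.support.sup κ, fun q hq hne h => hκ q hne fun i hi => h i ?_⟩
    exact lt_of_lt_of_le hi (Finset.le_sup (f := κ) hq)
  obtain ⟨k, hk⟩ := hk
  have h2 : gpre A k y.1 • x = x y • Finsupp.single (shiftB k y) (1 : K) := by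
    have hx' : x = ∑ q ∈ x.support, x q • Finsupp.single q (1 : K) := by
      conv_lhs => rw [← Finsupp.sum_single x]
      simp [Finsupp.sum]
    conv_lhs => rw [hx']
    rw [Finset.smul_sum, Finset.sum_eq_single y]
    · rw [smul_algebra_smul_comm, gpre_smul H, if_pos (fun _ _ => rfl)]
    · intro q hq hne
      rw [smul_algebra_smul_comm, gpre_smul H, if_neg (hk q hq hne), smul_zero]
    · intro h; exact absurd hy h
  have hKN : ∀ (c : K) m, m ∈ N → c • m ∈ N := by
    intro c m hm
    rw [← algebraMap_smul L c]
    exact N.smul_mem _ hm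
  have h3 : Finsupp.single (shiftB k y) (1 : K) ∈ N := by
    have h4 : x y • Finsupp.single (shiftB k y) (1 : K) ∈ N := h2 ▸ N.smul_mem _ hxN
    have h5 := hKN (x y)⁻¹ _ h4
    rwa [← mul_smul, inv_mul_cancel₀ (Finsupp.mem_support_iff.1 hy), one_smul] at h5
  have h6 : ∀ l, Finsupp.single (shiftB (k + l) y) (1 : K) ∈ N := by
    intro l
    have := N.smul_mem (gpre A l (shiftB k y).1) h3
    rwa [gpre_smul H, if_pos (fun _ _ => rfl), shift_shift] at this
  have h7 : ∀ z : CB s r p, Finsupp.single z (1 : K) ∈ N := by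
    intro z
    obtain ⟨a, b, hab⟩ := z.2.2
    obtain ⟨c, d, hcd⟩ := y.2.2
    rw [← pre_smul H (a + d + k) z]
    refine N.smul_mem _ ?_
    have : shiftB (a + d + k) z = shiftB (k + (c + b)) y := by
      apply Subtype.ext
      funext i
      change z.1 (a + d + k + i) = y.1 (k + (c + b) + i)
      rw [show a + d + k + i = a + (d + k + i) by omega,
        show k + (c + b) + i = c + (b + k + i) by omega, hab, hcd]
      congr 1; omega
    rw [this]
    exact h6 _
  rw [eq_top_iff]
  rintro t -
  rw [← Finsupp.sum_single t]
  refine Submodule.sum_mem _ fun q _ => ?_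
  have := hKN (t q) _ (h7 q)
  simpa using this

theorem W_inj (H : Compat (p := p) A) (hirr : ∀ m n, m < n → ∃ i, p (m + i) ≠ p (n + i)) (P : CB s r p) (hP : P.1 = p)
    {n : ℕ} {b : L} (hb : b ∈ W A p n)
    (h0 : b • Finsupp.single (shiftB n P) (1 : K) = 0) : b = 0 := by
  obtain ⟨c, rfl⟩ := Finsupp.mem_span_range_iff_exists_finsupp.1 hb
  have hinj : Function.Injective
      (fun g : {g : ℕ × CB s r p // ∀ i, g.2.1 (g.1 + i) = p (n + i)} => g.1.2) := by
    have aux : ∀ k k' (y : CB s r p), (∀ i, y.1 (k + i) = p (n + i)) →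
        (∀ i, y.1 (k' + i) = p (n + i)) → ¬ k < k' := by
      intro k k' y h1 h2 hlt
      obtain ⟨i, hi⟩ := hirr n (n + (k' - k)) (by omega)
      apply hi
      have a1 := h2 i
      have a2 := h1 ((k' - k) + i)
      rw [show k + (k' - k + i) = k' + i by omega] at a2
      rw [add_assoc, ← a2, a1]
    rintro ⟨⟨k, y⟩, h1⟩ ⟨⟨k', y'⟩, h2⟩ h
    simp only at h h1 h2
    subst h
    have h3 := aux k k' y h1 h2
    have h4 := aux k' k y h2 h1
    have : k = k' := by omega
    subst this
    rfl
  have hsum : Finsupp.mapDomain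
      (fun g : {g : ℕ × CB s r p // ∀ i, g.2.1 (g.1 + i) = p (n + i)} => g.1.2) c = 0 := by
    rw [← h0, Finsupp.mapDomain, Finsupp.sum, Finsupp.sum, Finset.sum_smul]
    refine Finset.sum_congr rfl fun g _ => ?_
    have h5 : shiftB n P = shiftB g.1.1 g.1.2 := by
      apply Subtype.ext
      funext i
      change P.1 (n + i) = g.1.2.1 (g.1.1 + i)
      rw [g.2, hP]
    rw [smul_assoc, h5, pre_smul H]
    simp
  have hc : c = 0 := Finsupp.mapDomain_injective hinj (by rw [hsum, Finsupp.mapDomain_zero])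
  rw [hc, Finsupp.sum_zero_index]

theorem not_fg (H : Compat (p := p) A) (hp : ∀ i, r (p i) = s (p (i + 1)))
    (hirr : ∀ m n, m < n → ∃ i, p (m + i) ≠ p (n + i))
    (hex : ∀ n, ∃ m f, n ≤ m ∧ s f = s (p m) ∧ f ≠ p m ∧ A.vt (r f) ≠ 0) (P : CB s r p)
    (hP : P.1 = p) :
    ¬ (LinearMap.ker (LinearMap.toSpanSingleton L (CB s r p →₀ K) (Finsupp.single P 1))).FG := by
  classical
  rintro ⟨F, hF⟩
  have hpreP : ∀ n, pre A n p • Finsupp.single (shiftB n P) (1 : K) = Finsupp.single P 1 := by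
    intro n
    have := pre_smul H n P
    rwa [hP] at this
  have h1 : ∀ a : L, ∃ n, a • Finsupp.single P (1 : K) = 0 → a * pre A n p = 0 := by
    intro a
    obtain ⟨n, hn⟩ := exists_W (A := A) hp a
    refine ⟨n, fun h => W_inj H hirr P hP hn ?_⟩
    rw [mul_smul, hpreP, h]
  choose κ hκ using h1
  have up : ∀ (b : L) n m, n ≤ m → b * pre A n p = 0 → b * pre A m p = 0 := by
    intro b n m hnm hb
    induction hnm with
    | refl => exact hb
    | step _ ih => rw [Nat.succ_eq_add_one, ← pre_ed A _ p hp, ← mul_assoc, ih, zero_mul]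
  obtain ⟨m, f, hm, hsf, hne, hrf⟩ := hex (F.sup κ)
  have h2 : ∀ a ∈ LinearMap.ker
      (LinearMap.toSpanSingleton L (CB s r p →₀ K) (Finsupp.single P 1)), a * pre A m p = 0 := by
    intro a ha
    rw [← hF] at ha
    induction ha using Submodule.span_induction with
    | mem x h =>
      have h3 : x ∈ LinearMap.ker
          (LinearMap.toSpanSingleton L (CB s r p →₀ K) (Finsupp.single P 1)) := by
        rw [← hF]; exact Submodule.subset_span h
      rw [LinearMap.mem_ker, LinearMap.toSpanSingleton_apply] at h3
      exact up _ _ _ ((Finset.le_sup (f := κ) h).trans hm) (hκ x h3)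
    | zero => rw [zero_mul]
    | add x y _ _ hx hy => rw [add_mul, hx, hy, add_zero]
    | smul a x _ hx => rw [smul_mul_assoc, hx, smul_zero]
  have h4 := h2 (A.gh f * gpre A m p) (by
    rw [LinearMap.mem_ker, LinearMap.toSpanSingleton_apply, mul_smul, gpre_smul H,
      if_pos (fun i _ => by rw [hP]), H.G, if_neg]
    change P.1 (m + 0) ≠ f
    rw [hP]
    exact hne.symm)
  rw [mul_assoc, gpre_pre A m p hp, ← hsf, A.gs] at h4
  apply hrf
  rw [← A.geq, h4, zero_mul]

end LPAChen

namespace LPAMain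

open LPAFam LPAChen

variable (K V E : Type) [Field K] [Fintype V] [Fintype E] (s r : E → V)

/-- Image of a generator in the Leavitt path algebra. -/
noncomputable def gi (x : LPAGen V E) : LeavittPathAlgebra K V E s r :=
  RingQuot.mkAlgHom K (LPARel K V E s r) (FreeAlgebra.ι K x)

/-- The tautological Leavitt family. -/
noncomputable def fam : LPAFam K s r (LeavittPathAlgebra K V E s r) where
  vt v := gi K V E s r (.vertex v)
  ed e := gi K V E s r (.edge e)
  gh e := gi K V E s r (.ghost e)
  vv v w h := by
    have := RingQuot.mkAlgHom_rel K (LPARel.vertex_orth (K := K) (s := s) (r := r) v w h)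
    simpa only [map_mul, map_zero, gi] using this
  vi v := by
    have := RingQuot.mkAlgHom_rel K (LPARel.vertex_idem (K := K) (s := s) (r := r) v)
    simpa only [map_mul, map_zero, gi] using this
  es e := by
    have := RingQuot.mkAlgHom_rel K (LPARel.edge_src (K := K) (s := s) (r := r) e)
    simpa only [map_mul, map_zero, gi] using this
  er e := by
    have := RingQuot.mkAlgHom_rel K (LPARel.edge_rng (K := K) (s := s) (r := r) e)
    simpa only [map_mul, map_zero, gi] using this
  gr e := by
    have := RingQuot.mkAlgHom_rel K (LPARel.ghost_rng (K := K) (s := s) (r := r) e)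
    simpa only [map_mul, map_zero, gi] using this
  gs e := by
    have := RingQuot.mkAlgHom_rel K (LPARel.ghost_src (K := K) (s := s) (r := r) e)
    simpa only [map_mul, map_zero, gi] using this
  gne e f h := by
    have := RingQuot.mkAlgHom_rel K (LPARel.ck1_distinct (K := K) (s := s) (r := r) e f h)
    simpa only [map_mul, map_zero, gi] using this
  geq e := by
    have := RingQuot.mkAlgHom_rel K (LPARel.ck1_same (K := K) (s := s) (r := r) e)
    simpa only [map_mul, map_zero, gi] using this
  ck v F hF hne := by
    have hfin : {e : E | s e = v}.Finite := Set.toFinite _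
    have hFe : F = hfin.toFinset := by
      ext e; rw [hF, Set.Finite.mem_toFinset]; rfl
    have := RingQuot.mkAlgHom_rel K (LPARel.ck2 (K := K) (s := s) (r := r) v hfin
      (by obtain ⟨e, he⟩ := hne; exact ⟨e, (hF e).1 he⟩))
    rw [hFe]
    simpa only [map_mul, map_sum, map_zero, gi] using this
  one := by
    have := RingQuot.mkAlgHom_rel K (LPARel.unit (K := K) (s := s) (r := r))
    simpa only [map_one, map_sum, gi] using this
  gen := by
    have h1 := congrArg (Subalgebra.map (RingQuot.mkAlgHom K (LPARel K V E s r)))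
      (FreeAlgebra.adjoin_range_ι K (LPAGen V E))
    rw [Algebra.map_top, (AlgHom.range_eq_top _).2 (RingQuot.mkAlgHom_surjective K _),
      AlgHom.map_adjoin] at h1
    rw [eq_top_iff, ← h1]
    refine Algebra.adjoin_mono ?_
    rintro _ ⟨_, ⟨x, rfl⟩, rfl⟩
    cases x with
    | vertex v => exact Or.inl (Or.inl ⟨v, rfl⟩)
    | edge e => exact Or.inl (Or.inr ⟨e, rfl⟩)
    | ghost e => exact Or.inr ⟨e, rfl⟩

variable {K V E s r}

theorem rho_gi (p : ℕ → E) (x : LPAGen V E) :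
    rho K p (gi K V E s r x) = genOp K x := by
  rw [rho, gi, RingQuot.liftAlgHom_mkAlgHom_apply, FreeAlgebra.lift_ι_apply]

theorem vt_ne_zero (q : ℕ → E) (hq : ∀ i, r (q i) = s (q (i + 1))) :
    (fam K V E s r).vt (s (q 0)) ≠ 0 := by
  intro h
  have h1 := rho_gi (K := K) (s := s) (r := r) q (.vertex (s (q 0)))
  have h2 : gi K V E s r (.vertex (s (q 0))) = 0 := h
  rw [h2, map_zero] at h1
  let Q : CB s r q := ⟨q, hq, 0, 0, fun _ => rfl⟩
  have h3 : Vop K (s (q 0)) (Finsupp.single Q (1 : K)) = 0 := by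
    have := congrArg (fun T => T (Finsupp.single Q (1 : K))) h1
    exact this.symm
  rw [Vop_single, if_pos rfl] at h3
  simp at h3

theorem not_fp (p : ℕ → E) (hp : ∀ i, r (p i) = s (p (i + 1)))
    (hirr : ∀ m n, m < n → ∃ i, p (m + i) ≠ p (n + i))
    (hex : ∀ n, ∃ m f, n ≤ m ∧ s f = s (p m) ∧ f ≠ p m ∧ (fam K V E s r).vt (r f) ≠ 0)
    (hfp : ∀ (M : Type) [AddCommGroup M] [Module (LeavittPathAlgebra K V E s r) M],
        IsSimpleModule (LeavittPathAlgebra K V E s r) M →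
        ∃ (m n : ℕ)
          (f : (Fin m → LeavittPathAlgebra K V E s r)
            →ₗ[LeavittPathAlgebra K V E s r] (Fin n → LeavittPathAlgebra K V E s r))
          (g : (Fin n → LeavittPathAlgebra K V E s r)
            →ₗ[LeavittPathAlgebra K V E s r] M),
          Function.Surjective g ∧ LinearMap.range f = LinearMap.ker g) : False := by
  classical
  let _ : Module (LeavittPathAlgebra K V E s r) (CB s r p →₀ K) :=
    Module.compHom _ (rho K p).toRingHom
  have hsm : ∀ (a : LeavittPathAlgebra K V E s r) (x : CB s r p →₀ K),
    a • x = rho K p a x := fun _ _ => rfl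
  have : IsScalarTower K (LeavittPathAlgebra K V E s r) (CB s r p →₀ K) := by
    constructor
    intro k a x
    rw [hsm, hsm, map_smul]; rfl
  have H : Compat (p := p) (fam K V E s r) := by
    constructor
    · intro v q
      rw [hsm]
      change rho K p (gi K V E s r (.vertex v)) _ = _
      rw [rho_gi]
      exact (Vop_single K v q).trans (by congr)
    · intro v q
      rw [hsm]
      change rho K p (gi K V E s r (.edge v)) _ = _
      rw [rho_gi]
      exact (Eop_single K v q).trans (by congr)
    · intro v q
      rw [hsm]
      change rho K p (gi K V E s r (.ghost v)) _ = _
      rw [rho_gi]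
      exact (Gop_single K v q).trans (by congr)
  have hs := chen_simple H hp
  obtain ⟨m, n, f, g, hg, hfg⟩ := hfp (CB s r p →₀ K) hs
  let P : CB s r p := ⟨p, hp, 0, 0, fun _ => rfl⟩
  have hFP : Module.FinitePresentation (LeavittPathAlgebra K V E s r) (CB s r p →₀ K) :=
    Module.finitePresentation_of_surjective g hg
      (by rw [← hfg, LinearMap.range_eq_map]; exact Module.Finite.fg_top.map f)
  refine not_fg H hp hirr hex P rfl ?_
  refine Module.FinitePresentation.fg_ker _ (IsSimpleModule.toSpanSingleton_surjective _ ?_)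
  simp

end LPAMain

/-- For a finite directed graph `E` and a field `K`, every simple left
module over the Leavitt path algebra `L = L_K(E)` is finitely presented (there is an
exact sequence `L^m → L^n → M → 0`) if and only if no two distinct cycles of `E` (cycles
being identified up to cyclic rotation) have a common vertex. -/
theorem lpa_allSimpleFP_iff_disjointCycles (K V E : Type) [Field K] [Fintype V]
    [Fintype E] (s r : E → V) :
    (∀ (M : Type) [AddCommGroup M] [Module (LeavittPathAlgebra K V E s r) M],
        IsSimpleModule (LeavittPathAlgebra K V E s r) M →
        ∃ (m n : ℕ)
          (f : (Fin m → LeavittPathAlgebra K V E s r)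
            →ₗ[LeavittPathAlgebra K V E s r] (Fin n → LeavittPathAlgebra K V E s r))
          (g : (Fin n → LeavittPathAlgebra K V E s r)
            →ₗ[LeavittPathAlgebra K V E s r] M),
          Function.Surjective g ∧ LinearMap.range f = LinearMap.ker g) ↔
      ∀ es₁ es₂ : List E, IsCycle s r es₁ → IsCycle s r es₂ →
        (∃ (i j : ℕ) (hi : i < es₁.length) (hj : j < es₂.length),
          s (es₁[i]'hi) = s (es₂[j]'hj)) →
        es₁.IsRotated es₂ := by
  classical
  constructor
  · intro hfp
    refine LPAGraph.disjoint_of_uniq ?_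
    by_contra hU
    rw [LPAFam.Uniq] at hU
    push Not at hU
    obtain ⟨e, f, hs, he, hf, hef⟩ := hU
    rw [← hs] at hf
    obtain ⟨hpath, p, hp, hirr, hvis⟩ := LPAGraph.exists_path (s e) e f hef rfl hs.symm he hf
    refine LPAMain.not_fp (K := K) p hp hirr ?_ hfp
    intro n
    obtain ⟨m, hm, hsm, hor⟩ := hvis n
    have hne : ∀ u, LPAFam.Reach s r u (s e) → (LPAMain.fam K V E s r).vt u ≠ 0 := by
      intro u hu
      obtain ⟨q, rfl, hq⟩ := hpath u hu
      exact LPAMain.vt_ne_zero q hq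
    rcases hor with h | h
    · exact ⟨m, f, hm, by rw [hsm, hs], by rw [h]; exact hef.symm, hne _ hf⟩
    · exact ⟨m, e, hm, by rw [hsm], by rw [h]; exact hef, hne _ he⟩
  · intro h M _ _ hM
    let _ : Module K M := Module.compHom M (algebraMap K (LeavittPathAlgebra K V E s r))
    have : IsScalarTower K (LeavittPathAlgebra K V E s r) M := by
      constructor
      intro k a x
      rw [Algebra.smul_def, mul_smul]; rfl
    obtain ⟨U, hfd, hU, hv, hg⟩ :=
      LPAFam.backward (M := M) (LPAMain.fam K V E s r) (LPAGraph.uniq_of_disjoint h)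
    exact LPAFam.fp_of_fd hU hv hg
end
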